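/- Every compact Hausdorff topological group whose underlying space is an ANE(4)-space is metrizable. -/

import Mathlib

open Topology

universe u

/-- A topological space `Z` has Lebesgue covering dimension at most `n`:
every finite open cover admits a finite open refinement in which each point
lies in at most `n + 1` members. -/
def CovDimLE (Z : Type u) [TopologicalSpace Z] (n : ℕ) : Prop :=
  ∀ 𝒰 : Finset (Set Z), (∀ U ∈ 𝒰, IsOpen U) → ⋃₀ (𝒰 : Set (Set Z)) = Set.univ →
    ∃ 𝒱 : Finset (Set Z), (∀ V ∈ 𝒱, IsOpen V) ∧ ⋃₀ (𝒱 : Set (Set Z)) = Set.univ ∧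
      (∀ V ∈ 𝒱, ∃ U ∈ 𝒰, V ⊆ U) ∧
      ∀ z : Z, Nat.card {V : Set Z // V ∈ 𝒱 ∧ z ∈ V} ≤ n + 1

/-- `X` is an absolute extensor in dimension `n` (an AE(n)-space): every continuous map
into `X` from a closed subspace of a compact Hausdorff space of covering dimension
at most `n` extends continuously over the whole space. -/
def IsAE (n : ℕ) (X : Type u) [TopologicalSpace X] : Prop :=
  ∀ (Z : Type u) [TopologicalSpace Z], CompactSpace Z → T2Space Z → CovDimLE Z n →
    ∀ Z₀ : Set Z, IsClosed Z₀ → ∀ g₀ : C(Z₀, X),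
      ∃ g : C(Z, X), ∀ z : Z₀, g (z : Z) = g₀ z

/-- `X` is an absolute neighborhood extensor in dimension `4` (an ANE(4)-space):
every continuous map into `X` from a closed subspace `Z₀` of a compact Hausdorff
space of covering dimension at most `4` extends continuously over some open
neighborhood of `Z₀`. -/
def IsANE4 (X : Type u) [TopologicalSpace X] : Prop :=
  ∀ (Z : Type u) [TopologicalSpace Z], CompactSpace Z → T2Space Z → CovDimLE Z 4 →
    ∀ Z₀ : Set Z, IsClosed Z₀ → ∀ g₀ : C(Z₀, X),
      ∃ (U : Set Z) (_ : IsOpen U) (hZ₀U : Z₀ ⊆ U) (g : C(U, X)),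
        ∀ (z : Z) (hz : z ∈ Z₀), g ⟨z, hZ₀U hz⟩ = g₀ ⟨z, hz⟩

/-- The underlying space of `X` is a topological manifold: every point has an open
neighborhood homeomorphic to an open subset of some Euclidean space. -/
def IsTopManifold (X : Type u) [TopologicalSpace X] : Prop :=
  ∀ x : X, ∃ (n : ℕ) (U : Set X) (V : Set (EuclideanSpace ℝ (Fin n))),
    IsOpen U ∧ x ∈ U ∧ IsOpen V ∧ Nonempty (U ≃ₜ V)

/-- The multiplicative equivalence `e` is an isomorphism of topological groups,
i.e. it is continuous with continuous inverse. -/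
def IsTopGroupIso {G H : Type*} [Group G] [Group H] [TopologicalSpace G]
    [TopologicalSpace H] (e : G ≃* H) : Prop :=
  Continuous e ∧ Continuous e.symm

/-- A package consisting of a compact Hausdorff topological group. -/
structure CompactGroupPkg : Type (u + 1) where
  carrier : Type u
  [topology : TopologicalSpace carrier]
  [group : Group carrier]
  [topGroup : IsTopologicalGroup carrier]
  [compact : CompactSpace carrier]
  [t2 : T2Space carrier]

attribute [instance] CompactGroupPkg.topology CompactGroupPkg.group
  CompactGroupPkg.topGroup CompactGroupPkg.compact CompactGroupPkg.t2

/-- `L` is a simple, connected and simply connected compact Lie group: a compact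
Hausdorff topological group whose underlying space is a topological manifold,
which is connected, simply connected, nonabelian, and all of whose closed
normal subgroups other than the whole group are finite. -/
def IsSimpleSCSCLieGroup (L : CompactGroupPkg.{u}) : Prop :=
  IsTopManifold L.carrier ∧ ConnectedSpace L.carrier ∧ SimplyConnectedSpace L.carrier ∧
    (∃ a b : L.carrier, a * b ≠ b * a) ∧
    ∀ N : Subgroup L.carrier, N.Normal → IsClosed (N : Set L.carrier) → N ≠ ⊤ → Finite N

universe v

/-- Finite open covers of `X` have subordinate partitions of unity of order at most five. -/
def HasThinPartitions (X : Type v) [TopologicalSpace X] : Prop :=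
  ∀ (ι : Type u) [Fintype ι] (U : ι → Set X), (∀ l, IsOpen (U l)) → (⋃ l, U l) = Set.univ →
    ∃ φ : ι → C(X, ℝ), (∀ l x, 0 ≤ φ l x) ∧ (∀ l x, φ l x ≠ 0 → x ∈ U l) ∧
      (∀ x, ∑ l, φ l x = 1) ∧ ∀ (T : Finset ι), T.card = 6 → ∀ x, ∏ l ∈ T, φ l x = 0

/-- The tent function supported on the unit interval starting at `m`. -/
noncomputable def tent (m : ℤ) (a : ℝ) : ℝ := max 0 (min (a - m) (m + 1 - a))

lemma continuous_tent (m : ℤ) : Continuous (tent m) := by unfold tent; fun_prop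

lemma tent_nonneg (m : ℤ) (a : ℝ) : 0 ≤ tent m a := le_max_left _ _

lemma tent_ne_zero_iff (m : ℤ) (a : ℝ) : tent m a ≠ 0 ↔ (m : ℝ) < a ∧ a < m + 1 := by
  unfold tent
  constructor
  · intro h
    have : 0 < min (a - m) (m + 1 - a) := by
      by_contra h'
      exact h (max_eq_left (not_lt.1 h'))
    constructor <;> [have := (lt_min_iff.1 this).1; have := (lt_min_iff.1 this).2] <;> linarith
  · rintro ⟨h1, h2⟩
    have : 0 < min (a - m) (m + 1 - a) := lt_min (by linarith) (by linarith)
    rw [max_eq_right this.le]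
    exact this.ne'

/-- The bump function of the brick with colour `c` and index `m`. -/
noncomputable def brick (c : Fin 5) (m : Fin 4 → ℤ) (y : Fin 4 → ℝ) : ℝ :=
  ∏ i, tent (m i) (y i - (c : ℕ) / 5)

lemma continuous_brick (c : Fin 5) (m : Fin 4 → ℤ) : Continuous (brick c m) := by
  unfold brick
  refine continuous_finsetProd _ fun i _ => (continuous_tent _).comp ?_
  fun_prop

lemma brick_nonneg (c : Fin 5) (m : Fin 4 → ℤ) (y) : 0 ≤ brick c m y :=
  Finset.prod_nonneg fun _ _ => tent_nonneg _ _

lemma brick_ne_zero_iff (c : Fin 5) (m : Fin 4 → ℤ) (y) :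
    brick c m y ≠ 0 ↔ ∀ i, (m i : ℝ) < y i - (c : ℕ) / 5 ∧ y i - (c : ℕ) / 5 < m i + 1 := by
  simp [brick, Finset.prod_ne_zero_iff, tent_ne_zero_iff]

lemma brick_unique {c : Fin 5} {m m' : Fin 4 → ℤ} {y} (h : brick c m y ≠ 0)
    (h' : brick c m' y ≠ 0) : m = m' := by
  rw [brick_ne_zero_iff] at h h'
  ext i
  obtain ⟨h1, h2⟩ := h i
  obtain ⟨h3, h4⟩ := h' i
  have a : m i < m' i + 1 := by exact_mod_cast h1.trans h4
  have b : m' i < m i + 1 := by exact_mod_cast h3.trans h2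
  omega

lemma exists_colour (y : Fin 4 → ℝ) : ∃ c : Fin 5, ∀ i (m : ℤ), y i - (c : ℕ) / 5 ≠ m := by
  by_contra! H
  choose f m hm using H
  obtain ⟨c, c', hne, hf⟩ := Fintype.exists_ne_map_eq_of_card_lt f (by simp)
  have h1 := hm c
  have h2 := hm c'
  rw [← hf] at h2
  have h3 : (((c' : ℕ) : ℝ) - (c : ℕ)) = 5 * (m c - m c') := by linarith
  have h4 : (((c' : ℕ) : ℤ) - (c : ℕ)) = 5 * (m c - m c') := by exact_mod_cast h3
  apply hne
  ext
  have := c.2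
  have := c'.2
  omega

lemma exists_brick_ne_zero (y : Fin 4 → ℝ) :
    ∃ c : Fin 5, ∃ m : Fin 4 → ℤ, brick c m y ≠ 0 := by
  obtain ⟨c, hc⟩ := exists_colour y
  refine ⟨c, fun i => ⌊y i - (c : ℕ) / 5⌋, (brick_ne_zero_iff _ _ _).2 fun i => ⟨?_, ?_⟩⟩
  · exact lt_of_le_of_ne (Int.floor_le _) (hc i _).symm
  · exact Int.lt_floor_add_one _

lemma exists_scale {X : Type*} [UniformSpace X] [CompactSpace X] [T2Space X]
    (p : ℕ → X → Fin 4 → ℝ) (hp : ∀ k, Continuous (p k))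
    (hdir : ∀ j k, j ≤ k → ∀ x y, p k x = p k y → p j x = p j y)
    (hsep : ∀ x y, (∀ k, p k x = p k y) → x = y)
    {ι : Type*} (U : ι → Set X) (hU : ∀ l, IsOpen (U l)) (hcov : (⋃ l, U l) = Set.univ) :
    ∃ k, ∃ δ > 0, ∀ x, ∃ l, ∀ x', dist (p k x) (p k x') ≤ δ → x' ∈ U l := by
  obtain ⟨V', hV', hVU'⟩ := lebesgue_number_lemma (K := Set.univ) isCompact_univ hU hcov.ge
  obtain ⟨V, hV, hVo, hVV⟩ : ∃ V ∈ uniformity X, IsOpen V ∧ V ⊆ V' :=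
    ⟨interior V', interior_mem_uniformity hV', isOpen_interior, interior_subset⟩
  have key1 : ∃ k, {z : X × X | p k z.1 = p k z.2} ⊆ V := by
    refine exists_subset_nhds_of_compactSpace (V := fun k => {z : X × X | p k z.1 = p k z.2})
      ?_ ?_ ?_
    · intro i j
      refine ⟨max i j, fun z hz => hdir _ _ (le_max_left _ _) _ _ hz,
        fun z hz => hdir _ _ (le_max_right _ _) _ _ hz⟩
    · intro k
      exact isClosed_eq ((hp k).comp continuous_fst) ((hp k).comp continuous_snd)
    · intro z hz
      have : z.1 = z.2 := hsep _ _ (by simpa using hz)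
      obtain ⟨a, b⟩ := z
      obtain rfl : a = b := this
      exact nhds_le_uniformity _ hV
  obtain ⟨k, hk⟩ := key1
  have hpos : ∀ n : ℕ, (0 : ℝ) < 1 / (n + 1 : ℝ) := fun n => by positivity
  have key2 : ∃ n : ℕ, {z : X × X | dist (p k z.1) (p k z.2) ≤ 1 / (n + 1 : ℝ)} ⊆ V := by
    refine exists_subset_nhds_of_compactSpace
      (V := fun n : ℕ => {z : X × X | dist (p k z.1) (p k z.2) ≤ 1 / (n + 1 : ℝ)}) ?_ ?_ ?_
    · refine directed_of_isDirected_le fun i j hij z hz =>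
      (show dist _ _ ≤ _ from hz).trans ?_
      exact Nat.one_div_le_one_div hij
    · intro n
      exact isClosed_le (((hp k).comp continuous_fst).dist ((hp k).comp continuous_snd))
        continuous_const
    · intro z hz
      refine hVo.mem_nhds (hk ?_)
      refine dist_le_zero.1 (ge_of_tendsto' tendsto_one_div_add_atTop_nhds_zero_nat fun n => ?_)
      exact Set.mem_iInter.1 hz n
  obtain ⟨n, hn⟩ := key2
  refine ⟨k, 1 / (n + 1 : ℝ), hpos n, fun x => ?_⟩
  obtain ⟨l, hl⟩ := hVU' x trivial
  exact ⟨l, fun x' hx' => hl (hVV (hn hx'))⟩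

theorem hasThinPartitions_of_maps {X : Type v} [UniformSpace X] [CompactSpace X] [T2Space X]
    (p : ℕ → X → Fin 4 → ℝ) (hp : ∀ k, Continuous (p k))
    (hdir : ∀ j k, j ≤ k → ∀ x y, p k x = p k y → p j x = p j y)
    (hsep : ∀ x y, (∀ k, p k x = p k y) → x = y) : HasThinPartitions.{u} X := by
  classical
  intro ι _ U hU hcov
  rcases isEmpty_or_nonempty X with hX | hX
  · exact ⟨fun _ => 0, fun _ _ => le_rfl, fun _ x => (hX.false x).elim,
      fun x => (hX.false x).elim, fun _ _ x => (hX.false x).elim⟩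
  obtain ⟨k, δ, hδ, hk⟩ := exists_scale p hp hdir hsep U hU hcov
  obtain ⟨M, hM⟩ : ∃ M : ℝ, 1 / δ < M := exists_gt _
  have hM0 : 0 < M := lt_trans (by positivity) hM
  have hMδ : 1 / M < δ := by
    rw [div_lt_iff₀ hM0]; rw [div_lt_iff₀ hδ] at hM; linarith
  -- the scaled map
  set q : X → Fin 4 → ℝ := fun x => M • p k x with hq
  have hqc : Continuous q := (hp k).const_smul M
  have hbr : ∀ c m x x', brick c m (q x) ≠ 0 → brick c m (q x') ≠ 0 →
      dist (p k x) (p k x') ≤ δ := by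
    intro c m x x' h h'
    rw [brick_ne_zero_iff] at h h'
    refine le_trans ((dist_pi_le_iff (by positivity)).2 fun i => ?_) hMδ.le
    obtain ⟨h1, h2⟩ := h i
    obtain ⟨h3, h4⟩ := h' i
    simp only [hq, Pi.smul_apply, smul_eq_mul] at h1 h2 h3 h4
    rw [Real.dist_eq, le_div_iff₀ hM0, ← abs_of_pos hM0, ← abs_mul, abs_le]
    constructor <;> nlinarith
  have hassign : ∀ cm : Fin 5 × (Fin 4 → ℤ), ∃ l : ι,
      ∀ x, brick cm.1 cm.2 (q x) ≠ 0 → x ∈ U l := by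
    intro cm
    by_cases hx : ∃ x, brick cm.1 cm.2 (q x) ≠ 0
    · obtain ⟨x, hx⟩ := hx
      obtain ⟨l, hl⟩ := hk x
      exact ⟨l, fun x' hx' => hl x' (hbr _ _ _ _ hx hx')⟩
    · push Not at hx
      obtain ⟨l, -⟩ := hk (Classical.arbitrary X)
      exact ⟨l, fun x' hx' => absurd (hx x') hx'⟩
  choose as has using hassign
  obtain ⟨N, hN⟩ : ∃ N : ℤ, ∀ c m x, brick c m (q x) ≠ 0 →
      m ∈ Fintype.piFinset fun _ : Fin 4 => Finset.Icc (-N) N := by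
    obtain ⟨B, hB⟩ := (isCompact_range hqc).isBounded.exists_norm_le
    refine ⟨⌈B⌉ + 2, fun c m x h => ?_⟩
    rw [brick_ne_zero_iff] at h
    rw [Fintype.mem_piFinset]
    intro i
    obtain ⟨h1, h2⟩ := h i
    have h3 := abs_le.1 ((norm_le_pi_norm (q x) i).trans (hB _ ⟨x, rfl⟩))
    have h4 : ((c : ℕ) : ℝ) / 5 ≤ 1 := by
      rw [div_le_one (by norm_num)]
      exact_mod_cast c.2.le
    have h5 : 0 ≤ ((c : ℕ) : ℝ) / 5 := by positivity
    have h6 := Int.le_ceil B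
    rw [Finset.mem_Icc]
    constructor
    · have : (-(⌈B⌉ + 2 : ℤ) : ℝ) ≤ (m i : ℝ) := by push_cast; linarith [h3.1]
      exact_mod_cast this
    · have : (m i : ℝ) ≤ ((⌈B⌉ + 2 : ℤ) : ℝ) := by push_cast; linarith [h3.2]
      exact_mod_cast this
  set S : Finset (Fin 5 × (Fin 4 → ℤ)) :=
    Finset.univ ×ˢ Fintype.piFinset fun _ : Fin 4 => Finset.Icc (-N) N with hS
  set ψ : ι → X → ℝ := fun l x => ∑ cm ∈ S with as cm = l, brick cm.1 cm.2 (q x) with hψ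
  have hψc : ∀ l, Continuous (ψ l) := fun l =>
    continuous_finsetSum _ fun cm _ => (continuous_brick _ _).comp hqc
  have hψ0 : ∀ l x, 0 ≤ ψ l x := fun l x => Finset.sum_nonneg fun _ _ => brick_nonneg _ _ _
  have hψn : ∀ l x, ψ l x ≠ 0 → ∃ cm, as cm = l ∧ brick cm.1 cm.2 (q x) ≠ 0 := by
    intro l x h
    obtain ⟨cm, h1, h2⟩ := Finset.exists_ne_zero_of_sum_ne_zero h
    exact ⟨cm, (Finset.mem_filter.1 h1).2, h2⟩
  have hsum : ∀ x, 0 < ∑ l, ψ l x := by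
    intro x
    obtain ⟨c, m, h⟩ := exists_brick_ne_zero (q x)
    refine Finset.sum_pos' (fun l _ => hψ0 l x) ⟨as (c, m), Finset.mem_univ _, ?_⟩
    refine Finset.sum_pos' (fun _ _ => brick_nonneg _ _ _) ⟨(c, m), ?_, ?_⟩
    · simp only [Finset.mem_filter, and_true, hS, Finset.mem_product, Finset.mem_univ, true_and]
      exact hN c m x h
    · exact lt_of_le_of_ne (brick_nonneg _ _ _) h.symm
  refine ⟨fun l => ⟨fun x => ψ l x / ∑ l', ψ l' x, (hψc l).div
    (continuous_finsetSum _ fun l' _ => hψc l') fun x => (hsum x).ne'⟩, ?_, ?_, ?_, ?_⟩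
  · intro l x
    exact div_nonneg (hψ0 l x) (hsum x).le
  · intro l x h
    obtain ⟨cm, rfl, h2⟩ := hψn l x (left_ne_zero_of_mul h)
    exact has cm x h2
  · intro x
    simp only [ContinuousMap.coe_mk, ← Finset.sum_div]
    exact div_self (hsum x).ne'
  · intro T hT x
    by_contra hne
    rw [Finset.prod_eq_zero_iff] at hne
    push Not at hne
    have hex : ∀ l : T, ∃ cm, as cm = l ∧ brick cm.1 cm.2 (q x) ≠ 0 := fun l =>
      hψn l x (left_ne_zero_of_mul (hne l l.2))
    choose cm hcm1 hcm2 using hex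
    obtain ⟨a, b, hab, hc⟩ := Fintype.exists_ne_map_eq_of_card_lt (fun l : T => (cm l).1)
      (by simp [hT])
    apply hab
    have hm : (cm a).2 = (cm b).2 := by
      refine brick_unique (hcm2 a) ?_
      have := hcm2 b
      rwa [← hc] at this
    ext
    rw [← hcm1 a, ← hcm1 b, Prod.ext hc hm]

theorem covDimLE_stoneCech {I : Type u} [TopologicalSpace I] [DiscreteTopology I] {X : Type}
    [TopologicalSpace X] [CompactSpace X] (hX : HasThinPartitions.{u} X) :
    CovDimLE (StoneCech (I × X)) 4 := by
  classical
  let Z := StoneCech (I × X)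
  change CovDimLE Z 4
  intro 𝒰 hopen hcov
  obtain ⟨u', hu'c, hu'o, hu'⟩ := exists_iUnion_eq_closure_subset (u := fun U : 𝒰 => (U : Set Z))
    (fun U => hopen U U.2) (fun x => Set.toFinite _) (by
      rw [Set.sUnion_eq_iUnion] at hcov
      exact hcov)
  have hun : Continuous (stoneCechUnit : I × X → Z) := continuous_stoneCechUnit
  have hpart : ∀ i : I, ∃ φ : 𝒰 → C(X, ℝ), (∀ l x, 0 ≤ φ l x) ∧
      (∀ l x, φ l x ≠ 0 → stoneCechUnit (i, x) ∈ u' l) ∧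
      (∀ x, ∑ l, φ l x = 1) ∧ ∀ (T : Finset 𝒰), T.card = 6 → ∀ x, ∏ l ∈ T, φ l x = 0 := by
    intro i
    refine hX 𝒰 (fun l => {x | stoneCechUnit (i, x) ∈ u' l})
      (fun l => (hu'o l).preimage (hun.comp (Continuous.prodMk_right i))) ?_
    ext x
    have : (stoneCechUnit (i, x) : Z) ∈ ⋃ l, u' l := hu'c ▸ trivial
    simpa using this
  choose φ h0 hsup hsum hprod using hpart
  have hle : ∀ i l x, φ i l x ≤ 1 := fun i l x => by
    rw [← hsum i x]
    exact Finset.single_le_sum (fun l _ => h0 i l x) (Finset.mem_univ l)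
  have hφc : ∀ l, Continuous fun z : I × X => (⟨φ z.1 l z.2, h0 _ _ _, hle _ _ _⟩ : unitInterval) := by
    intro l
    refine Continuous.subtype_mk ?_ _
    exact continuous_prod_of_discrete_left.2 fun i => (φ i l).continuous
  set Φ : 𝒰 → Z → ℝ := fun l z => ((stoneCechExtend (hφc l) z : unitInterval) : ℝ) with hΦ
  have hΦc : ∀ l, Continuous (Φ l) := fun l =>
    continuous_subtype_val.comp (continuous_stoneCechExtend _)
  have hΦu : ∀ l i x, Φ l (stoneCechUnit (i, x)) = φ i l x := fun l i x => by
    simp only [hΦ]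
    rw [stoneCechExtend_stoneCechUnit]
  have hd : DenseRange (stoneCechUnit : I × X → Z) := denseRange_stoneCechUnit
  have hΦsum : ∀ z, ∑ l, Φ l z = 1 := by
    intro z
    refine congrFun (hd.equalizer (continuous_finsetSum _ fun l _ => hΦc l) continuous_const ?_) z
    ext ⟨i, x⟩
    simpa [hΦu] using hsum i x
  have hΦprod : ∀ (T : Finset 𝒰), T.card = 6 → ∀ z, ∏ l ∈ T, Φ l z = 0 := by
    intro T hT z
    refine congrFun (hd.equalizer (continuous_finsetProd _ fun l _ => hΦc l) continuous_const ?_) z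
    ext ⟨i, x⟩
    simp [hΦu, hprod _ T hT]
  have hO : ∀ l, IsOpen {z | Φ l z ≠ 0} := fun l => isOpen_ne_fun (hΦc l) continuous_const
  refine ⟨Finset.univ.image fun l => {z | Φ l z ≠ 0}, ?_, ?_, ?_, ?_⟩
  · intro V hV
    obtain ⟨l, -, rfl⟩ := Finset.mem_image.1 hV
    exact hO l
  · rw [Set.eq_univ_iff_forall]
    intro z
    obtain ⟨l, -, hl⟩ := Finset.exists_ne_zero_of_sum_ne_zero ((hΦsum z).trans_ne one_ne_zero)
    exact ⟨_, by simpa using ⟨l.1, l.2, rfl⟩, hl⟩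
  · intro V hV
    obtain ⟨l, -, rfl⟩ := Finset.mem_image.1 hV
    refine ⟨l, l.2, (hd.open_subset_closure_inter (hO l)).trans ((closure_mono ?_).trans (hu' l))⟩
    rintro _ ⟨hz, ⟨i, x⟩, rfl⟩
    exact hsup i l x fun h => hz ((hΦu l i x).trans h)
  · intro z
    have hT : (Finset.univ.filter fun l => Φ l z ≠ 0).card ≤ 5 := by
      by_contra! h
      obtain ⟨T, hT, hc⟩ := Finset.exists_subset_card_eq (Nat.succ_le_of_lt h)
      refine Finset.prod_ne_zero_iff.2 (fun l hl => ?_) (hΦprod T hc z)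
      exact (Finset.mem_filter.1 (hT hl)).2
    refine le_trans ?_ hT
    rw [← Fintype.card_coe, ← Nat.card_eq_fintype_card]
    refine Nat.card_le_card_of_surjective
      (fun l => ⟨{z | Φ l.1 z ≠ 0}, Finset.mem_image_of_mem _ (Finset.mem_univ _),
        (Finset.mem_filter.1 l.2).2⟩) ?_
    rintro ⟨V, hV, hz⟩
    obtain ⟨l, -, rfl⟩ := Finset.mem_image.1 hV
    exact ⟨⟨l, Finset.mem_filter.2 ⟨Finset.mem_univ _, hz⟩⟩, rfl⟩

/-- The evaluation map of a space into a cube. -/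
def cubeMap (G : Type u) [TopologicalSpace G] (x : G) (k : C(G, unitInterval)) : unitInterval := k x

lemma isClosedEmbedding_cubeMap (G : Type u) [TopologicalSpace G] [CompactSpace G] [T2Space G] :
    IsClosedEmbedding (cubeMap G) := by
  refine Continuous.isClosedEmbedding (continuous_pi fun k => k.continuous) fun x y hxy => ?_
  by_contra hne
  obtain ⟨k, hk0, hk1, hk⟩ := exists_continuous_zero_one_of_isClosed (isClosed_singleton (x := x))
    (isClosed_singleton (x := y)) (by simpa using hne)
  have := congrFun hxy ⟨fun z => ⟨k z, hk z⟩, by fun_prop⟩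
  have h2 : k x = k y := congrArg Subtype.val this
  rw [hk0 rfl, hk1 rfl] at h2
  exact zero_ne_one h2

theorem exists_small_extension {G : Type u} [Group G] [TopologicalSpace G] [IsTopologicalGroup G]
    [CompactSpace G] [T2Space G] (hG : IsANE4 G) {X : Type} [TopologicalSpace X] [CompactSpace X]
    [T2Space X] (hX : HasThinPartitions.{u} X) {V : Set G} (hV : V ∈ 𝓝 (1 : G)) :
    ∃ V' ∈ 𝓝 (1 : G), ∀ (K : Set X) (f : X → G), IsClosed K → ContinuousOn f K →
      (∀ x ∈ K, f x ∈ V') → ∃ F : C(X, G), (∀ x, F x ∈ V) ∧ ∀ x ∈ K, F x = f x := by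
  classical
  by_contra! H
  let I : Type u := {V' : Set G // V' ∈ 𝓝 (1 : G)}
  let _ : TopologicalSpace I := ⊥
  have : DiscreteTopology I := ⟨rfl⟩
  have H' : ∀ i : I, ∃ (K : Set X) (f : X → G), IsClosed K ∧ ContinuousOn f K ∧
      (∀ x ∈ K, f x ∈ i.1) ∧ ∀ F : C(X, G), (∀ x, F x ∈ V) → ∃ x ∈ K, F x ≠ f x :=
    fun i => H i.1 i.2
  choose K f hK hf hfV hbad using H'
  have hι := isClosedEmbedding_cubeMap G
  have hinj := hι.injective
  have htie : ∀ i, ∃ Ψ : C(X, C(G, unitInterval) → unitInterval),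
      ∀ x ∈ K i, Ψ x = cubeMap G (f i x) := by
    intro i
    obtain ⟨Ψ, hΨ⟩ := ContinuousMap.exists_restrict_eq (hK i)
      (⟨fun x : K i => cubeMap G (f i x), hι.continuous.comp (hf i).domRestrict⟩ :
        C(K i, C(G, unitInterval) → unitInterval))
    exact ⟨Ψ, fun x hx => DFunLike.congr_fun hΨ ⟨x, hx⟩⟩
  choose Ψ hΨ using htie
  let Z := StoneCech (I × X)
  have hZ : CovDimLE Z 4 := covDimLE_stoneCech hX
  have hun : Continuous (stoneCechUnit : I × X → Z) := continuous_stoneCechUnit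
  have hΨc : Continuous fun z : I × X => Ψ z.1 z.2 :=
    continuous_prod_of_discrete_left.2 fun i => (Ψ i).continuous
  let Ψh : Z → C(G, unitInterval) → unitInterval := stoneCechExtend hΨc
  have hΨh : Continuous Ψh := continuous_stoneCechExtend hΨc
  have hΨhu : ∀ i x, Ψh (stoneCechUnit (i, x)) = Ψ i x :=
    fun i x => stoneCechExtend_stoneCechUnit hΨc (i, x)
  let A : Set Z := stoneCechUnit '' {z : I × X | z.2 ∈ K z.1}
  have hΨA : ∀ i, ∀ x ∈ K i, Ψh (stoneCechUnit (i, x)) = cubeMap G (f i x) :=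
    fun i x hx => (hΨhu i x).trans (hΨ i x hx)
  have hπc : Continuous fun z : I × X => (pure z.1 : Ultrafilter I) :=
    continuous_of_discreteTopology.comp continuous_fst
  let π : Z → Ultrafilter I := stoneCechExtend hπc
  have hπ : Continuous π := continuous_stoneCechExtend hπc
  have hπu : ∀ i x, π (stoneCechUnit (i, x)) = pure i :=
    fun i x => stoneCechExtend_stoneCechUnit hπc (i, x)
  let T : I → Set Z := fun i => {z | {j : I | j.1 ⊆ i.1} ∈ π z}
  have hTo : ∀ i, IsOpen (T i) := fun i => (ultrafilter_isOpen_basic _).preimage hπ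
  have hTc : ∀ i, IsClosed (T i) := fun i => (ultrafilter_isClosed_basic _).preimage hπ
  have hTu : ∀ i j x, stoneCechUnit (j, x) ∈ T i ↔ j.1 ⊆ i.1 := by
    intro i j x
    change _ ∈ π _ ↔ _
    rw [hπu]
    exact Ultrafilter.mem_pure
  have hrange : ∀ z ∈ closure A, Ψh z ∈ Set.range (cubeMap G) := by
    refine closure_minimal ?_ (hι.isClosed_range.preimage hΨh)
    rintro _ ⟨⟨i, x⟩, hx, rfl⟩
    exact ⟨f i x, (hΨA i x hx).symm⟩
  let r : (C(G, unitInterval) → unitInterval) → G := Function.invFun (cubeMap G)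
  have hr : ∀ y, r (cubeMap G y) = y := Function.leftInverse_invFun hinj
  have hr' : ∀ z ∈ closure A, cubeMap G (r (Ψh z)) = Ψh z := by
    intro z hz
    obtain ⟨y, hy⟩ := hrange z hz
    rw [← hy, hr]
  have hone : ∀ z ∈ closure A, (∀ i, z ∈ T i) → r (Ψh z) = 1 := by
    intro z hz hT
    by_contra hne
    obtain ⟨W, hW, hWc, hWs⟩ := exists_mem_nhds_isClosed_subset
      (isOpen_compl_singleton.mem_nhds (Ne.symm hne : (1 : G) ≠ r (Ψh z)))
    have h1 : z ∈ closure (T ⟨W, hW⟩ ∩ A) := (hTo _).inter_closure ⟨hT _, hz⟩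
    have h2 : Ψh z ∈ cubeMap G '' W := by
      refine closure_minimal ?_ ((hι.isClosedMap W hWc).preimage hΨh) h1
      rintro _ ⟨hzT, ⟨i, x⟩, hx, rfl⟩
      exact ⟨f i x, (hTu _ _ _).1 hzT (hfV i x hx), (hΨA i x hx).symm⟩
    obtain ⟨w, hw, hwz⟩ := h2
    refine hWs hw ?_
    rw [Set.mem_singleton_iff, ← hwz, hr]
  let g₀ : Z → G := fun z => if z ∈ closure A then r (Ψh z) else 1
  have hg₀ : ContinuousOn g₀ (closure A ∪ ⋂ i, T i) := by
    refine ContinuousOn.union_of_isClosed ?_ ?_ isClosed_closure (isClosed_iInter hTc)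
    · rw [hι.isInducing.continuousOn_iff]
      refine hΨh.continuousOn.congr fun z hz => ?_
      simp only [g₀, Function.comp, if_pos hz]
      exact hr' z hz
    · refine continuousOn_const (c := (1 : G)) |>.congr fun z hz => ?_
      by_cases hz' : z ∈ closure A
      · simp only [g₀, if_pos hz']
        exact hone z hz' (Set.mem_iInter.1 hz)
      · simp only [g₀, if_neg hz']
  obtain ⟨U, hU, hsub, g, hg⟩ := hG Z inferInstance inferInstance hZ _
    (isClosed_closure.union (isClosed_iInter hTc)) ⟨_, hg₀.domRestrict⟩
  let O : Set Z := Subtype.val '' (g ⁻¹' interior V)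
  have hO : IsOpen O := hU.isOpenMap_subtype_val _ (isOpen_interior.preimage g.continuous)
  have hTO : ∃ i, T i ⊆ O := by
    have : Nonempty I := ⟨⟨Set.univ, Filter.univ_mem⟩⟩
    refine exists_subset_nhds_of_compactSpace ?_ hTc fun z hz => hO.mem_nhds ?_
    · intro i j
      refine ⟨⟨i.1 ∩ j.1, Filter.inter_mem i.2 j.2⟩, fun z hz => ?_, fun z hz => ?_⟩
      · exact Filter.mem_of_superset hz fun k hk => hk.trans Set.inter_subset_left
      · exact Filter.mem_of_superset hz fun k hk => hk.trans Set.inter_subset_right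
    · refine ⟨⟨z, hsub (Or.inr hz)⟩, ?_, rfl⟩
      have h1 : g₀ z = 1 := by
        by_cases hz' : z ∈ closure A
        · simp only [g₀, if_pos hz']
          exact hone z hz' (Set.mem_iInter.1 hz)
        · simp only [g₀, if_neg hz']
      have h2 := hg z (Or.inr hz)
      change _ = g₀ z at h2
      rw [Set.mem_preimage, h2, h1]
      exact mem_interior_iff_mem_nhds.2 hV
  obtain ⟨i, hi⟩ := hTO
  have hmem : ∀ x, (stoneCechUnit (i, x) : Z) ∈ O := fun x => hi ((hTu _ _ _).2 subset_rfl)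
  have hOU : O ⊆ U := by rintro _ ⟨z, -, rfl⟩; exact z.2
  obtain ⟨x, hx, hne⟩ := hbad i
    ⟨fun x => g ⟨stoneCechUnit (i, x), hOU (hmem x)⟩, g.continuous.comp
      ((hun.comp (Continuous.prodMk_right i)).subtype_mk _)⟩ fun x => by
      obtain ⟨z, hz, hzx⟩ := hmem x
      have : z = ⟨stoneCechUnit (i, x), hOU (hmem x)⟩ := Subtype.ext hzx
      rw [this] at hz
      exact interior_subset hz
  apply hne
  have hxA : (stoneCechUnit (i, x) : Z) ∈ closure A := subset_closure ⟨(i, x), hx, rfl⟩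
  refine (hg (stoneCechUnit (i, x)) (Or.inl hxA)).trans ?_
  change g₀ _ = _
  simp only [g₀, if_pos hxA]
  rw [hΨA i x hx, hr]

/-- The closed cone over the rational solenoid, as the multiplicative monoid of the functions
`r • s` where `r` lies in the unit interval and `s` is a unitary character of `ℚ`. -/
def solenoidCone : Submonoid (ℚ → ℂ) where
  carrier := {f | f 0 = (‖f 0‖ : ℂ) ∧ ‖f 0‖ ≤ 1 ∧ (∀ p q, f p * f q = f (p + q) * f 0) ∧
    ∀ p, f (-p) = star (f p)}
  one_mem' := by simp
  mul_mem' := by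
    rintro f g ⟨hf1, hf2, hf3, hf4⟩ ⟨hg1, hg2, hg3, hg4⟩
    refine ⟨?_, ?_, fun p q => ?_, fun p => ?_⟩
    · simp only [Pi.mul_apply, norm_mul, Complex.ofReal_mul, ← hf1, ← hg1]
    · simp only [Pi.mul_apply, norm_mul]
      exact mul_le_one₀ hf2 (norm_nonneg _) hg2
    · simp only [Pi.mul_apply]
      linear_combination f p * f q * hg3 p q + g (p + q) * g 0 * hf3 p q
    · simp only [Pi.mul_apply, hf4, hg4, star_mul']

/-- The points of the cone over the rational solenoid. -/
abbrev SolCone : Type := solenoidCone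

namespace SolCone

instance : CoeFun SolCone fun _ => ℚ → ℂ := ⟨Subtype.val⟩

lemma mul_apply (x y : SolCone) (q : ℚ) : (x * y) q = x q * y q := rfl

lemma one_apply (q : ℚ) : (1 : SolCone) q = 1 := rfl

lemma continuous_apply (q : ℚ) : Continuous fun x : SolCone => x q :=
  (_root_.continuous_apply q).comp continuous_subtype_val

lemma continuous_iff {Y : Type*} [TopologicalSpace Y] {f : Y → SolCone} :
    Continuous f ↔ ∀ q, Continuous fun y => f y q := by
  rw [continuous_induced_rng, continuous_pi_iff]
  rfl

lemma ext {x y : SolCone} (h : ∀ q, x q = y q) : x = y := Subtype.ext (funext h)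

lemma apply_zero_eq (x : SolCone) : x 0 = (‖x 0‖ : ℂ) := x.2.1

lemma norm_zero_le (x : SolCone) : ‖x 0‖ ≤ 1 := x.2.2.1

lemma apply_mul (x : SolCone) (p q : ℚ) : x p * x q = x (p + q) * x 0 := x.2.2.2.1 p q

lemma apply_neg (x : SolCone) (p : ℚ) : x (-p) = star (x p) := x.2.2.2.2 p

lemma norm_apply (x : SolCone) (p : ℚ) : ‖x p‖ = ‖x 0‖ := by
  have h := congrArg norm (x.apply_mul p (-p))
  rw [add_neg_cancel, norm_mul, norm_mul, apply_neg, norm_star] at h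
  exact (mul_self_inj (norm_nonneg _) (norm_nonneg _)).1 h

lemma norm_apply_le (x : SolCone) (p : ℚ) : ‖x p‖ ≤ 1 := (x.norm_apply p).trans_le x.norm_zero_le

lemma apply_add {x : SolCone} (hx : x 0 = 1) (p q : ℚ) : x (p + q) = x p * x q := by
  rw [apply_mul, hx, mul_one]

lemma apply_mul_star {x : SolCone} (hx : x 0 = 1) (p : ℚ) : x p * star (x p) = 1 := by
  rw [← apply_neg, ← apply_add hx, add_neg_cancel, hx]

/-- Pointwise complex conjugation on the cone. -/
def conj (x : SolCone) : SolCone := ⟨star x.1, by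
  refine ⟨?_, ?_, fun p q => ?_, fun p => ?_⟩
  · have := x.apply_zero_eq
    rw [Pi.star_apply, norm_star]
    conv_lhs => rw [this]
    exact Complex.conj_ofReal _
  · simpa using x.norm_zero_le
  · change star (x p) * star (x q) = star (x (p + q)) * star (x 0)
    rw [← star_mul', ← star_mul', x.apply_mul]
  · exact congrArg star (x.apply_neg p)⟩

lemma conj_apply (x : SolCone) (q : ℚ) : x.conj q = star (x q) := rfl

lemma continuous_conj : Continuous conj :=
  continuous_iff.2 fun q => (continuous_apply q).star

lemma conj_apply_zero {x : SolCone} (hx : x 0 = 1) : x.conj 0 = 1 := by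
  rw [conj_apply, hx, star_one]

lemma mul_conj {x : SolCone} (hx : x 0 = 1) : x * x.conj = 1 :=
  ext fun q => by rw [mul_apply, conj_apply, apply_mul_star hx, one_apply]

lemma conj_mul (x y : SolCone) : (x * y).conj = x.conj * y.conj :=
  ext fun q => by simp only [mul_apply, conj_apply, star_mul']

lemma mul_apply_zero {x y : SolCone} (hx : x 0 = 1) (hy : y 0 = 1) : (x * y) 0 = 1 := by
  rw [mul_apply, hx, hy, one_mul]

lemma isClosed : IsClosed (solenoidCone : Set (ℚ → ℂ)) := by
  have h : ∀ q : ℚ, Continuous fun f : ℚ → ℂ => f q := fun q => _root_.continuous_apply q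
  have h3 : IsClosed {f : ℚ → ℂ | ∀ p q, f p * f q = f (p + q) * f 0} := by
    simp only [Set.ofPred_forall]
    exact isClosed_iInter fun p => isClosed_iInter fun q =>
      isClosed_eq ((h p).mul (h q)) ((h _).mul (h 0))
  have h4 : IsClosed {f : ℚ → ℂ | ∀ p, f (-p) = star (f p)} := by
    simp only [Set.ofPred_forall]
    exact isClosed_iInter fun p => isClosed_eq (h _) (h p).star
  exact (isClosed_eq (h 0) (Complex.continuous_ofReal.comp (h 0).norm)).inter
    ((isClosed_le (h 0).norm continuous_const).inter (h3.inter h4))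

instance : CompactSpace SolCone := by
  refine isCompact_iff_compactSpace.1 (IsCompact.of_isClosed_subset
    (isCompact_univ_pi fun _ : ℚ => isCompact_closedBall (0 : ℂ) 1) isClosed fun f hf q _ => ?_)
  rw [mem_closedBall_zero_iff]
  exact norm_apply_le ⟨f, hf⟩ q

/-- The point of the cone with radius `t` and the character with frequency `a`. -/
noncomputable def mk (t : unitInterval) (a : ℝ) : SolCone :=
  ⟨fun q => (t : ℝ) * Complex.exp (2 * Real.pi * Complex.I * (q * a)), by
    refine ⟨?_, ?_, fun p q => ?_, fun p => ?_⟩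
    · simp [abs_of_nonneg t.2.1]
    · simpa [abs_of_nonneg t.2.1] using t.2.2
    · simp only [Rat.cast_add, add_mul, mul_add, Complex.exp_add, Rat.cast_zero, zero_mul,
        mul_zero, Complex.exp_zero]
      ring
    · simp only [star_mul', Complex.star_def, Complex.conj_ofReal, ← Complex.exp_conj, map_mul,
        Complex.conj_I, map_ofNat, Rat.cast_neg]
      congr 2
      simp⟩

lemma mk_apply (t : unitInterval) (a : ℝ) (q : ℚ) :
    mk t a q = (t : ℝ) * Complex.exp (2 * Real.pi * Complex.I * (q * a)) := rfl

lemma apply_natCast_mul_eq {x y : SolCone} {q : ℚ} (h : x q = y q) (n : ℕ) :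
    x (n * q) = y (n * q) := by
  have h0 : x 0 = y 0 := by
    rw [x.apply_zero_eq, y.apply_zero_eq, ← norm_apply x q, ← norm_apply y q, h]
  induction n with
  | zero => simpa using h0
  | succ n ih =>
    have e : ((n + 1 : ℕ) : ℚ) * q = n * q + q := by push_cast; ring
    rw [e]
    by_cases hx : x 0 = 0
    · have h1 : x (n * q + q) = 0 := by rw [← norm_eq_zero, norm_apply, hx, norm_zero]
      have h2 : y (n * q + q) = 0 := by rw [← norm_eq_zero, norm_apply, ← h0, hx, norm_zero]
      rw [h1, h2]
    · refine mul_right_cancel₀ hx ?_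
      rw [← apply_mul, h0, ← apply_mul, ih, h]

lemma eq_of_apply_factorial {x y : SolCone} {j k : ℕ} (hjk : j ≤ k)
    (h : x (1 / k.factorial) = y (1 / k.factorial)) :
    x (1 / j.factorial) = y (1 / j.factorial) := by
  obtain ⟨n, hn⟩ := Nat.factorial_dvd_factorial hjk
  have : (1 / j.factorial : ℚ) = n * (1 / k.factorial) := by
    rw [hn]
    have h1 : (j.factorial : ℚ) ≠ 0 := by positivity
    have h2 : (n : ℚ) ≠ 0 := by
      rintro h
      have : n = 0 := by exact_mod_cast h
      rw [this, mul_zero] at hn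
      exact k.factorial_ne_zero hn
    push_cast
    field_simp
  rw [this]
  exact apply_natCast_mul_eq h n

lemma eq_of_forall_apply_factorial {x y : SolCone}
    (h : ∀ k : ℕ, x (1 / k.factorial) = y (1 / k.factorial)) : x = y := by
  have key : ∀ (n d : ℕ), 0 < d → x (n / d : ℚ) = y (n / d : ℚ) := by
    intro n d hd
    obtain ⟨m, hm⟩ := Nat.dvd_factorial hd le_rfl
    have : (n / d : ℚ) = (n * m : ℕ) * (1 / d.factorial) := by
      have h1 : (d : ℚ) ≠ 0 := by positivity
      have h2 : (m : ℚ) ≠ 0 := by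
        rintro h
        have : m = 0 := by exact_mod_cast h
        rw [this, mul_zero] at hm
        exact d.factorial_ne_zero hm
      rw [hm]
      push_cast
      field_simp
    rw [this]
    exact apply_natCast_mul_eq (h d) _
  refine ext fun q => ?_
  rcases le_total 0 q with hq | hq
  · have := key q.num.toNat q.den q.den_pos
    have e : ((q.num.toNat : ℕ) : ℚ) = (q.num : ℚ) := by
      have : ((q.num.toNat : ℕ) : ℤ) = q.num := Int.toNat_of_nonneg (Rat.num_nonneg.2 hq)
      exact_mod_cast this
    rwa [e, Rat.num_div_den] at this
  · have := key (-q).num.toNat (-q).den (-q).den_pos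
    have e : (((-q).num.toNat : ℕ) : ℚ) = ((-q).num : ℚ) := by
      have : (((-q).num.toNat : ℕ) : ℤ) = (-q).num :=
        Int.toNat_of_nonneg (Rat.num_nonneg.2 (by linarith))
      exact_mod_cast this
    rw [e, Rat.num_div_den, apply_neg, apply_neg] at this
    exact star_injective this

theorem hasThinPartitions_prod : HasThinPartitions.{u} (SolCone × SolCone) := by
  refine hasThinPartitions_of_maps (fun k z =>
    ![(z.1 (1 / k.factorial)).re, (z.1 (1 / k.factorial)).im,
      (z.2 (1 / k.factorial)).re, (z.2 (1 / k.factorial)).im]) (fun k => ?_) ?_ ?_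
  · have h1 := (continuous_apply (1 / k.factorial)).comp (continuous_fst (X := SolCone) (Y := SolCone))
    have h2 := (continuous_apply (1 / k.factorial)).comp (continuous_snd (X := SolCone) (Y := SolCone))
    refine continuous_pi fun i => ?_
    fin_cases i
    · exact Complex.continuous_re.comp h1
    · exact Complex.continuous_im.comp h1
    · exact Complex.continuous_re.comp h2
    · exact Complex.continuous_im.comp h2
  · intro j k hjk x y h
    have h1 : x.1 (1 / k.factorial) = y.1 (1 / k.factorial) :=
      Complex.ext (congrFun h 0) (congrFun h 1)
    have h2 : x.2 (1 / k.factorial) = y.2 (1 / k.factorial) :=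
      Complex.ext (congrFun h 2) (congrFun h 3)
    simp only [eq_of_apply_factorial hjk h1, eq_of_apply_factorial hjk h2]
  · intro x y h
    exact Prod.ext (eq_of_forall_apply_factorial fun k =>
      Complex.ext (congrFun (h k) 0) (congrFun (h k) 1)) (eq_of_forall_apply_factorial fun k =>
      Complex.ext (congrFun (h k) 2) (congrFun (h k) 3))

end SolCone

/-- The standard character `x ↦ exp (2 π i x)` of the real line. -/
noncomputable def unitExp (x : ℝ) : ℂ := Complex.exp (2 * Real.pi * Complex.I * x)

lemma unitExp_add (x y : ℝ) : unitExp (x + y) = unitExp x * unitExp y := by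
  simp only [unitExp, Complex.ofReal_add, mul_add, Complex.exp_add]

lemma unitExp_zero : unitExp 0 = 1 := by simp [unitExp]

lemma unitExp_intCast (k : ℤ) : unitExp k = 1 := by
  have := Complex.exp_int_mul_two_pi_mul_I k
  rw [unitExp, ← this]
  congr 1
  push_cast
  ring

lemma star_unitExp (x : ℝ) : star (unitExp x) = unitExp (-x) := by
  simp only [unitExp, Complex.star_def, ← Complex.exp_conj, map_mul, Complex.conj_I, map_ofNat,
    Complex.conj_ofReal, Complex.ofReal_neg]
  congr 1
  ring

lemma norm_unitExp (x : ℝ) : ‖unitExp x‖ = 1 := by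
  have := Complex.norm_exp_ofReal_mul_I (2 * Real.pi * x)
  rw [← this, unitExp]
  congr 2
  push_cast
  ring

lemma unitExp_sum {ι : Type*} (s : Finset ι) (f : ι → ℝ) :
    unitExp (∑ i ∈ s, f i) = ∏ i ∈ s, unitExp (f i) := by
  classical
  induction s using Finset.induction_on with
  | empty => simp [unitExp_zero]
  | insert a s ha ih => rw [Finset.sum_insert ha, Finset.prod_insert ha, unitExp_add, ih]

lemma unitExp_natCast_mul (n : ℕ) (x : ℝ) : unitExp (n * x) = unitExp x ^ n := by
  rw [unitExp, unitExp, ← Complex.exp_nat_mul]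
  congr 1
  push_cast
  ring

lemma unitExp_div_ne_one {Q : ℕ} (hQ : 0 < Q) {k : ℤ} (hk : ¬ (Q : ℤ) ∣ k) :
    unitExp (k / Q) ≠ 1 := by
  intro h
  rw [unitExp, Complex.exp_eq_one_iff] at h
  obtain ⟨n, hn⟩ := h
  have h2 : (2 * Real.pi * Complex.I : ℂ) ≠ 0 := Complex.two_pi_I_ne_zero
  have hQ' : (Q : ℂ) ≠ 0 := by exact_mod_cast hQ.ne'
  rw [mul_comm (n : ℂ)] at hn
  have h3 := mul_left_cancel₀ h2 hn
  push_cast at h3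
  rw [div_eq_iff hQ'] at h3
  apply hk
  refine ⟨n, ?_⟩
  rw [mul_comm]
  exact_mod_cast h3

lemma sum_unitExp_eq_zero {Q : ℕ} (hQ : 0 < Q) {k : ℤ} (hk : ¬ (Q : ℤ) ∣ k) :
    ∑ θ : Fin Q, unitExp (k * (θ : ℕ) / Q) = 0 := by
  have h1 : ∀ θ : Fin Q, unitExp (k * (θ : ℕ) / Q) = unitExp (k / Q) ^ (θ : ℕ) := by
    intro θ
    rw [← unitExp_natCast_mul]
    congr 1
    ring
  simp only [h1]
  rw [Fin.sum_univ_eq_sum_range (fun i => unitExp (k / Q) ^ i) Q]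
  have h2 := geom_sum_mul (unitExp (k / Q)) Q
  rw [← unitExp_natCast_mul, mul_div_cancel₀ (b := (Q : ℝ)) _ (by exact_mod_cast hQ.ne'),
    unitExp_intCast, sub_self] at h2
  exact (mul_eq_zero.1 h2).resolve_right (sub_ne_zero.2 (unitExp_div_ne_one hQ hk))

/-- The character with frequency `A` sampled on the grid of mesh `1 / Q` in the torus. -/
noncomputable def gridChar {Q : ℕ} (A : Fin 3 → ℤ) (θ : Fin 3 → Fin Q) : ℂ :=
  unitExp (∑ l, A l * (θ l : ℕ) / Q)

lemma gridChar_add {Q : ℕ} (A B : Fin 3 → ℤ) (θ : Fin 3 → Fin Q) :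
    gridChar (A + B) θ = gridChar A θ * gridChar B θ := by
  rw [gridChar, gridChar, gridChar, ← unitExp_add, ← Finset.sum_add_distrib]
  congr 1
  refine Finset.sum_congr rfl fun l _ => ?_
  simp only [Pi.add_apply, Int.cast_add]
  ring

lemma star_gridChar {Q : ℕ} (A : Fin 3 → ℤ) (θ : Fin 3 → Fin Q) :
    star (gridChar A θ) = gridChar (-A) θ := by
  rw [gridChar, gridChar, star_unitExp, ← Finset.sum_neg_distrib]
  congr 1
  refine Finset.sum_congr rfl fun l _ => ?_
  simp only [Pi.neg_apply, Int.cast_neg]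
  ring

lemma sum_gridChar {Q : ℕ} (hQ : 0 < Q) {A : Fin 3 → ℤ} {l : Fin 3} (hl : ¬ (Q : ℤ) ∣ A l) :
    ∑ θ : Fin 3 → Fin Q, gridChar A θ = 0 := by
  have : ∀ θ : Fin 3 → Fin Q, gridChar A θ = ∏ l, unitExp (A l * (θ l : ℕ) / Q) :=
    fun θ => unitExp_sum _ _
  simp only [this]
  rw [← Fintype.prod_sum (fun l (θ : Fin Q) => unitExp (A l * (θ : ℕ) / Q))]
  exact Finset.prod_eq_zero (Finset.mem_univ l) (sum_unitExp_eq_zero hQ hl)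

lemma sum_norm_sq_gridChar {Q : ℕ} (hQ : 0 < Q) {ι : Type*} (S : Finset ι) (a : ι → Fin 3 → ℤ)
    (hS : ∀ i ∈ S, ∀ j ∈ S, i ≠ j → ∃ l, ¬ (Q : ℤ) ∣ a i l - a j l) (w : ι → ℂ) :
    ∑ θ : Fin 3 → Fin Q, ‖∑ i ∈ S, w i * gridChar (a i) θ‖ ^ 2 =
      (Q : ℝ) ^ 3 * ∑ i ∈ S, ‖w i‖ ^ 2 := by
  classical
  have h1 : ∀ z : ℂ, ((‖z‖ ^ 2 : ℝ) : ℂ) = z * star z := fun z => by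
    rw [Complex.star_def, Complex.mul_conj, Complex.normSq_eq_norm_sq]
  have h2 : ∀ θ : Fin 3 → Fin Q, ((‖∑ i ∈ S, w i * gridChar (a i) θ‖ ^ 2 : ℝ) : ℂ) =
      ∑ i ∈ S, ∑ j ∈ S, w i * star (w j) * gridChar (a i - a j) θ := by
    intro θ
    rw [h1, star_sum, Finset.sum_mul_sum]
    refine Finset.sum_congr rfl fun i _ => Finset.sum_congr rfl fun j _ => ?_
    rw [star_mul', star_gridChar, sub_eq_add_neg, gridChar_add]
    ring
  have h3 : (((∑ θ : Fin 3 → Fin Q, ‖∑ i ∈ S, w i * gridChar (a i) θ‖ ^ 2 : ℝ)) : ℂ) =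
      (((Q : ℝ) ^ 3 * ∑ i ∈ S, ‖w i‖ ^ 2 : ℝ) : ℂ) := by
    rw [Complex.ofReal_sum, Finset.sum_congr rfl fun θ _ => h2 θ, Finset.sum_comm]
    rw [Complex.ofReal_mul, Complex.ofReal_sum, Finset.mul_sum]
    refine Finset.sum_congr rfl fun i hi => ?_
    rw [Finset.sum_comm, Finset.sum_eq_single_of_mem i hi]
    · rw [h1, ← Finset.mul_sum]
      have : ∀ θ : Fin 3 → Fin Q, gridChar (a i - a i) θ = 1 := fun θ => by
        simp [gridChar, unitExp_zero]
      simp only [this]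
      simp
      ring
    · intro j hj hij
      obtain ⟨l, hl⟩ := hS i hi j hj hij.symm
      rw [← Finset.mul_sum, sum_gridChar hQ (l := l) hl, mul_zero]
  exact_mod_cast h3

lemma abs_mul_sub_mul_le {a b c d x y : ℝ} (ha : |a| ≤ 1) (hd : |d| ≤ 1) (h1 : |a - b| ≤ x)
    (h2 : |c - d| ≤ y) : |a * c - b * d| ≤ x + y := by
  have e : a * c - b * d = a * (c - d) + (a - b) * d := by ring
  rw [e]
  refine (abs_add_le _ _).trans ?_
  rw [abs_mul, abs_mul]
  have := mul_le_mul ha h2 (abs_nonneg _) zero_le_one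
  have := mul_le_mul h1 hd (abs_nonneg _) ((abs_nonneg _).trans h1)
  linarith

lemma abs_pow_le_one_of {a : ℝ} (h : a ∈ Set.Icc (0 : ℝ) 1) (n : ℕ) : |a ^ n| ≤ 1 := by
  rw [abs_pow, abs_of_nonneg h.1]
  exact pow_le_one₀ h.1 h.2

lemma abs_pow_sub_pow_le_of {a b : ℝ} (ha : a ∈ Set.Icc (0 : ℝ) 1) (hb : b ∈ Set.Icc (0 : ℝ) 1)
    {δ : ℝ} (h : |a - b| ≤ δ) (n : ℕ) : |a ^ n - b ^ n| ≤ n * δ := by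
  induction n with
  | zero => simp
  | succ n ih =>
    rw [pow_succ, pow_succ]
    refine (abs_mul_sub_mul_le (abs_pow_le_one_of ha n) ?_ ih h).trans ?_
    · simpa using abs_pow_le_one_of hb 1
    · push_cast; linarith

lemma abs_monomial_sub_le {a b : Fin 3 → ℝ} (ha : ∀ l, a l ∈ Set.Icc (0 : ℝ) 1)
    (hb : ∀ l, b l ∈ Set.Icc (0 : ℝ) 1) {δ : ℝ} (h : ∀ l, |a l - b l| ≤ δ) (ν : Fin 3 → ℕ) :
    |∏ l, a l ^ ν l - ∏ l, b l ^ ν l| ≤ (∑ l, (ν l : ℝ)) * δ := by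
  have h1 : ∀ l, |a l ^ ν l - b l ^ ν l| ≤ ν l * δ :=
    fun l => abs_pow_sub_pow_le_of (ha l) (hb l) (h l) _
  have h2 : ∀ l, |a l ^ ν l| ≤ 1 := fun l => abs_pow_le_one_of (ha l) _
  have h3 : ∀ l, |b l ^ ν l| ≤ 1 := fun l => abs_pow_le_one_of (hb l) _
  simp only [Fin.prod_univ_three, Fin.sum_univ_three]
  refine (abs_mul_sub_mul_le ?_ (h3 2) (abs_mul_sub_mul_le (h2 0) (h3 1) (h1 0) (h1 1))
    (h1 2)).trans (by linarith)
  rw [abs_mul]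
  exact mul_le_one₀ (h2 0) (abs_nonneg _) (h2 1)

lemma monomial_mem_Icc {a : Fin 3 → ℝ} (ha : ∀ l, a l ∈ Set.Icc (0 : ℝ) 1) (ν : Fin 3 → ℕ) :
    ∏ l, a l ^ ν l ∈ Set.Icc (0 : ℝ) 1 :=
  ⟨Finset.prod_nonneg fun l _ => pow_nonneg (ha l).1 _,
    Finset.prod_le_one (fun l _ => pow_nonneg (ha l).1 _) fun l _ => pow_le_one₀ (ha l).1 (ha l).2⟩

/-- The cube of side `R` with lowest corner `A` in the lattice `ℤ³`. -/
noncomputable def latticeCube (R : ℕ) (A : Fin 3 → ℤ) : Finset (Fin 3 → ℤ) :=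
  Fintype.piFinset fun l => Finset.Ico (A l) (A l + R)

lemma mem_latticeCube {R : ℕ} {A ξ : Fin 3 → ℤ} :
    ξ ∈ latticeCube R A ↔ ∀ l, A l ≤ ξ l ∧ ξ l < A l + R := by
  simp [latticeCube]

lemma card_latticeCube (R : ℕ) (A : Fin 3 → ℤ) : (latticeCube R A).card = R ^ 3 := by
  simp [latticeCube, Fintype.card_piFinset]

lemma card_Ico_sdiff_le (a b : ℤ) (R : ℕ) :
    (Finset.Ico a (a + R) \ Finset.Ico (a + b) (a + b + R)).card ≤ b.natAbs := by
  have : Finset.Ico a (a + R) \ Finset.Ico (a + b) (a + b + R) ⊆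
      Finset.Ico a (a + b) ∪ Finset.Ico (a + b + R) (a + R) := by
    intro x
    simp only [Finset.mem_sdiff, Finset.mem_Ico, Finset.mem_union]
    omega
  refine (Finset.card_le_card this).trans ((Finset.card_union_le _ _).trans ?_)
  rw [Int.card_Ico, Int.card_Ico]
  omega

lemma card_latticeCube_sdiff_le {R B : ℕ} {A A' : Fin 3 → ℤ} (h : ∀ l, (A' l - A l).natAbs ≤ B) :
    (latticeCube R A \ latticeCube R A').card ≤ 3 * (B * R ^ 2) := by
  classical
  have hsub : latticeCube R A \ latticeCube R A' ⊆ Finset.univ.biUnion fun l : Fin 3 =>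
      Fintype.piFinset fun j => if j = l then
        Finset.Ico (A j) (A j + R) \ Finset.Ico (A j + (A' j - A j)) (A j + (A' j - A j) + R)
        else Finset.Ico (A j) (A j + R) := by
    intro ξ hξ
    rw [Finset.mem_sdiff, mem_latticeCube, mem_latticeCube, not_forall] at hξ
    obtain ⟨h1, l, hl⟩ := hξ
    rw [Finset.mem_biUnion]
    refine ⟨l, Finset.mem_univ _, Fintype.mem_piFinset.2 fun j => ?_⟩
    split_ifs with hj
    · subst hj
      have := h1 j
      simp only [Finset.mem_sdiff, Finset.mem_Ico]
      omega
    · exact Finset.mem_Ico.2 (h1 j)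
  refine (Finset.card_le_card hsub).trans (Finset.card_biUnion_le.trans ?_)
  refine (Finset.sum_le_card_nsmul _ _ (B * R ^ 2) fun l _ => ?_).trans (by simp)
  rw [Fintype.card_piFinset]
  have h1 : ∀ j : Fin 3, (if j = l then
        Finset.Ico (A j) (A j + R) \ Finset.Ico (A j + (A' j - A j)) (A j + (A' j - A j) + R)
        else Finset.Ico (A j) (A j + R)).card ≤ if j = l then B else R := by
    intro j
    split_ifs
    · exact (card_Ico_sdiff_le _ _ _).trans (h j)
    · simp
  refine (Finset.prod_le_prod' fun j _ => h1 j).trans (le_of_eq ?_)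
  fin_cases l <;> simp [Fin.prod_univ_three] <;> ring

/-- The indicator function of the cube of side `R` at `A`. -/
noncomputable def cubeInd (R : ℕ) (A ξ : Fin 3 → ℤ) : ℝ := if ξ ∈ latticeCube R A then 1 else 0

lemma sum_cubeInd_sq_eq {R : ℕ} {A : Fin 3 → ℤ} {X : Finset (Fin 3 → ℤ)}
    (hX : latticeCube R A ⊆ X) : ∑ ξ ∈ X, cubeInd R A ξ ^ 2 = (R : ℝ) ^ 3 := by
  classical
  have : ∀ ξ, cubeInd R A ξ ^ 2 = if ξ ∈ latticeCube R A then 1 else 0 := fun ξ => by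
    unfold cubeInd; split_ifs <;> norm_num
  simp only [this]
  rw [← Finset.sum_filter, Finset.sum_const, nsmul_eq_mul, mul_one, Finset.filter_mem_eq_inter,
    Finset.inter_eq_right.2 hX, card_latticeCube]
  push_cast
  rfl

lemma sum_sq_shift_le {R B : ℕ} {A A' : Fin 3 → ℤ} (hB : ∀ l, (A' l - A l).natAbs ≤ B)
    (f : (Fin 3 → ℤ) → ℝ) (c η : ℝ) (hf : ∀ ξ, f ξ ∈ Set.Icc (0 : ℝ) 1)
    (hc : c ∈ Set.Icc (0 : ℝ) 1)
    (hη : ∀ ξ ∈ latticeCube R A, |f ξ - c| ≤ η) (X : Finset (Fin 3 → ℤ)) :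
    ∑ ξ ∈ X, (f ξ * cubeInd R A ξ - c * cubeInd R A' ξ) ^ 2 ≤
      η ^ 2 * R ^ 3 + 6 * (B * R ^ 2) := by
  classical
  have hpt : ∀ ξ, (f ξ * cubeInd R A ξ - c * cubeInd R A' ξ) ^ 2 ≤
      η ^ 2 * (if ξ ∈ latticeCube R A then 1 else 0) +
      ((if ξ ∈ latticeCube R A \ latticeCube R A' then 1 else 0) +
      (if ξ ∈ latticeCube R A' \ latticeCube R A then 1 else 0)) := by
    intro ξ
    have h0 := hf ξ
    have hη2 : 0 ≤ η ^ 2 := sq_nonneg _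
    unfold cubeInd
    by_cases h1 : ξ ∈ latticeCube R A <;> by_cases h2 : ξ ∈ latticeCube R A' <;>
      simp only [h1, h2, Finset.mem_sdiff, if_true, if_false, not_true, not_false_iff, and_true,
        and_false, mul_one, mul_zero, sub_zero, zero_sub, add_zero, zero_add]
    · have := abs_le.1 (hη ξ h1)
      nlinarith [this.1, this.2]
    · have : f ξ ^ 2 ≤ 1 := pow_le_one₀ h0.1 h0.2
      linarith
    · have : c ^ 2 ≤ 1 := pow_le_one₀ hc.1 hc.2
      simpa using this
    · norm_num
  have hcard : ∀ S : Finset (Fin 3 → ℤ), ∑ ξ ∈ X, (if ξ ∈ S then (1 : ℝ) else 0) ≤ S.card := by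
    intro S
    rw [← Finset.sum_filter, Finset.sum_const, nsmul_eq_mul, mul_one]
    exact_mod_cast Finset.card_le_card (fun ξ hξ => (Finset.mem_filter.1 hξ).2)
  refine (Finset.sum_le_sum fun ξ _ => hpt ξ).trans ?_
  rw [Finset.sum_add_distrib, Finset.sum_add_distrib, ← Finset.mul_sum]
  have e1 := hcard (latticeCube R A)
  have e2 := hcard (latticeCube R A \ latticeCube R A')
  have e3 := hcard (latticeCube R A' \ latticeCube R A)
  have e4 : (((latticeCube R A \ latticeCube R A').card : ℕ) : ℝ) ≤ 3 * (B * R ^ 2) := by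
    exact_mod_cast card_latticeCube_sdiff_le hB
  have e5 : (((latticeCube R A' \ latticeCube R A).card : ℕ) : ℝ) ≤ 3 * (B * R ^ 2) := by
    exact_mod_cast card_latticeCube_sdiff_le fun l => by rw [← Int.natAbs_neg, neg_sub]; exact hB l
  rw [card_latticeCube] at e1
  push_cast at e1
  have := mul_le_mul_of_nonneg_left e1 (sq_nonneg η)
  linarith

/-- The lattice points of the simplex of size `d` in the positive octant of `ℤ³`. -/
noncomputable def latticeSimplex (d : ℕ) : Finset (Fin 3 → ℤ) :=
  ((Finset.range (d + 1)).sigma fun x => Finset.range (d + 1 - x)).image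
    fun z => ![(z.1 : ℤ), (z.2 : ℤ), (d : ℤ) - z.1 - z.2]

lemma mem_latticeSimplex {d : ℕ} {A : Fin 3 → ℤ} :
    A ∈ latticeSimplex d ↔ (∀ l, 0 ≤ A l) ∧ ∑ l, A l = d := by
  simp only [latticeSimplex, Finset.mem_image, Finset.mem_sigma, Finset.mem_range,
    Fin.sum_univ_three, Fin.forall_fin_succ, IsEmpty.forall_iff]
  constructor
  · rintro ⟨⟨x, y⟩, ⟨hx, hy⟩, rfl⟩
    simp
    simp at hx hy
    omega
  · rintro ⟨⟨h0, h1, h2, -⟩, hs⟩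
    simp at h0 h1 h2
    refine ⟨⟨(A 0).toNat, (A 1).toNat⟩, ⟨?_, ?_⟩, ?_⟩
    · simp; omega
    · simp; omega
    · ext l
      fin_cases l <;> simp <;> omega

lemma two_mul_sum_range_sub (d : ℕ) :
    2 * ∑ x ∈ Finset.range (d + 1), (d + 1 - x) = (d + 1) * (d + 2) := by
  induction d with
  | zero => simp
  | succ d ih =>
    rw [Finset.sum_range_succ', mul_add]
    simp only [Nat.add_sub_add_right]
    rw [ih, Nat.sub_zero]
    ring

lemma two_mul_card_latticeSimplex (d : ℕ) :
    2 * (latticeSimplex d).card = (d + 1) * (d + 2) := by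
  rw [latticeSimplex, Finset.card_image_of_injective, Finset.card_sigma]
  · simp only [Finset.card_range]
    exact two_mul_sum_range_sub d
  · rintro ⟨x, y⟩ ⟨x', y'⟩ h
    have h0 := congrFun h 0
    have h1 := congrFun h 1
    simp at h0 h1
    simp [h0, h1]

lemma sum_wave_sq {Q : ℕ} (hQ : 0 < Q) {ι : Type*} (S : Finset ι) (a : ι → Fin 3 → ℤ)
    (hS : ∀ i ∈ S, ∀ j ∈ S, i ≠ j → ∃ l, ¬ (Q : ℤ) ∣ a i l - a j l) (u : ι → ℂ)
    (d : ι → (Fin 3 → ℤ) → ℝ) (X : Finset (Fin 3 → ℤ)) :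
    ∑ ω : X × (Fin 3 → Fin Q), ‖∑ i ∈ S, u i * d i ω.1 * gridChar (a i) ω.2‖ ^ 2 =
      (Q : ℝ) ^ 3 * ∑ i ∈ S, ‖u i‖ ^ 2 * ∑ ξ ∈ X, d i ξ ^ 2 := by
  rw [Fintype.sum_prod_type]
  simp only [fun ξ => sum_norm_sq_gridChar hQ S a hS fun i => u i * d i ξ]
  rw [← Finset.mul_sum, Finset.sum_coe_sort X fun ξ => ∑ i ∈ S, ‖u i * (d i ξ : ℂ)‖ ^ 2,
    Finset.sum_comm]
  congr 1
  refine Finset.sum_congr rfl fun i _ => ?_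
  rw [Finset.mul_sum]
  refine Finset.sum_congr rfl fun ξ _ => ?_
  rw [norm_mul, mul_pow, Complex.norm_real, Real.norm_eq_abs, sq_abs]

lemma sum_norm_sq_mulVec {n : ℕ} {M : Matrix (Fin n) (Fin n) ℂ}
    (hM : M ∈ Matrix.unitaryGroup (Fin n) ℂ) (v : Fin n → ℂ) :
    ∑ j, ‖(M.mulVec v) j‖ ^ 2 = ∑ i, ‖v i‖ ^ 2 := by
  have h1 : ∀ w : Fin n → ℂ, ((∑ j, ‖w j‖ ^ 2 : ℝ) : ℂ) = star w ⬝ᵥ w := fun w => by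
    rw [Complex.ofReal_sum, dotProduct]
    refine Finset.sum_congr rfl fun j _ => ?_
    rw [Pi.star_apply, mul_comm, Complex.star_def, Complex.mul_conj, Complex.normSq_eq_norm_sq]
  have h2 : star (M.mulVec v) ⬝ᵥ M.mulVec v = star v ⬝ᵥ v := by
    rw [Matrix.star_mulVec, Matrix.dotProduct_mulVec, Matrix.vecMul_vecMul,
      ← Matrix.star_eq_conjTranspose, Matrix.mem_unitaryGroup_iff'.1 hM, Matrix.vecMul_one]
  have := (h1 _).trans (h2.trans (h1 v).symm)
  exact_mod_cast this

/-- The `ℓ²` norm of a complex function on a finite type. -/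
noncomputable def l2norm {Ω : Type*} [Fintype Ω] (f : Ω → ℂ) : ℝ :=
  ‖(WithLp.toLp 2 f : EuclideanSpace ℂ Ω)‖

section l2norm
variable {Ω : Type*} [Fintype Ω]

lemma l2norm_nonneg (f : Ω → ℂ) : 0 ≤ l2norm f := norm_nonneg _

lemma l2norm_sq (f : Ω → ℂ) : l2norm f ^ 2 = ∑ ω, ‖f ω‖ ^ 2 := by
  rw [l2norm, EuclideanSpace.norm_eq, Real.sq_sqrt (Finset.sum_nonneg fun _ _ => sq_nonneg _)]

lemma l2norm_add_le (f g : Ω → ℂ) : l2norm (fun ω => f ω + g ω) ≤ l2norm f + l2norm g := by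
  have := norm_add_le (WithLp.toLp 2 f : EuclideanSpace ℂ Ω) (WithLp.toLp 2 g)
  rwa [← WithLp.toLp_add] at this

lemma l2norm_sum_le {ι : Type*} (s : Finset ι) (c : ι → ℂ) (f : ι → Ω → ℂ) :
    l2norm (fun ω => ∑ p ∈ s, c p * f p ω) ≤ ∑ p ∈ s, ‖c p‖ * l2norm (f p) := by
  have := norm_sum_le s fun p => (c p) • (WithLp.toLp 2 (f p) : EuclideanSpace ℂ Ω)
  simp only [norm_smul] at this
  refine le_trans (le_of_eq ?_) this
  rw [l2norm]
  congr 1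
  ext ω
  simp

lemma l2norm_mul_le (f g : Ω → ℂ) {ε : ℝ} (hε : 0 ≤ ε) (h : ∀ ω, g ω ≠ 0 → ‖f ω‖ ≤ ε) :
    l2norm (fun ω => f ω * g ω) ≤ ε * l2norm g := by
  refine le_of_sq_le_sq ?_ (mul_nonneg hε (l2norm_nonneg _))
  rw [mul_pow, l2norm_sq, l2norm_sq, Finset.mul_sum]
  refine Finset.sum_le_sum fun ω _ => ?_
  by_cases hg : g ω = 0
  · simp [hg]
  · rw [norm_mul, mul_pow]
    have := h ω hg
    gcongr

lemma norm_sum_star_mul_le (f g : Ω → ℂ) : ‖∑ ω, star (f ω) * g ω‖ ≤ l2norm f * l2norm g := by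
  have := norm_inner_le_norm (𝕜 := ℂ) (WithLp.toLp 2 f : EuclideanSpace ℂ Ω) (WithLp.toLp 2 g)
  refine le_trans (le_of_eq ?_) this
  congr 1
  simp [PiLp.inner_apply, mul_comm]

lemma sum_l2norm_le {n : ℕ} (f : Fin n → Ω → ℂ) :
    (∑ i, l2norm (f i)) ^ 2 ≤ n * ∑ i, l2norm (f i) ^ 2 := by
  have := sq_sum_le_card_mul_sum_sq (s := Finset.univ) (f := fun i => l2norm (f i))
  simpa using this

/-- A family of functions acted upon by pointwise unitary matrices vanishes if the matrix entries
are close to operators with values orthogonal to the result. -/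
lemma eq_zero_of_near_orthogonal {n : ℕ} (M : Ω → Matrix (Fin n) (Fin n) ℂ)
    (hM : ∀ ω, M ω ∈ Matrix.unitaryGroup (Fin n) ℂ) (U : Fin n → Ω → ℂ)
    (v : Fin n → Fin n → Ω → ℂ) {e : ℝ} (he0 : 0 ≤ e) (he : n * e < 1)
    (hv : ∀ j i, l2norm (fun ω => M ω j i * U i ω - v j i ω) ≤ e * l2norm (U i))
    (ho : ∀ j i, ∑ ω, star (v j i ω) * ∑ i', M ω j i' * U i' ω = 0) (i : Fin n) :
    l2norm (U i) = 0 := by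
  set Y : Fin n → Ω → ℂ := fun j ω => ∑ i, M ω j i * U i ω with hY
  have h1 : ∑ j, l2norm (Y j) ^ 2 = ∑ i, l2norm (U i) ^ 2 := by
    simp only [l2norm_sq]
    rw [Finset.sum_comm, Finset.sum_comm (s := Finset.univ (α := Fin n))]
    refine Finset.sum_congr rfl fun ω _ => ?_
    exact sum_norm_sq_mulVec (hM ω) fun i => U i ω
  have h2 : ∀ j, l2norm (Y j) ^ 2 ≤ ∑ i, e * l2norm (U i) * l2norm (Y j) := by
    intro j
    have e1 : ((l2norm (Y j) ^ 2 : ℝ) : ℂ) =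
        ∑ i, ∑ ω, star (M ω j i * U i ω - v j i ω) * Y j ω := by
      have e2 : ∀ i, ∑ ω, star (M ω j i * U i ω - v j i ω) * Y j ω =
          ∑ ω, star (M ω j i * U i ω) * Y j ω := by
        intro i
        have := ho j i
        simp only [star_sub, sub_mul, Finset.sum_sub_distrib]
        rw [sub_eq_self]
        exact this
      rw [Finset.sum_congr rfl fun i _ => e2 i, Finset.sum_comm, l2norm_sq, Complex.ofReal_sum]
      refine Finset.sum_congr rfl fun ω _ => ?_
      rw [← Finset.sum_mul, ← star_sum, mul_comm, Complex.star_def, Complex.mul_conj,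
        Complex.normSq_eq_norm_sq]
    have e3 : l2norm (Y j) ^ 2 = ‖((l2norm (Y j) ^ 2 : ℝ) : ℂ)‖ := by
      rw [Complex.norm_real, Real.norm_of_nonneg (sq_nonneg _)]
    rw [e3, e1]
    refine (norm_sum_le _ _).trans (Finset.sum_le_sum fun i _ => ?_)
    refine (norm_sum_star_mul_le _ _).trans ?_
    exact mul_le_mul_of_nonneg_right (hv j i) (l2norm_nonneg _)
  set a := ∑ i, l2norm (U i)
  set b := ∑ j, l2norm (Y j)
  set N := ∑ i, l2norm (U i) ^ 2 with hN
  have hN0 : 0 ≤ N := Finset.sum_nonneg fun _ _ => sq_nonneg _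
  have ha : a ^ 2 ≤ n * N := sum_l2norm_le U
  have hb : b ^ 2 ≤ n * N := by rw [← h1]; exact sum_l2norm_le Y
  have h3 : N ≤ e * (a * b) := by
    rw [← h1]
    refine (Finset.sum_le_sum fun j _ => h2 j).trans (le_of_eq ?_)
    rw [Finset.sum_mul_sum, Finset.mul_sum, Finset.sum_comm]
    refine Finset.sum_congr rfl fun i _ => ?_
    rw [Finset.mul_sum]
    exact Finset.sum_congr rfl fun j _ => by ring
  have h4 : a * b ≤ n * N := by nlinarith [sq_nonneg (a - b)]
  have h5 : N ≤ n * e * N := by nlinarith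
  have h6 : N = 0 := by nlinarith
  rw [hN, Finset.sum_eq_zero_iff_of_nonneg fun _ _ => sq_nonneg _] at h6
  exact pow_eq_zero_iff two_ne_zero |>.1 (h6 i (Finset.mem_univ i))

end l2norm

lemma exists_orthogonal_combination {Ω ι : Type*} [Fintype Ω] {n : ℕ} (S : Fin n → Finset ι)
    (T : Finset ι) (φ : ι → Ω → ℂ) (M : Ω → Matrix (Fin n) (Fin n) ℂ)
    (hcard : n * T.card < ∑ i, (S i).card) :
    ∃ u : Fin n → ι → ℂ, (∃ i, ∃ A ∈ S i, u i A ≠ 0) ∧ ∀ j, ∀ A' ∈ T,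
      ∑ ω, star (φ A' ω) * ∑ i, M ω j i * ∑ A ∈ S i, u i A * φ A ω = 0 := by
  classical
  let m : Matrix (Fin n × T) (Σ i : Fin n, S i) ℂ :=
    fun jA iA => ∑ ω, star (φ jA.2 ω) * (M ω jA.1 iA.1 * φ iA.2 ω)
  have hker : LinearMap.ker m.mulVecLin ≠ ⊥ := by
    apply LinearMap.ker_ne_bot_of_finrank_lt
    simpa [Fintype.card_sigma] using hcard
  obtain ⟨w, hw, hw0⟩ := Submodule.exists_mem_ne_zero_of_ne_bot hker
  obtain ⟨⟨i, A⟩, hiA⟩ := Function.ne_iff.1 hw0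
  refine ⟨fun i A => if h : A ∈ S i then w ⟨i, A, h⟩ else 0, ⟨i, A, A.2, ?_⟩, fun j A' hA' => ?_⟩
  · simpa using hiA
  · have h0 := congrFun (show m.mulVec w = 0 by simpa using hw) (j, ⟨A', hA'⟩)
    rw [Matrix.mulVec, dotProduct, Pi.zero_apply] at h0
    rw [← h0, Fintype.sum_sigma]
    simp only [m, Finset.sum_mul, Finset.mul_sum]
    rw [Finset.sum_comm]
    refine Finset.sum_congr rfl fun i _ => ?_
    rw [Finset.sum_comm, ← Finset.sum_coe_sort (S i)]
    refine Finset.sum_congr rfl fun A _ => Finset.sum_congr rfl fun ω _ => ?_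
    simp only [A.2, dite_true]
    ring

lemma l2norm_wave_error_le {Q R B : ℕ} (hQ : 0 < Q) (S : Finset (Fin 3 → ℤ))
    (hS : ∀ A ∈ S, ∀ A' ∈ S, A ≠ A' → ∃ l, ¬ (Q : ℤ) ∣ A l - A' l) {b : Fin 3 → ℤ}
    (hb : ∀ l, (b l).natAbs ≤ B) (u : (Fin 3 → ℤ) → ℂ) (f : (Fin 3 → ℤ) → ℝ)
    (hf : ∀ ξ, f ξ ∈ Set.Icc (0 : ℝ) 1) {η δ : ℝ} (hδ : 0 ≤ δ)
    (hη : ∀ A ∈ S, ∀ ξ ∈ latticeCube R A, |f ξ - f A| ≤ η) {X : Finset (Fin 3 → ℤ)}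
    (hX : ∀ A ∈ S, latticeCube R A ⊆ X)
    (hle : η ^ 2 * R ^ 3 + 6 * (B * R ^ 2) ≤ δ ^ 2 * (R : ℝ) ^ 3) :
    l2norm (fun ω : X × (Fin 3 → Fin Q) => ∑ A ∈ S, u A *
        ((f ω.1 * cubeInd R A ω.1 - f A * cubeInd R (A + b) ω.1 : ℝ) : ℂ) *
          gridChar (A + b) ω.2) ≤
      δ * l2norm (fun ω : X × (Fin 3 → Fin Q) => ∑ A ∈ S, u A *
        (cubeInd R A ω.1 : ℂ) * gridChar A ω.2) := by
  refine le_of_sq_le_sq ?_ (mul_nonneg hδ (l2norm_nonneg _))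
  rw [mul_pow, l2norm_sq, l2norm_sq]
  rw [sum_wave_sq hQ S (fun A => A + b) (by simpa using hS) u
      (fun A ξ => f ξ * cubeInd R A ξ - f A * cubeInd R (A + b) ξ) X,
    sum_wave_sq hQ S (fun A => A) hS u (fun A ξ => cubeInd R A ξ) X, mul_left_comm]
  gcongr
  rw [Finset.mul_sum]
  refine Finset.sum_le_sum fun A hA => ?_
  rw [sum_cubeInd_sq_eq (hX A hA), mul_left_comm]
  gcongr
  refine (sum_sq_shift_le (by simpa using hb) f (f A) η hf (hf A) (hη A hA) X).trans hle

lemma exists_lattice_scale (V : ℝ) (B : ℕ) {δ : ℝ} (hδ : 0 < δ) : ∃ R D : ℕ, 0 < R ∧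
    100 * (B + R + 1) ≤ D ∧
    (V * (12 * R / D)) ^ 2 * (R : ℝ) ^ 3 + 6 * (B * R ^ 2) ≤ δ ^ 2 * (R : ℝ) ^ 3 := by
  obtain ⟨R, hR⟩ := exists_nat_gt (12 * B / δ ^ 2)
  have hR0 : (0 : ℝ) < R := lt_of_le_of_lt (by positivity) hR
  rw [div_lt_iff₀ (by positivity)] at hR
  have hlim : Filter.Tendsto (fun D : ℕ => (V * (12 * R / D)) ^ 2) Filter.atTop (𝓝 0) := by
    have := ((tendsto_const_div_atTop_nhds_zero_nat (12 * (R : ℝ))).const_mul V).pow 2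
    simpa using this
  obtain ⟨D, hD1, hD2⟩ := ((hlim.eventually_lt_const (show 0 < δ ^ 2 / 2 by positivity)).and
    (Filter.eventually_ge_atTop (100 * (B + R + 1)))).exists
  refine ⟨R, D, by exact_mod_cast hR0, hD2, ?_⟩
  have h3 : (V * (12 * R / D)) ^ 2 * (R : ℝ) ^ 3 ≤ δ ^ 2 / 2 * R ^ 3 := by gcongr
  nlinarith [sq_nonneg (R : ℝ), mul_pos hR0 hR0]

lemma card_latticeSimplex_sum_lt {n D : ℕ} (k : Fin n → ℤ) (hk : ∑ i, k i ≤ 0) (hk0 : k ≠ 0)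
    (d : Fin n → ℕ) (hd : ∀ i, (d i : ℤ) = D - k i) :
    n * (latticeSimplex D).card < ∑ i, (latticeSimplex (d i)).card := by
  have h1 : (2 * ∑ i, ((latticeSimplex (d i)).card : ℤ)) =
      ∑ i, ((D + 1) * (D + 2) - k i * (2 * D + 3) + k i ^ 2 : ℤ) := by
    rw [Finset.mul_sum]
    refine Finset.sum_congr rfl fun i _ => ?_
    have := two_mul_card_latticeSimplex (d i)
    zify at this
    rw [this, hd]
    ring
  have h2 := two_mul_card_latticeSimplex D
  zify at h2
  rw [Finset.sum_add_distrib, Finset.sum_sub_distrib, ← Finset.sum_mul Finset.univ k] at h1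
  simp only [Finset.sum_const, Finset.card_univ, Fintype.card_fin, nsmul_eq_mul] at h1
  have h3 : 0 < ∑ i, k i ^ 2 := by
    obtain ⟨i, hi⟩ := Function.ne_iff.1 hk0
    exact Finset.sum_pos' (fun _ _ => sq_nonneg _) ⟨i, Finset.mem_univ i, lt_of_le_of_ne (sq_nonneg _) (pow_ne_zero 2 hi).symm⟩
  zify
  nlinarith

/-- A coordinate cut-off, vanishing for `x ≤ D / 12` and equal to `1` for `D / 6 ≤ x`. -/
noncomputable def cutoff (D : ℕ) (x : ℤ) : ℝ := max 0 (min 1 (12 * x / D - 1))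

lemma cutoff_mem_Icc (D : ℕ) (x : ℤ) : cutoff D x ∈ Set.Icc (0 : ℝ) 1 :=
  ⟨le_max_left _ _, max_le zero_le_one (min_le_left _ _)⟩

lemma abs_cutoff_sub_le {D R : ℕ} {x y : ℤ} (h1 : x ≤ y) (h2 : y < x + R) :
    |cutoff D y - cutoff D x| ≤ 12 * R / D := by
  have h3 : (x : ℝ) ≤ y := by exact_mod_cast h1
  have h4 : (y : ℝ) ≤ x + R := by exact_mod_cast h2.le
  have h5 := abs_max_sub_max_le_max 0 (min 1 (12 * (y : ℝ) / D - 1)) 0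
    (min 1 (12 * (x : ℝ) / D - 1))
  have h6 := abs_min_sub_min_le_max 1 (12 * (y : ℝ) / D - 1) 1 (12 * (x : ℝ) / D - 1)
  simp only [sub_self, abs_zero, abs_nonneg, sup_of_le_right] at h5 h6
  refine (h5.trans h6).trans ?_
  have h7 : 12 * (y : ℝ) / D - 1 - (12 * x / D - 1) = 12 * (y - x) / D := by ring
  rw [h7, abs_of_nonneg (div_nonneg (by linarith) (Nat.cast_nonneg _))]
  gcongr
  linarith

lemma cutoff_eq_one {D : ℕ} (hD : 0 < D) {x : ℤ} (h : (D : ℤ) ≤ 6 * x) : cutoff D x = 1 := by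
  have hD' : (0 : ℝ) < D := by exact_mod_cast hD
  have h' : (D : ℝ) ≤ 6 * x := by exact_mod_cast h
  have : 1 ≤ 12 * (x : ℝ) / D - 1 := by
    rw [le_sub_iff_add_le, le_div_iff₀ hD']
    linarith
  rw [cutoff, min_eq_left this, max_eq_right zero_le_one]

lemma lt_of_cutoff_ne_zero {D : ℕ} (hD : 0 < D) {x : ℤ} (h : cutoff D x ≠ 0) :
    (D : ℤ) < 12 * x := by
  by_contra hx
  apply h
  have hD' : (0 : ℝ) < D := by exact_mod_cast hD
  have h' : 12 * (x : ℝ) ≤ D := by exact_mod_cast not_lt.1 hx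
  have : 12 * (x : ℝ) / D - 1 ≤ 0 := by
    rw [sub_nonpos, div_le_iff₀ hD']
    linarith
  rw [cutoff, max_eq_left ((min_le_right _ _).trans this)]

open Classical in
/-- No field of unitary matrices over the boundary of the cube times a torus is approximated by
trigonometric polynomials whose columns are homogeneous of degrees `k i` with `∑ i, k i ≤ 0`. -/
lemma false_of_homogeneous_approx {n : ℕ} (k : Fin n → ℤ) (hk : ∑ i, k i ≤ 0) (hk0 : k ≠ 0)
    (c : Fin n → Fin n → ((Fin 3 → ℕ) × (Fin 3 → ℤ)) →₀ ℂ)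
    (hc0 : ∀ j i, ∀ p ∈ (c j i).support, ∀ l, p.1 l = 0 → p.2 l = 0)
    (hck : ∀ j i, ∀ p ∈ (c j i).support, ∑ l, p.2 l = k i) {ε : ℝ} (hε0 : 0 ≤ ε)
    (hε : n * ε ≤ 1 / 4)
    (H : ∀ t : Fin 3 → ℝ, (∀ l, t l ∈ Set.Icc (0 : ℝ) 1) → (∃ l, t l = 1) → ∀ a : Fin 3 → ℝ,
      ∃ M ∈ Matrix.unitaryGroup (Fin n) ℂ, ∀ j i, ‖M j i - ∑ p ∈ (c j i).support,
        c j i p * ((∏ l, t l ^ p.1 l : ℝ) : ℂ) * unitExp (∑ l, p.2 l * a l)‖ ≤ ε) : False := by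
  set P : Finset ((Fin 3 → ℕ) × (Fin 3 → ℤ)) :=
    Finset.univ.biUnion fun j => Finset.univ.biUnion fun i => (c j i).support with hP
  have hPmem : ∀ j i, ∀ p ∈ (c j i).support, p ∈ P := fun j i p hp =>
    Finset.mem_biUnion.2 ⟨j, Finset.mem_univ _, Finset.mem_biUnion.2 ⟨i, Finset.mem_univ _, hp⟩⟩
  set B : ℕ := ∑ p ∈ P, ∑ l, (p.2 l).natAbs + ∑ i, (k i).natAbs with hB
  have hBp : ∀ j i, ∀ p ∈ (c j i).support, ∀ l, (p.2 l).natAbs ≤ B := by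
    intro j i p hp l
    have h1 := Finset.single_le_sum (f := fun l => (p.2 l).natAbs) (fun _ _ => Nat.zero_le _)
      (Finset.mem_univ l)
    have h2 := Finset.single_le_sum (f := fun p : (Fin 3 → ℕ) × (Fin 3 → ℤ) =>
      ∑ l, (p.2 l).natAbs) (fun _ _ => Nat.zero_le _) (hPmem j i p hp)
    omega
  have hBk : ∀ i, (k i).natAbs ≤ B := by
    intro i
    have h1 := Finset.single_le_sum (f := fun i => (k i).natAbs) (fun _ _ => Nat.zero_le _)
      (Finset.mem_univ i)
    omega
  set V : ℕ := ∑ p ∈ P, ∑ l, p.1 l with hV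
  have hVp : ∀ j i, ∀ p ∈ (c j i).support, ∑ l, p.1 l ≤ V := by
    intro j i p hp
    exact Finset.single_le_sum (f := fun p : (Fin 3 → ℕ) × (Fin 3 → ℤ) =>
      ∑ l, p.1 l) (fun _ _ => Nat.zero_le _) (hPmem j i p hp)
  set K : ℝ := ∑ j, ∑ i, ∑ p ∈ (c j i).support, ‖c j i p‖ with hK
  have hKp : ∀ j i, ∑ p ∈ (c j i).support, ‖c j i p‖ ≤ K := by
    intro j i
    have h1 := Finset.single_le_sum (f := fun i => ∑ p ∈ (c j i).support, ‖c j i p‖)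
      (fun _ _ => Finset.sum_nonneg fun _ _ => norm_nonneg _) (Finset.mem_univ i)
    have h2 := Finset.single_le_sum (f := fun j => ∑ i, ∑ p ∈ (c j i).support, ‖c j i p‖)
      (fun _ _ => Finset.sum_nonneg fun _ _ => Finset.sum_nonneg fun _ _ => norm_nonneg _)
      (Finset.mem_univ j)
    exact h1.trans h2
  have hK0 : 0 ≤ K := Finset.sum_nonneg fun _ _ => Finset.sum_nonneg fun _ _ =>
    Finset.sum_nonneg fun _ _ => norm_nonneg _
  set δ : ℝ := 1 / (4 * (n + 1) * (K + 1)) with hδdef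
  have hδ : 0 < δ := by positivity
  obtain ⟨R, D, hR, hD, hscale⟩ := exists_lattice_scale V B hδ
  have hD0 : 0 < D := by omega
  set d : Fin n → ℕ := fun i => ((D : ℤ) - k i).toNat with hd
  have hdk : ∀ i, (d i : ℤ) = D - k i := fun i => by
    have := hBk i
    simp only [hd]
    omega
  have hdB : ∀ i, d i ≤ D + B := fun i => by
    have := hBk i
    have := hdk i
    omega
  set Q : ℕ := D + B + 1 with hQ
  have hQ0 : 0 < Q := by omega
  set X : Finset (Fin 3 → ℤ) := Fintype.piFinset fun _ => Finset.Ico (0 : ℤ) (D + B + R) with hX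
  have hcX : ∀ i, ∀ A ∈ latticeSimplex (d i), latticeCube R A ⊆ X := by
    intro i A hA ξ hξ
    rw [mem_latticeSimplex, Fin.sum_univ_three] at hA
    rw [mem_latticeCube] at hξ
    rw [hX, Fintype.mem_piFinset]
    intro l
    rw [Finset.mem_Ico]
    have h1 := hξ l
    have h2 := hA.1 l
    have h3 := hA.1 0
    have h4 := hA.1 1
    have h5 := hA.1 2
    have h6 := hdB i
    have h7 := hA.2
    have h8 : A l ≤ d i := by fin_cases l <;> simp <;> omega
    omega
  have hsep : ∀ i, ∀ A ∈ latticeSimplex (d i), ∀ A' ∈ latticeSimplex (d i), A ≠ A' →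
      ∃ l, ¬ (Q : ℤ) ∣ A l - A' l := by
    intro i A hA A' hA' hne
    rw [mem_latticeSimplex, Fin.sum_univ_three] at hA hA'
    obtain ⟨l, hl⟩ := Function.ne_iff.1 hne
    refine ⟨l, fun hdvd => hl ?_⟩
    have h6 := hdB i
    have h7 := hA.1
    have h8 := hA'.1
    have h9 : A l ≤ d i := by
      have := h7 0; have := h7 1; have := h7 2; fin_cases l <;> simp <;> omega
    have h10 : A' l ≤ d i := by
      have := h8 0; have := h8 1; have := h8 2; fin_cases l <;> simp <;> omega
    have h11 := Int.eq_zero_of_abs_lt_dvd hdvd (by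
      have := h7 l
      have := h8 l
      rw [abs_lt]
      constructor <;> omega)
    omega
  set t : (Fin 3 → ℤ) → Fin 3 → ℝ := fun ξ l => cutoff D (ξ l) with ht
  have ht01 : ∀ ξ l, t ξ l ∈ Set.Icc (0 : ℝ) 1 := fun ξ l => cutoff_mem_Icc D _
  let φ : (Fin 3 → ℤ) → X × (Fin 3 → Fin Q) → ℂ :=
    fun A ω => (cubeInd R A ω.1 : ℂ) * gridChar A ω.2
  -- the field of unitary matrices, extended by the identity
  have hMex : ∀ ω : X × (Fin 3 → Fin Q), ∃ M ∈ Matrix.unitaryGroup (Fin n) ℂ,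
      (∃ l, t ω.1 l = 1) → ∀ j i, ‖M j i - ∑ p ∈ (c j i).support,
        c j i p * ((∏ l, t ω.1 l ^ p.1 l : ℝ) : ℂ) * gridChar p.2 ω.2‖ ≤ ε := by
    intro ω
    by_cases hω : ∃ l, t ω.1 l = 1
    · obtain ⟨M, hM, hM'⟩ := H (t ω.1) (ht01 ω.1) hω fun l => (ω.2 l : ℕ) / Q
      refine ⟨M, hM, fun _ j i => ?_⟩
      simpa only [gridChar, mul_div_assoc] using hM' j i
    · exact ⟨1, one_mem _, fun h => absurd h hω⟩
  choose M hMu hMa using hMex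
  obtain ⟨u, ⟨i₀, A₀, hA₀, hu₀⟩, hu⟩ := exists_orthogonal_combination
    (fun i => latticeSimplex (d i)) (latticeSimplex D) φ M (card_latticeSimplex_sum_lt k hk hk0 d hdk)
  set U : Fin n → X × (Fin 3 → Fin Q) → ℂ :=
    fun i ω => ∑ A ∈ latticeSimplex (d i), u i A * (cubeInd R A ω.1 : ℂ) * gridChar A ω.2 with hU
  let mono : (Fin 3 → ℕ) → (Fin 3 → ℤ) → ℝ := fun ν ξ => ∏ l, t ξ l ^ ν l
  let v : Fin n → Fin n → X × (Fin 3 → Fin Q) → ℂ := fun j i ω => ∑ p ∈ (c j i).support,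
    c j i p * ∑ A ∈ latticeSimplex (d i), u i A * (mono p.1 A : ℂ) * φ (A + p.2) ω
  have hzero : l2norm (U i₀) = 0 := by
    refine eq_zero_of_near_orthogonal M hMu U v (e := ε + K * δ) (by positivity) ?_ ?_ ?_ i₀
    · have h1 : n * (K * δ) ≤ 1 / 4 := by
        rw [hδdef, ← mul_assoc, mul_one_div, div_le_div_iff₀ (by positivity) (by norm_num)]
        nlinarith [Nat.cast_nonneg (α := ℝ) n]
      nlinarith
    · intro j i
      have hsplit : ∀ ω, M ω j i * U i ω - v j i ω =
          (M ω j i - ∑ p ∈ (c j i).support, c j i p * (mono p.1 ω.1 : ℂ) * gridChar p.2 ω.2) *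
            U i ω + ∑ p ∈ (c j i).support, c j i p * ∑ A ∈ latticeSimplex (d i), u i A *
              ((mono p.1 ω.1 * cubeInd R A ω.1 - mono p.1 A * cubeInd R (A + p.2) ω.1 : ℝ) : ℂ) *
                gridChar (A + p.2) ω.2 := by
        intro ω
        have : (∑ p ∈ (c j i).support, c j i p * (mono p.1 ω.1 : ℂ) * gridChar p.2 ω.2) * U i ω =
            v j i ω + ∑ p ∈ (c j i).support, c j i p * ∑ A ∈ latticeSimplex (d i), u i A *
              ((mono p.1 ω.1 * cubeInd R A ω.1 - mono p.1 A * cubeInd R (A + p.2) ω.1 : ℝ) : ℂ) *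
                gridChar (A + p.2) ω.2 := by
          rw [← Finset.sum_add_distrib, Finset.sum_mul]
          refine Finset.sum_congr rfl fun p _ => ?_
          rw [← mul_add, ← Finset.sum_add_distrib, mul_assoc, mul_assoc, Finset.mul_sum,
            Finset.mul_sum]
          congr 1
          refine Finset.sum_congr rfl fun A _ => ?_
          simp only [φ, gridChar_add]
          push_cast
          ring
        linear_combination this
      rw [funext hsplit, add_mul]
      refine (l2norm_add_le _ _).trans (add_le_add ?_ ?_)
      · refine l2norm_mul_le _ _ hε0 fun ω hω => hMa ω ?_ j i
        obtain ⟨A, hA, hA0⟩ := Finset.exists_ne_zero_of_sum_ne_zero hω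
        have hAc : cubeInd R A ω.1 ≠ 0 := fun h0 => hA0 (by simp [h0])
        have hξ : (ω.1 : Fin 3 → ℤ) ∈ latticeCube R A := by
          by_contra h0
          exact hAc (if_neg h0)
        rw [mem_latticeCube] at hξ
        rw [mem_latticeSimplex, Fin.sum_univ_three] at hA
        have h1 := hξ 0
        have h2 := hξ 1
        have h3 := hξ 2
        have h4 := hA.2
        have h5 := hdk i
        have h6 := hBk i
        have : ∃ l, (D : ℤ) ≤ 6 * (ω.1 : Fin 3 → ℤ) l := by
          by_contra! hcon
          have := hcon 0
          have := hcon 1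
          have := hcon 2
          omega
        obtain ⟨l, hl⟩ := this
        exact ⟨l, cutoff_eq_one hD0 hl⟩
      · refine (l2norm_sum_le _ _ _).trans ?_
        have : ∀ p ∈ (c j i).support, ‖c j i p‖ * l2norm (fun ω : X × (Fin 3 → Fin Q) =>
            ∑ A ∈ latticeSimplex (d i), u i A *
              ((mono p.1 ω.1 * cubeInd R A ω.1 - mono p.1 A * cubeInd R (A + p.2) ω.1 : ℝ) : ℂ) *
                gridChar (A + p.2) ω.2) ≤ ‖c j i p‖ * (δ * l2norm (U i)) := by
          intro p hp
          refine mul_le_mul_of_nonneg_left ?_ (norm_nonneg _)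
          refine l2norm_wave_error_le hQ0 _ (hsep i) (hBp j i p hp) (u i) (mono p.1)
            (fun ξ => monomial_mem_Icc (ht01 ξ) _) (η := V * (12 * R / D)) hδ.le ?_ (hcX i) hscale
          intro A hA ξ hξ
          rw [mem_latticeCube] at hξ
          refine (abs_monomial_sub_le (ht01 ξ) (ht01 A)
            (fun l => abs_cutoff_sub_le (hξ l).1 (hξ l).2) _).trans ?_
          gcongr
          exact_mod_cast hVp j i p hp
        refine (Finset.sum_le_sum this).trans ?_
        rw [← Finset.sum_mul, mul_assoc]
        have := l2norm_nonneg (U i)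
        have := hKp j i
        gcongr
    · intro j i
      have hUφ : ∀ i' ω, U i' ω = ∑ A ∈ latticeSimplex (d i'), u i' A * φ A ω := fun i' ω =>
        Finset.sum_congr rfl fun A _ => mul_assoc _ _ _
      have hterm : ∀ p ∈ (c j i).support, ∀ A ∈ latticeSimplex (d i),
          (mono p.1 A : ℂ) ≠ 0 → A + p.2 ∈ latticeSimplex D := by
        intro p hp A hA hne
        rw [mem_latticeSimplex] at hA ⊢
        constructor
        · intro l
          have h1 := hA.1 l
          by_cases h0 : p.1 l = 0
          · rw [Pi.add_apply, hc0 j i p hp l h0]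
            omega
          · have h2 : t A l ≠ 0 := by
              intro h3
              apply hne
              have : mono p.1 A = 0 :=
                Finset.prod_eq_zero (Finset.mem_univ l) (by rw [h3, zero_pow h0])
              rw [this, Complex.ofReal_zero]
            have h3 := lt_of_cutoff_ne_zero hD0 h2
            have h4 := hBp j i p hp l
            rw [Pi.add_apply]
            omega
        · simp only [Pi.add_apply]
          rw [Finset.sum_add_distrib, hA.2, hck j i p hp, hdk]
          ring
      have hvan : ∀ p ∈ (c j i).support, ∀ A ∈ latticeSimplex (d i),
          star (mono p.1 A : ℂ) * ∑ ω, star (φ (A + p.2) ω) * ∑ i', M ω j i' * U i' ω = 0 := by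
        intro p hp A hA
        by_cases h0 : (mono p.1 A : ℂ) = 0
        · rw [h0, star_zero, zero_mul]
        · simp only [hUφ]
          rw [hu j _ (hterm p hp A hA h0), mul_zero]
      have : ∑ ω, star (v j i ω) * ∑ i', M ω j i' * U i' ω = ∑ p ∈ (c j i).support,
          star (c j i p) * ∑ A ∈ latticeSimplex (d i), star (u i A) * (star (mono p.1 A : ℂ) *
            ∑ ω, star (φ (A + p.2) ω) * ∑ i', M ω j i' * U i' ω) := by
        simp only [v, star_sum, star_mul', Finset.sum_mul _ (fun p => star (c j i p) * _)]
        rw [Finset.sum_comm]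
        refine Finset.sum_congr rfl fun p _ => ?_
        simp only [mul_assoc]
        rw [← Finset.mul_sum]
        congr 1
        simp only [Finset.sum_mul _ (fun A => star (u i A) * _)]
        rw [Finset.sum_comm]
        refine Finset.sum_congr rfl fun A _ => ?_
        simp only [mul_assoc]
        rw [← Finset.mul_sum, ← Finset.mul_sum]
      rw [this]
      exact Finset.sum_eq_zero fun p hp => by
        rw [Finset.sum_eq_zero fun A hA => by rw [hvan p hp A hA, mul_zero], mul_zero]
  have hpos : 0 < l2norm (U i₀) ^ 2 := by
    rw [l2norm_sq, sum_wave_sq hQ0 _ (fun A => A) (hsep i₀) (u i₀) fun A ξ => cubeInd R A ξ]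
    refine mul_pos (by positivity) (Finset.sum_pos' (fun A _ => ?_) ⟨A₀, hA₀, ?_⟩)
    · exact mul_nonneg (sq_nonneg _) (Finset.sum_nonneg fun _ _ => sq_nonneg _)
    · rw [sum_cubeInd_sq_eq (hcX i₀ A₀ hA₀)]
      have := norm_pos_iff.2 hu₀
      positivity
  rw [hzero] at hpos
  norm_num at hpos

lemma unitExp_average_eq {Q : ℕ} (hQ : 0 < Q) {k : ℤ} (hk : k.natAbs < Q) :
    (Q : ℂ)⁻¹ * ∑ θ : Fin Q, unitExp (k * (θ : ℕ) / Q) = if k = 0 then 1 else 0 := by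
  split_ifs with h
  · simp [h, unitExp_zero, hQ.ne']
  · rw [sum_unitExp_eq_zero hQ, mul_zero]
    intro hdvd
    exact h (Int.eq_zero_of_abs_lt_dvd hdvd (by rw [Int.abs_eq_natAbs]; exact_mod_cast hk))

/-- Averaging discards the terms of the wrong degree in an approximation of a homogeneous
function. -/
lemma norm_sub_sum_filter_le {ι : Type*} (F : (Fin 3 → ℝ) → ℂ) (k : ℤ)
    (hF : ∀ a α, F (fun l => a l + α) = F a * unitExp (k * α)) (S : Finset ι) (z : ι → ℂ)
    (b : ι → Fin 3 → ℤ) {ε : ℝ}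
    (h : ∀ a, ‖F a - ∑ p ∈ S, z p * unitExp (∑ l, b p l * a l)‖ ≤ ε) (a : Fin 3 → ℝ) :
    ‖F a - ∑ p ∈ S with ∑ l, b p l = k, z p * unitExp (∑ l, b p l * a l)‖ ≤ ε := by
  set Q : ℕ := ∑ p ∈ S, (∑ l, b p l - k).natAbs + 1 with hQdef
  have hQ : 0 < Q := Nat.succ_pos _
  have hQp : ∀ p ∈ S, (∑ l, b p l - k).natAbs < Q := fun p hp =>
    Nat.lt_succ_of_le (Finset.single_le_sum (f := fun p => (∑ l, b p l - k).natAbs)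
      (fun _ _ => Nat.zero_le _) hp)
  have hQC : (Q : ℂ) ≠ 0 := by exact_mod_cast hQ.ne'
  have h1 : F a = (Q : ℂ)⁻¹ * ∑ θ : Fin Q, F (fun l => a l + (θ : ℕ) / Q) *
      unitExp (-(k * ((θ : ℕ) / Q))) := by
    have : ∀ θ : Fin Q, F (fun l => a l + (θ : ℕ) / Q) * unitExp (-(k * ((θ : ℕ) / Q))) = F a := by
      intro θ
      rw [hF, mul_assoc, ← unitExp_add, add_neg_cancel, unitExp_zero, mul_one]
    rw [Finset.sum_congr rfl fun θ _ => this θ]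
    simp [hQC]
  have h2 : ∑ p ∈ S with ∑ l, b p l = k, z p * unitExp (∑ l, b p l * a l) =
      (Q : ℂ)⁻¹ * ∑ θ : Fin Q, (∑ p ∈ S, z p * unitExp (∑ l, b p l * (a l + (θ : ℕ) / Q))) *
        unitExp (-(k * ((θ : ℕ) / Q))) := by
    simp only [Finset.sum_mul]
    rw [Finset.sum_comm, Finset.mul_sum, Finset.sum_filter]
    refine Finset.sum_congr rfl fun p hp => ?_
    have h3 : ∀ θ : Fin Q, z p * unitExp (∑ l, b p l * (a l + (θ : ℕ) / Q)) *
        unitExp (-(k * ((θ : ℕ) / Q))) = z p * unitExp (∑ l, b p l * a l) *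
          unitExp (((∑ l, b p l - k : ℤ) : ℝ) * (θ : ℕ) / Q) := by
      intro θ
      rw [mul_assoc, mul_assoc, ← unitExp_add, ← unitExp_add]
      congr 2
      push_cast
      simp only [Fin.sum_univ_three]
      ring
    rw [Finset.sum_congr rfl fun θ _ => h3 θ, ← Finset.mul_sum, mul_left_comm,
      unitExp_average_eq hQ (hQp p hp)]
    simp only [sub_eq_zero, mul_ite, mul_one, mul_zero]
  rw [h2, h1, ← mul_sub, ← Finset.sum_sub_distrib, norm_mul]
  have h4 : ‖∑ θ : Fin Q, (F (fun l => a l + (θ : ℕ) / Q) * unitExp (-(k * ((θ : ℕ) / Q))) -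
      (∑ p ∈ S, z p * unitExp (∑ l, b p l * (a l + (θ : ℕ) / Q))) *
        unitExp (-(k * ((θ : ℕ) / Q))))‖ ≤ ∑ θ : Fin Q, ε := by
    refine (norm_sum_le _ _).trans (Finset.sum_le_sum fun θ _ => ?_)
    rw [← sub_mul, norm_mul, norm_unitExp, mul_one]
    exact h _
  rw [Finset.sum_const, Finset.card_univ, Fintype.card_fin, nsmul_eq_mul] at h4
  rw [norm_inv, Complex.norm_natCast, inv_mul_le_iff₀ (by exact_mod_cast hQ)]
  exact h4

/-- The union of the three "faces" of the cube of the solenoid cone. -/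
def conesBoundary : Set (Fin 3 → SolCone) := {x | ∃ l, x l 0 = 1}

lemma isClosed_conesBoundary : IsClosed conesBoundary := by
  have : conesBoundary = ⋃ l : Fin 3, {x : Fin 3 → SolCone | x l 0 = 1} := by
    ext x
    simp [conesBoundary]
  rw [this]
  exact isClosed_iUnion_of_finite fun l =>
    isClosed_eq ((SolCone.continuous_apply 0).comp (continuous_apply l)) continuous_const

/-- A trigonometric polynomial with rational frequencies and polynomial radial dependence. -/
def IsConePolynomial (f : conesBoundary → ℂ) : Prop :=
  ∃ c : ((Fin 3 → ℕ) × (Fin 3 → ℚ)) →₀ ℂ, (∀ p ∈ c.support, ∀ l, p.1 l = 0 → p.2 l = 0) ∧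
    ∀ (t : Fin 3 → unitInterval) (a : Fin 3 → ℝ)
      (h : (fun l => SolCone.mk (t l) (a l)) ∈ conesBoundary), f ⟨_, h⟩ = c.sum fun p z =>
        z * ((∏ l, (t l : ℝ) ^ p.1 l : ℝ) : ℂ) * unitExp (∑ l, p.2 l * a l)

lemma IsConePolynomial.add {f g : conesBoundary → ℂ} (hf : IsConePolynomial f)
    (hg : IsConePolynomial g) : IsConePolynomial (f + g) := by
  classical
  obtain ⟨c, hc, hc'⟩ := hf
  obtain ⟨d, hd, hd'⟩ := hg
  refine ⟨c + d, fun p hp => ?_, fun t a h => ?_⟩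
  · rcases Finset.mem_union.1 (Finsupp.support_add hp) with h | h
    exacts [hc p h, hd p h]
  · rw [Finsupp.sum_add_index' (fun _ => by simp) (fun _ _ _ => by ring), Pi.add_apply, hc', hd']

lemma IsConePolynomial.smul {f : conesBoundary → ℂ} (hf : IsConePolynomial f) (r : ℂ) :
    IsConePolynomial (r • f) := by
  classical
  obtain ⟨c, hc, hc'⟩ := hf
  refine ⟨r • c, fun p hp => hc p (Finsupp.support_smul hp), fun t a h => ?_⟩
  rw [Finsupp.sum_smul_index (fun _ => by simp), Pi.smul_apply, hc', Finsupp.smul_sum]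
  refine Finset.sum_congr rfl fun p _ => ?_
  simp only [smul_eq_mul]
  ring

/-- The coordinate functions on `conesBoundary`. -/
def coneCoord (lq : Fin 3 × ℚ) : C(conesBoundary, ℂ) :=
  ⟨fun x => x.1 lq.1 lq.2, (SolCone.continuous_apply lq.2).comp
    ((continuous_apply lq.1).comp continuous_subtype_val)⟩

lemma exists_monomial_of_mem_closure {f : C(conesBoundary, ℂ)}
    (hf : f ∈ Submonoid.closure (Set.range coneCoord)) :
    ∃ (ν : Fin 3 → ℕ) (b : Fin 3 → ℚ), (∀ l, ν l = 0 → b l = 0) ∧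
      ∀ (t : Fin 3 → unitInterval) (a : Fin 3 → ℝ)
        (h : (fun l => SolCone.mk (t l) (a l)) ∈ conesBoundary),
        f ⟨_, h⟩ = ((∏ l, (t l : ℝ) ^ ν l : ℝ) : ℂ) * unitExp (∑ l, b l * a l) := by
  induction hf using Submonoid.closure_induction with
  | mem f hf =>
    obtain ⟨⟨l, q⟩, rfl⟩ := hf
    refine ⟨Pi.single l 1, Pi.single l q, fun j hj => ?_, fun t a h => ?_⟩
    · by_cases hjl : j = l
      · subst hjl
        simp at hj
      · simp [hjl]
    · have h1 : ∏ j, (t j : ℝ) ^ (Pi.single l 1 : Fin 3 → ℕ) j = t l := by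
        rw [Finset.prod_eq_single l] <;> simp +contextual
      have h2 : ∑ j, ((Pi.single l q : Fin 3 → ℚ) j : ℝ) * a j = q * a l := by
        rw [Finset.sum_eq_single l] <;> simp +contextual
      rw [h1, h2]
      simp [coneCoord, SolCone.mk_apply, unitExp]
  | one => exact ⟨0, 0, fun _ _ => rfl, fun t a h => by simp [unitExp_zero]⟩
  | mul f g _ _ hf hg =>
    obtain ⟨ν, b, h1, h2⟩ := hf
    obtain ⟨ν', b', h1', h2'⟩ := hg
    refine ⟨ν + ν', b + b', fun l hl => ?_, fun t a h => ?_⟩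
    · have := Nat.add_eq_zero_iff.1 hl
      rw [Pi.add_apply, h1 l this.1, h1' l this.2, add_zero]
    · rw [ContinuousMap.mul_apply, h2, h2']
      simp only [Pi.add_apply, pow_add, Finset.prod_mul_distrib, Rat.cast_add, add_mul,
        Finset.sum_add_distrib, unitExp_add, Complex.ofReal_mul]
      ring

instance : CompactSpace conesBoundary := isCompact_iff_compactSpace.1 isClosed_conesBoundary.isCompact

lemma exists_conePolynomial_near (f : C(conesBoundary, ℂ)) {ε : ℝ} (hε : 0 < ε) :
    ∃ g : C(conesBoundary, ℂ), IsConePolynomial g ∧ ∀ x, ‖f x - g x‖ ≤ ε := by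
  have hstar : star (Set.range coneCoord) ⊆ Set.range coneCoord := by
    rintro f ⟨⟨l, q⟩, hlq⟩
    refine ⟨⟨l, -q⟩, ?_⟩
    rw [← star_star f, ← hlq]
    ext x
    simp [coneCoord, SolCone.apply_neg]
  set A := StarAlgebra.adjoin ℂ (Set.range coneCoord) with hA
  have hsep : A.toSubalgebra.SeparatesPoints := by
    intro x y hxy
    have : ∃ l q, x.1 l q ≠ y.1 l q := by
      by_contra! h
      exact hxy (Subtype.ext (funext fun l => SolCone.ext (h l)))
    obtain ⟨l, q, hlq⟩ := this
    exact ⟨coneCoord (l, q), ⟨_, StarAlgebra.subset_adjoin ℂ _ ⟨(l, q), rfl⟩, rfl⟩, hlq⟩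
  have htop := ContinuousMap.starSubalgebra_topologicalClosure_eq_top_of_separatesPoints A hsep
  have hf : f ∈ closure (A : Set C(conesBoundary, ℂ)) := by
    rw [← StarSubalgebra.topologicalClosure_coe, htop]
    trivial
  obtain ⟨g, hg, hfg⟩ := Metric.mem_closure_iff.1 hf ε hε
  refine ⟨g, ?_, fun x => ?_⟩
  · have hg' : g ∈ Algebra.adjoin ℂ (Set.range coneCoord) := by
      have := StarAlgebra.adjoin_toSubalgebra ℂ (Set.range coneCoord)
      rw [Set.union_eq_left.2 hstar] at this
      rw [← this]
      exact hg
    rw [← Subalgebra.mem_toSubmodule, Algebra.adjoin_eq_span] at hg'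
    clear hfg hg
    induction hg' using Submodule.span_induction with
    | mem g hg =>
      obtain ⟨ν, b, h1, h2⟩ := exists_monomial_of_mem_closure hg
      refine ⟨Finsupp.single (ν, b) 1, fun p hp => ?_, fun t a h => ?_⟩
      · rw [Finset.mem_singleton.1 (Finsupp.support_single_subset hp)]
        exact h1
      · rw [h2, Finsupp.sum_single_index (by simp), one_mul]
    | zero => exact ⟨0, by simp, fun t a h => by simp⟩
    | add f g _ _ hf hg => exact hf.add hg
    | smul r f _ hf => exact hf.smul r
  · rw [← dist_eq_norm]
    exact (ContinuousMap.dist_apply_le_dist x).trans hfg.le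

lemma exists_common_denominator (S : Finset ℚ) :
    ∃ m : ℕ, 0 < m ∧ ∀ q ∈ S, (((m * q).num : ℤ) : ℚ) = m * q := by
  refine ⟨∏ q ∈ S, q.den, Finset.prod_pos fun q _ => q.den_pos, fun q hq => ?_⟩
  obtain ⟨r, hr⟩ := Finset.dvd_prod_of_mem (fun q : ℚ => q.den) hq
  rw [hr]
  have : ((q.den * r : ℕ) : ℚ) * q = ((r * q.num : ℤ) : ℚ) := by
    push_cast
    rw [mul_comm (q.den : ℚ), mul_assoc, Rat.den_mul_eq_num]
  rw [this, Rat.num_intCast]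

/-- There is no continuous field of unitary matrices on `conesBoundary` whose columns are
equivariant of weights `κ i` under the solenoid, if `∑ i, κ i ≤ 0` and `κ ≠ 0`. -/
lemma false_of_equivariant_unitary {n : ℕ} (κ : Fin n → ℚ) (hκ : ∑ i, κ i ≤ 0) (hκ0 : κ ≠ 0)
    (M : (Fin 3 → SolCone) → Matrix (Fin n) (Fin n) ℂ) (hM : ContinuousOn M conesBoundary)
    (hMu : ∀ x ∈ conesBoundary, M x ∈ Matrix.unitaryGroup (Fin n) ℂ)
    (hMe : ∀ x ∈ conesBoundary, ∀ s : SolCone, s 0 = 1 → ∀ j i,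
      M (fun l => x l * s) j i = M x j i * s (κ i)) : False := by
  classical
  set ε : ℝ := 1 / (4 * (n + 1)) with hε
  have hε0 : 0 < ε := by positivity
  have hnear : ∀ j i, ∃ g : C(conesBoundary, ℂ), IsConePolynomial g ∧
      ∀ x : conesBoundary, ‖M x j i - g x‖ ≤ ε := fun j i =>
    exists_conePolynomial_near ⟨fun x : conesBoundary => M x j i,
      ((continuousOn_iff_continuous_domRestrict.1 hM).matrix_elem j i)⟩ hε0
  choose g hg hMg using hnear
  choose c hc hgc using hg
  obtain ⟨m, hm, hmS⟩ := exists_common_denominator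
    ((Finset.univ.biUnion fun j => Finset.univ.biUnion fun i => (c j i).support.biUnion fun p =>
      Finset.univ.image p.2) ∪ Finset.univ.image κ)
  have hmκ : ∀ i, (((m * κ i).num : ℤ) : ℚ) = m * κ i := fun i => hmS _ (by simp)
  have hmc : ∀ j i, ∀ p ∈ (c j i).support, ∀ l, (((m * p.2 l).num : ℤ) : ℚ) = m * p.2 l := by
    intro j i p hp l
    refine hmS _ (Finset.mem_union_left _ ?_)
    simp only [Finset.mem_biUnion, Finset.mem_univ, true_and]
    exact ⟨j, i, p, hp, Finset.mem_image_of_mem _ (Finset.mem_univ l)⟩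
  let toInt : (Fin 3 → ℕ) × (Fin 3 → ℚ) → (Fin 3 → ℕ) × (Fin 3 → ℤ) :=
    fun p => (p.1, fun l => (m * p.2 l).num)
  let c' : Fin n → Fin n → ((Fin 3 → ℕ) × (Fin 3 → ℤ)) →₀ ℂ := fun j i =>
    Finsupp.mapDomain toInt (c j i)
  let k : Fin n → ℤ := fun i => (m * κ i).num
  refine false_of_homogeneous_approx (n := n) k ?_ ?_
    (fun j i => (c' j i).filter fun p => ∑ l, p.2 l = k i) ?_ ?_ hε0.le ?_ ?_
  · have : ((∑ i, k i : ℤ) : ℚ) ≤ 0 := by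
      rw [Int.cast_sum, Finset.sum_congr rfl fun i _ => hmκ i, ← Finset.mul_sum]
      exact mul_nonpos_of_nonneg_of_nonpos (Nat.cast_nonneg _) hκ
    exact_mod_cast this
  · intro h
    refine hκ0 (funext fun i => ?_)
    have h1 : k i = 0 := congrFun h i
    have h2 := hmκ i
    change ((k i : ℤ) : ℚ) = _ at h2
    rw [h1, Int.cast_zero, eq_comm, mul_eq_zero] at h2
    exact h2.resolve_left (by exact_mod_cast hm.ne')
  · intro j i p hp l hl
    have h1 := (Finset.mem_filter.1 ((Finsupp.support_filter _ _).subset hp)).1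
    obtain ⟨p', hp', rfl⟩ := Finset.mem_image.1 (Finsupp.mapDomain_support h1)
    have : p'.2 l = 0 := hc j i p' hp' l hl
    simp [toInt, this]
  · intro j i p hp
    exact (Finset.mem_filter.1 ((Finsupp.support_filter _ _).subset hp)).2
  · rw [hε, mul_one_div, div_le_div_iff₀ (by positivity) (by norm_num)]
    linarith
  · intro t ht ⟨l₀, hl₀⟩ a
    let tI : Fin 3 → unitInterval := fun l => ⟨t l, ht l⟩
    let pt : (Fin 3 → ℝ) → Fin 3 → SolCone := fun a l => SolCone.mk (tI l) (m * a l)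
    have hpt : ∀ a, pt a ∈ conesBoundary := fun a => ⟨l₀, by
      simp [pt, SolCone.mk_apply, tI, hl₀]⟩
    refine ⟨M (pt a), hMu _ (hpt a), fun j i => ?_⟩
    have hfil := norm_sub_sum_filter_le (fun a => M (pt a) j i) (k i) (fun a α => ?_)
      (c' j i).support (fun p => c' j i p * ((∏ l, t l ^ p.1 l : ℝ) : ℂ)) (fun p => p.2)
      (ε := ε) (fun a => ?_) a
    · rw [Finsupp.support_filter, Finset.sum_congr rfl fun p hp => by
        rw [Finsupp.filter_apply_pos (fun p => ∑ l, p.2 l = k i) (c' j i)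
          (Finset.mem_filter.1 hp).2]]
      exact hfil
    · have h1 : pt (fun l => a l + α) = fun l => pt a l * SolCone.mk 1 (m * α) := by
        funext l
        refine SolCone.ext fun q => ?_
        simp only [pt, SolCone.mul_apply, SolCone.mk_apply, Set.Icc.coe_one, Complex.ofReal_one,
          one_mul, mul_assoc, ← Complex.exp_add]
        push_cast
        ring_nf
      have h2 : (SolCone.mk 1 (m * α)) (κ i) = unitExp (k i * α) := by
        have h3 : ((k i : ℤ) : ℝ) = m * κ i := by exact_mod_cast congrArg (Rat.cast (K := ℝ)) (hmκ i)
        rw [SolCone.mk_apply, h3, unitExp]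
        push_cast
        ring_nf
      rw [h1, hMe _ (hpt a) _ (by simp [SolCone.mk_apply]), h2]
    · have h1 := hMg j i ⟨pt a, hpt a⟩
      rw [hgc j i tI _ (hpt a)] at h1
      refine le_of_eq_of_le ?_ h1
      congr 2
      change (c' j i).sum (fun p z => z * ((∏ l, t l ^ p.1 l : ℝ) : ℂ) *
        unitExp (∑ l, p.2 l * a l)) = _
      rw [Finsupp.sum_mapDomain_index (fun _ => by simp) (fun _ _ _ => by ring)]
      refine Finset.sum_congr rfl fun p hp => ?_
      change c j i p * _ * _ = c j i p * _ * _
      congr 2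
      refine Finset.sum_congr rfl fun l _ => ?_
      have h3 : (((m * p.2 l).num : ℤ) : ℝ) = m * p.2 l := by
        exact_mod_cast congrArg (Rat.cast (K := ℝ)) (hmc j i p hp l)
      simp only [toInt, h3]
      ring

section AbstractPeterWeyl
variable {G : Type*} [Group G] [TopologicalSpace G] {H : Type*} [NormedAddCommGroup H]
  [InnerProductSpace ℂ H]

lemma inner_isometricAction {L : G → H →ₗᵢ[ℂ] H} (hL1 : ∀ φ, L 1 φ = φ)
    (hLm : ∀ g h φ, L (g * h) φ = L g (L h φ)) (g : G) (φ ψ : H) :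
    inner ℂ (L g φ) ψ = inner ℂ φ (L g⁻¹ ψ) := by
  rw [← (L g).inner_map_map φ, ← hLm, mul_inv_cancel, hL1]

/-- A finite-dimensional invariant subspace of a continuous isometric action gives a unitary
representation. -/
lemma exists_unitaryRep_of_invariant {L : G → H →ₗᵢ[ℂ] H} (hL1 : ∀ φ, L 1 φ = φ)
    (hLm : ∀ g h φ, L (g * h) φ = L g (L h φ)) (hLc : ∀ φ, Continuous fun g => L g φ)
    (E : Submodule ℂ H) [FiniteDimensional ℂ E] (hE : ∀ g, ∀ φ ∈ E, L g φ ∈ E) (g : G)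
    {v : H} (hv : v ∈ E) (hgv : L g v ≠ v) :
    ∃ (n : ℕ) (ρ : G →* Matrix.unitaryGroup (Fin n) ℂ), Continuous ρ ∧ ρ g ≠ 1 := by
  let b := stdOrthonormalBasis ℂ E
  let ℓ : G → E → E := fun g φ => ⟨L g φ, hE g φ φ.2⟩
  have hinner : ∀ g (φ ψ : E), inner ℂ (ℓ g φ) ψ = inner ℂ φ (ℓ g⁻¹ ψ) := fun g φ ψ =>
    inner_isometricAction hL1 hLm g φ ψ
  have hℓm : ∀ g h φ, ℓ (g * h) φ = ℓ g (ℓ h φ) := fun g h φ => Subtype.ext (hLm g h φ)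
  have hℓ1 : ∀ φ, ℓ 1 φ = φ := fun φ => Subtype.ext (hL1 φ)
  let m : G → Matrix (Fin _) (Fin _) ℂ := fun h => Matrix.of fun i j => inner ℂ (b i) (ℓ h (b j))
  have hm1 : m 1 = 1 := by
    ext i j
    simp only [m, Matrix.of_apply, hℓ1, Matrix.one_apply]
    exact orthonormal_iff_ite.1 b.orthonormal i j
  have hmm : ∀ h h', m (h * h') = m h * m h' := by
    intro h h'
    ext i j
    rw [Matrix.mul_apply]
    have : ∀ k, m h i k * m h' k j = inner ℂ (ℓ h⁻¹ (b i)) (b k) * inner ℂ (b k) (ℓ h' (b j)) := by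
      intro k
      rw [hinner, inv_inv]
      rfl
    rw [Finset.sum_congr rfl fun k _ => this k, b.sum_inner_mul_inner, hinner, inv_inv, ← hℓm]
    rfl
  have hms : ∀ h, star (m h) = m h⁻¹ := by
    intro h
    ext i j
    rw [Matrix.star_apply]
    simp only [m, Matrix.of_apply]
    rw [← hinner, Complex.star_def, inner_conj_symm]
  have hmu : ∀ h, m h ∈ Matrix.unitaryGroup (Fin _) ℂ := fun h => by
    rw [Matrix.mem_unitaryGroup_iff, hms, ← hmm, mul_inv_cancel, hm1]
  let ρ : G →* Matrix.unitaryGroup (Fin _) ℂ :=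
    { toFun := fun h => ⟨m h, hmu h⟩
      map_one' := Subtype.ext hm1
      map_mul' := fun h h' => Subtype.ext (hmm h h') }
  refine ⟨_, ρ, ?_, fun hρ => hgv ?_⟩
  · refine Continuous.subtype_mk (continuous_matrix fun i j => ?_) _
    exact Continuous.inner (f := fun _ => (b i : H)) continuous_const (hLc (b j))
  · have hg : m g = 1 := congrArg Subtype.val hρ
    have h1 : ∀ j, ℓ g (b j) = b j := by
      intro j
      refine b.toBasis.ext_elem_iff.2 fun i => ?_
      rw [OrthonormalBasis.coe_toBasis_repr_apply, OrthonormalBasis.coe_toBasis_repr_apply,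
        b.repr_apply_apply, b.repr_apply_apply, orthonormal_iff_ite.1 b.orthonormal i j]
      have := congrFun (congrFun hg i) j
      rwa [Matrix.one_apply] at this
    have h2 : (L g).toLinearMap ∘ₗ E.subtype = E.subtype :=
      b.toBasis.ext fun j => by simpa [ℓ] using congrArg Subtype.val (h1 j)
    exact LinearMap.congr_fun h2 ⟨v, hv⟩

lemma exists_unitaryRep_of_compactOperator [CompleteSpace H] {L : G → H →ₗᵢ[ℂ] H}
    (hL1 : ∀ φ, L 1 φ = φ)
    (hLm : ∀ g h φ, L (g * h) φ = L g (L h φ)) (hLc : ∀ φ, Continuous fun g => L g φ)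
    (T : H →L[ℂ] H) (hT : IsCompactOperator T) (hTL : ∀ g φ, T (L g φ) = L g (T φ)) (g : G)
    {ψ : H} (hg : L g (T ψ) ≠ T ψ) :
    ∃ (n : ℕ) (ρ : G →* Matrix.unitaryGroup (Fin n) ℂ), Continuous ρ ∧ ρ g ≠ 1 := by
  set A : H →L[ℂ] H := (ContinuousLinearMap.adjoint T) ∘L T with hA
  have hAinner : ∀ φ χ, inner ℂ (A φ) χ = inner ℂ (T φ) (T χ) := fun φ χ =>
    ContinuousLinearMap.adjoint_inner_left T χ (T φ)
  have hAc : IsCompactOperator A := hT.clm_comp (ContinuousLinearMap.adjoint T)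
  have hAs : A.IsSymmetric := fun φ χ => by
    change inner ℂ (A φ) χ = inner ℂ φ (A χ)
    rw [hAinner, ← inner_conj_symm φ, hAinner, inner_conj_symm]
  have hAL : ∀ h φ, A (L h φ) = L h (A φ) := by
    intro h φ
    refine ext_inner_right ℂ fun χ => ?_
    rw [hAinner, hTL, inner_isometricAction hL1 hLm, inner_isometricAction hL1 hLm, ← hTL, hAinner]
  by_cases htriv : ∀ μ : ℂ, μ ≠ 0 → ∀ v ∈ Module.End.eigenspace A.toLinearMap μ, L g v = v
  · exfalso
    apply hg
    have h1 : ∀ φ, A (L g φ) = A φ := by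
      let Z : H →L[ℂ] H := A ∘L (L g).toContinuousLinearMap - A
      have hZ : (⨆ μ, Module.End.eigenspace A.toLinearMap μ) ≤ LinearMap.ker Z.toLinearMap := by
        refine iSup_le fun μ v hv => ?_
        have hv' : A v = μ • v := Module.End.mem_eigenspace_iff.1 hv
        change A (L g v) - A v = 0
        rw [hAL]
        by_cases hμ : μ = 0
        · rw [hv', hμ, zero_smul, map_zero, sub_zero]
        · rw [hv', map_smul, htriv μ hμ v hv, sub_self]
      have htop : (⨆ μ, Module.End.eigenspace A.toLinearMap μ).topologicalClosure = ⊤ := by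
        rw [Submodule.topologicalClosure_eq_top_iff]
        exact ContinuousLinearMap.orthogonalComplement_iSup_eigenspaces_eq_bot hAc hAs
      have hZ' : LinearMap.ker Z.toLinearMap = ⊤ := by
        rw [eq_top_iff, ← htop]
        exact Submodule.topologicalClosure_minimal _ hZ Z.isClosed_ker
      intro φ
      have : φ ∈ LinearMap.ker Z.toLinearMap := hZ' ▸ Submodule.mem_top
      exact sub_eq_zero.1 this
    have h2 : T (L g ψ - ψ) = 0 := by
      rw [← inner_self_eq_zero (𝕜 := ℂ), ← hAinner, map_sub, h1, sub_self, inner_zero_left]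
    rw [map_sub, sub_eq_zero, hTL] at h2
    exact h2
  · push Not at htriv
    obtain ⟨μ, hμ, v, hv, hgv⟩ := htriv
    have := ContinuousLinearMap.finite_dimensional_eigenspace hAc μ hμ
    refine exists_unitaryRep_of_invariant hL1 hLm hLc
      (Module.End.eigenspace A.toLinearMap μ) (fun h φ hφ => ?_) g hv hgv
    rw [Module.End.mem_eigenspace_iff] at hφ ⊢
    change A φ = _ at hφ
    change A (L h φ) = _
    rw [hAL, hφ, map_smul]

end AbstractPeterWeyl

section PeterWeyl
open MeasureTheory
variable {G : Type*} [Group G] [TopologicalSpace G] [IsTopologicalGroup G] [CompactSpace G]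
  [MeasurableSpace G] [BorelSpace G]

/-- The left regular representation on the square-integrable functions. -/
noncomputable def leftRegular (μ : Measure G) [μ.IsHaarMeasure] (g : G) :
    Lp ℂ 2 μ →ₗᵢ[ℂ] Lp ℂ 2 μ where
  toFun φ := DomMulAct.mk g⁻¹ • φ
  map_add' := smul_add _
  map_smul' _ _ := smul_comm _ _ _
  norm_map' φ := DomMulAct.norm_smul_Lp _ φ

variable (μ : Measure G) [μ.IsHaarMeasure] [μ.Regular]

lemma leftRegular_one (φ : Lp ℂ 2 μ) : leftRegular μ 1 φ = φ := by
  change DomMulAct.mk (1 : G)⁻¹ • φ = φ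
  rw [inv_one, DomMulAct.mk_one, one_smul]

lemma leftRegular_mul (g h : G) (φ : Lp ℂ 2 μ) :
    leftRegular μ (g * h) φ = leftRegular μ g (leftRegular μ h φ) := by
  change DomMulAct.mk (g * h)⁻¹ • φ = DomMulAct.mk g⁻¹ • DomMulAct.mk h⁻¹ • φ
  rw [mul_inv_rev, DomMulAct.mk_mul, mul_smul]

lemma continuous_leftRegular (φ : Lp ℂ 2 μ) : Continuous fun g => leftRegular μ g φ := by
  change Continuous fun g : G => DomMulAct.mk g⁻¹ • φ
  have : Continuous fun g : G => DomMulAct.mk g⁻¹ :=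
    DomMulAct.continuous_mk.comp continuous_inv
  have hf : Fact ((2 : ENNReal) ≠ ⊤) := ⟨by norm_num⟩
  exact this.smul continuous_const

/-- The matrix coefficient operator of a square-integrable function. -/
noncomputable def coefficientMap (F : Lp ℂ 2 μ) : Lp ℂ 2 μ →L[ℂ] BoundedContinuousFunction G ℂ :=
  LinearMap.mkContinuous
    { toFun := fun φ => BoundedContinuousFunction.mkOfCompact
        ⟨fun x => inner ℂ (leftRegular μ x F) φ,
          (continuous_leftRegular μ F).inner continuous_const⟩
      map_add' := fun φ ψ => by
        ext x
        exact inner_add_right (𝕜 := ℂ) (leftRegular μ x F) φ ψ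
      map_smul' := fun c φ => by
        ext x
        exact inner_smul_right (𝕜 := ℂ) (leftRegular μ x F) φ c } ‖F‖ fun φ => by
    rw [BoundedContinuousFunction.norm_le (by positivity)]
    intro x
    refine (norm_inner_le_norm (𝕜 := ℂ) (leftRegular μ x F) φ).trans ?_
    rw [(leftRegular μ x).norm_map]

lemma coefficientMap_apply (F φ : Lp ℂ 2 μ) (x : G) :
    coefficientMap μ F φ x = inner ℂ (leftRegular μ x F) φ := rfl

lemma isCompactOperator_coefficientMap (F : Lp ℂ 2 μ) : IsCompactOperator (coefficientMap μ F) := by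
  let A := coefficientMap μ F '' Metric.ball 0 1
  refine ⟨closure A, ?_, Filter.mem_of_superset (Metric.ball_mem_nhds 0 one_pos) fun φ hφ =>
    subset_closure ⟨φ, hφ, rfl⟩⟩
  refine BoundedContinuousFunction.arzela_ascoli (Metric.closedBall 0 ‖F‖)
    (isCompact_closedBall _ _) A ?_ ?_
  · rintro _ x ⟨φ, hφ, rfl⟩
    rw [mem_closedBall_zero_iff, coefficientMap_apply]
    refine (norm_inner_le_norm _ _).trans ?_
    rw [(leftRegular μ x).norm_map]
    exact mul_le_of_le_one_right (norm_nonneg _) (mem_ball_zero_iff.1 hφ).le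
  · intro x
    rw [Metric.equicontinuousAt_iff_right]
    intro ε hε
    have := Metric.continuousAt_iff'.1 ((continuous_leftRegular μ F).continuousAt (x := x)) ε hε
    filter_upwards [this] with y hy
    rintro ⟨_, φ, hφ, rfl⟩
    change dist (coefficientMap μ F φ x) (coefficientMap μ F φ y) < ε
    rw [coefficientMap_apply, coefficientMap_apply, dist_eq_norm, ← inner_sub_left]
    refine (norm_inner_le_norm _ _).trans_lt ?_
    rw [← dist_eq_norm, dist_comm]
    exact (mul_le_of_le_one_right dist_nonneg (mem_ball_zero_iff.1 hφ).le).trans_lt hy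

end PeterWeyl

open MeasureTheory in
/-- **Peter–Weyl**: the finite-dimensional continuous unitary representations of a compact
Hausdorff group separate points. -/
theorem exists_unitaryRep_ne_one {G : Type u} [Group G] [TopologicalSpace G] [IsTopologicalGroup G]
    [CompactSpace G] [T2Space G] {g : G} (hg : g ≠ 1) :
    ∃ (n : ℕ) (ρ : G →* Matrix.unitaryGroup (Fin n) ℂ), Continuous ρ ∧ ρ g ≠ 1 := by
  let _ : MeasurableSpace G := borel G
  have : BorelSpace G := ⟨rfl⟩
  set μ : Measure G := Measure.haar
  -- a bump function whose translate by `g` has disjoint support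
  obtain ⟨V, hVo, hV1, hV⟩ : ∃ V : Set G, IsOpen V ∧ (1 : G) ∈ V ∧ ∀ y ∈ V, g * y ∉ V := by
    obtain ⟨O₁, O₂, h1, h2, hg1, h12, hd⟩ := t2_separation hg
    refine ⟨O₂ ∩ (fun y => g * y) ⁻¹' O₁, h2.inter (h1.preimage (continuous_const_mul g)),
      ⟨h12, by simpa using hg1⟩, fun y hy hgy => ?_⟩
    exact Set.disjoint_left.1 hd hy.2 hgy.1
  obtain ⟨f, hf0, hf1, -⟩ := exists_continuous_zero_one_of_isClosed hVo.isClosed_compl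
    (isClosed_singleton (x := (1 : G))) (by simpa using hV1)
  let fC : BoundedContinuousFunction G ℂ := BoundedContinuousFunction.mkOfCompact
    ⟨fun x => (f x : ℂ), Complex.continuous_ofReal.comp f.continuous⟩
  let J := BoundedContinuousFunction.toLp (E := ℂ) 2 μ ℂ
  let F : Lp ℂ 2 μ := J fC
  let T : Lp ℂ 2 μ →L[ℂ] Lp ℂ 2 μ := J ∘L coefficientMap μ F
  have hJ : ∀ φ : BoundedContinuousFunction G ℂ, J φ =ᵐ[μ] φ := fun φ =>
    BoundedContinuousFunction.coeFn_toLp (p := 2) (μ := μ) (𝕜 := ℂ) φ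
  have hLJ : ∀ h (φ : BoundedContinuousFunction G ℂ),
      leftRegular μ h (J φ) = J (φ.compContinuous ⟨fun x => h⁻¹ * x, continuous_const_mul _⟩) := by
    intro h φ
    apply Lp.ext
    have h1 := DomMulAct.smul_Lp_ae_eq (DomMulAct.mk h⁻¹) (J φ)
    have h2 : (fun x => (J φ : G → ℂ) (h⁻¹ * x)) =ᵐ[μ] fun x => φ (h⁻¹ * x) :=
      (measurePreserving_mul_left μ h⁻¹).quasiMeasurePreserving.ae_eq_comp (hJ φ)
    refine h1.trans (h2.trans ?_)
    exact (hJ (φ.compContinuous ⟨fun x => h⁻¹ * x, continuous_const_mul _⟩)).symm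
  refine exists_unitaryRep_of_compactOperator (L := leftRegular μ) (leftRegular_one μ)
    (leftRegular_mul μ) (continuous_leftRegular μ) T
    ((isCompactOperator_coefficientMap μ F).clm_comp J) (fun h φ => ?_) g (ψ := F) ?_
  · change J _ = leftRegular μ h (J _)
    rw [hLJ]
    congr 1
    ext x
    change inner ℂ (leftRegular μ x F) (leftRegular μ h φ) =
      inner ℂ (leftRegular μ (h⁻¹ * x) F) φ
    have := inner_isometricAction (leftRegular_one μ) (leftRegular_mul μ) h⁻¹ (leftRegular μ x F) φ
    rw [leftRegular_mul, this, inv_inv]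
  · change leftRegular μ g (J _) ≠ J _
    rw [hLJ]
    intro h
    have hfun := BoundedContinuousFunction.toLp_injective (p := 2) (𝕜 := ℂ) μ h
    have h1 := DFunLike.congr_fun hfun 1
    change inner ℂ (leftRegular μ (g⁻¹ * 1) F) F = inner ℂ (leftRegular μ 1 F) F at h1
    rw [leftRegular_one, mul_one] at h1
    have h2 : inner ℂ (leftRegular μ g⁻¹ F) F = 0 := by
      rw [L2.inner_def]
      refine integral_eq_zero_of_ae ?_
      filter_upwards [hJ fC, (hLJ g⁻¹ fC ▸ hJ _ : leftRegular μ g⁻¹ F =ᵐ[μ] _)] with x hx1 hx2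
      rw [hx1, hx2]
      change inner ℂ ((f (g⁻¹⁻¹ * x) : ℝ) : ℂ) ((f x : ℝ) : ℂ) = 0
      rw [inv_inv]
      by_cases hx : x ∈ V
      · have : f (g * x) = 0 := hf0 (hV x hx)
        simp [this]
      · have : f x = 0 := hf0 hx
        simp [this]
    rw [h2, eq_comm, inner_self_eq_zero] at h1
    have h3 : fC = 0 := BoundedContinuousFunction.toLp_injective (p := 2) (𝕜 := ℂ) μ
      (h1.trans (map_zero J).symm)
    have h4 := DFunLike.congr_fun h3 1
    change ((f 1 : ℝ) : ℂ) = 0 at h4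
    rw [hf1 rfl] at h4
    simp at h4

/-- A linear isometry of a finite-dimensional complex inner product space has an orthonormal basis
of eigenvectors. -/
lemma exists_orthonormalBasis_eigenvectors {E : Type*} [NormedAddCommGroup E]
    [InnerProductSpace ℂ E] [FiniteDimensional ℂ E] {n : ℕ} (hn : Module.finrank ℂ E = n)
    (L : E →ₗᵢ[ℂ] E) :
    ∃ (b : OrthonormalBasis (Fin n) ℂ E) (μ : Fin n → ℂ), ∀ i, L (b i) = μ i • b i := by
  classical
  let T : Module.End ℂ E := L.toLinearMap
  have hT : ∀ v w, inner ℂ (T v) (T w) = inner ℂ v w := L.inner_map_map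
  have hμ : ∀ {μ : ℂ} {v : E}, v ∈ T.eigenspace μ → v ≠ 0 → starRingEnd ℂ μ * μ = 1 := by
    intro μ v hv hv0
    rw [Module.End.mem_eigenspace_iff] at hv
    have h := hT v v
    rw [hv, inner_smul_left, inner_smul_right, ← mul_assoc] at h
    exact mul_right_cancel₀ (inner_self_ne_zero.2 hv0) (h.trans (one_mul _).symm)
  have horth : OrthogonalFamily ℂ (fun μ : Module.End.Eigenvalues T => T.eigenspace μ)
      fun μ => (T.eigenspace μ).subtypeₗᵢ := by
    refine OrthogonalFamily.of_pairwise fun μ ν hne => ?_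
    rw [Function.onFun, Submodule.isOrtho_iff_inner_eq]
    intro v hv w hw
    by_cases hv0 : v = 0
    · rw [hv0, inner_zero_left]
    have h1 := hμ hv hv0
    rw [Module.End.mem_eigenspace_iff] at hv hw
    have h := hT v w
    rw [hv, hw, inner_smul_left, inner_smul_right, ← mul_assoc] at h
    by_contra hvw
    have h2 := mul_right_cancel₀ hvw (h.trans (one_mul _).symm)
    have h3 : starRingEnd ℂ (μ : ℂ) ≠ 0 := left_ne_zero_of_mul_eq_one h1
    exact hne (Subtype.ext (mul_left_cancel₀ h3 (h1.trans h2.symm)))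
  have hW : (⨆ μ, T.eigenspace μ)ᗮ = ⊥ := by
    have hinv : ∀ w ∈ (⨆ μ, T.eigenspace μ)ᗮ, T w ∈ (⨆ μ, T.eigenspace μ)ᗮ := by
      intro w hw
      rw [← Submodule.iInf_orthogonal, Submodule.mem_iInf] at hw ⊢
      intro μ v hv
      by_cases hv0 : v = 0
      · rw [hv0, inner_zero_left]
      have h1 := hμ hv hv0
      have h := hT v w
      rw [Module.End.mem_eigenspace_iff.1 hv, inner_smul_left, hw μ v hv] at h
      exact (mul_eq_zero.1 h).resolve_left (left_ne_zero_of_mul_eq_one h1)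
    by_contra hbot
    have : Nontrivial (⨆ μ, T.eigenspace μ)ᗮ := Submodule.nontrivial_iff_ne_bot.2 hbot
    obtain ⟨μ, hμ'⟩ := Module.End.exists_eigenvalue (T.restrict hinv)
    obtain ⟨w, hw⟩ := hμ'.exists_hasEigenvector
    have h1 : T w = μ • (w : E) := congrArg Subtype.val hw.apply_eq_smul
    have h2 : (w : E) ∈ ⨆ μ, T.eigenspace μ :=
      Submodule.mem_iSup_of_mem μ (Module.End.mem_eigenspace_iff.2 h1)
    exact hw.2 (Subtype.ext (inner_self_eq_zero.1 (w.2 _ h2)))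
  have hinternal : DirectSum.IsInternal fun μ : Module.End.Eigenvalues T => T.eigenspace μ := by
    rw [horth.isInternal_iff]
    convert hW using 2
    refine le_antisymm (iSup_le fun μ => le_iSup (fun μ => T.eigenspace μ) (μ : ℂ))
      (iSup_le fun μ => ?_)
    by_cases h : T.HasEigenvalue μ
    · exact le_iSup (fun μ : Module.End.Eigenvalues T => T.eigenspace μ) ⟨μ, h⟩
    · rw [Module.End.hasEigenvalue_iff, not_not] at h
      rw [h]
      exact bot_le
  refine ⟨hinternal.subordinateOrthonormalBasis hn horth,
    fun i => ((hinternal.subordinateOrthonormalBasisIndex hn i horth : Module.End.Eigenvalues T) : ℂ),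
    fun i => ?_⟩
  exact Module.End.mem_eigenspace_iff.1 (hinternal.subordinateOrthonormalBasis_subordinate hn i horth)

open Matrix in
/-- Unitary matrices are unitarily diagonalizable. -/
theorem exists_unitary_diagonalization {n : ℕ} (U : Matrix.unitaryGroup (Fin n) ℂ) :
    ∃ (W : Matrix.unitaryGroup (Fin n) ℂ) (μ : Fin n → Circle),
      ((W⁻¹ * U * W : Matrix.unitaryGroup (Fin n) ℂ) : Matrix (Fin n) (Fin n) ℂ) =
        Matrix.diagonal fun i => (μ i : ℂ) := by
  let L : EuclideanSpace ℂ (Fin n) →ₗᵢ[ℂ] EuclideanSpace ℂ (Fin n) :=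
    (Matrix.toEuclideanLin (U : Matrix (Fin n) (Fin n) ℂ)).isometryOfInner fun x y => by
      rw [← LinearMap.adjoint_inner_left, ← Matrix.toEuclideanLin_conjTranspose_eq_adjoint]
      congr 1
      rw [Matrix.toLpLin_apply, Matrix.toLpLin_apply, Matrix.mulVec_mulVec,
        ← Matrix.star_eq_conjTranspose, Matrix.UnitaryGroup.star_mul_self, Matrix.one_mulVec]
  obtain ⟨b, μ, hb⟩ := exists_orthonormalBasis_eigenvectors (finrank_euclideanSpace_fin) L
  let W : Matrix (Fin n) (Fin n) ℂ := Matrix.of fun i j => b j i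
  have hW : W ∈ Matrix.unitaryGroup (Fin n) ℂ := by
    rw [Matrix.mem_unitaryGroup_iff']
    ext i j
    rw [Matrix.mul_apply, Matrix.one_apply, ← orthonormal_iff_ite.1 b.orthonormal i j,
      PiLp.inner_apply]
    exact Finset.sum_congr rfl fun k _ => mul_comm _ _
  have hUW : (U : Matrix (Fin n) (Fin n) ℂ) * W = W * Matrix.diagonal μ := by
    ext i j
    rw [Matrix.mul_diagonal]
    have := congrArg (fun v : EuclideanSpace ℂ (Fin n) => v i) (hb j)
    change _ = μ j * b j i at this
    exact this.trans (mul_comm _ _)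
  have hd : star W * (U : Matrix (Fin n) (Fin n) ℂ) * W = Matrix.diagonal μ := by
    rw [mul_assoc, hUW, ← mul_assoc, (Matrix.mem_unitaryGroup_iff').1 hW, one_mul]
  have hnorm : ∀ i, ‖μ i‖ = 1 := by
    intro i
    have h : ‖L (b i)‖ = 1 := by rw [L.norm_map, b.norm_eq_one]
    rwa [hb, norm_smul, b.norm_eq_one, mul_one] at h
  exact ⟨⟨W, hW⟩, fun i => ⟨μ i, mem_sphere_zero_iff_norm.2 (hnorm i)⟩, hd⟩

section Kronecker
open Finset

/-- The coefficients of a trigonometric polynomial are bounded by its supremum. -/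
lemma norm_coeff_le_of_eval_le (f : Circle →₀ ℂ) {B : ℝ}
    (hB : ∀ k : ℕ, ‖f.sum fun z c => c * (z : ℂ) ^ k‖ ≤ B) (w : Circle) : ‖f w‖ ≤ B := by
  classical
  by_cases hw : w ∈ f.support
  swap
  · rw [Finsupp.notMem_support_iff.1 hw, norm_zero]
    exact (norm_nonneg _).trans (hB 0)
  set C : ℝ := ∑ z ∈ f.support.erase w, ‖f z‖ * (2 / ‖((w⁻¹ * z : Circle) : ℂ) - 1‖) with hC
  have key : ∀ N : ℕ, N * ‖f w‖ ≤ N * B + C := by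
    intro N
    have h1 : ∑ k ∈ range N, ((w⁻¹ : Circle) : ℂ) ^ k * f.sum (fun z c => c * (z : ℂ) ^ k) =
        N * f w + ∑ z ∈ f.support.erase w, f z * ∑ k ∈ range N, ((w⁻¹ * z : Circle) : ℂ) ^ k := by
      have h2 : ∀ k ∈ range N, ((w⁻¹ : Circle) : ℂ) ^ k * f.sum (fun z c => c * (z : ℂ) ^ k) =
          ∑ z ∈ f.support, f z * ((w⁻¹ * z : Circle) : ℂ) ^ k := by
        intro k _
        rw [Finsupp.sum, Finset.mul_sum]
        refine Finset.sum_congr rfl fun z _ => ?_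
        rw [Circle.coe_mul, mul_pow]
        ring
      rw [Finset.sum_congr rfl h2, Finset.sum_comm, ← Finset.add_sum_erase _ _ hw]
      congr 1
      · rw [inv_mul_cancel]
        simp
      · exact Finset.sum_congr rfl fun z _ => (Finset.mul_sum _ _ _).symm
    have h3 : ‖∑ k ∈ range N, ((w⁻¹ : Circle) : ℂ) ^ k * f.sum (fun z c => c * (z : ℂ) ^ k)‖
        ≤ N * B := by
      refine (norm_sum_le _ _).trans ?_
      calc _ ≤ ∑ k ∈ range N, B := Finset.sum_le_sum fun k _ => by
            rw [norm_mul, norm_pow, Circle.norm_coe, one_pow, one_mul]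
            exact hB k
        _ = N * B := by simp
    have h4 : ‖∑ z ∈ f.support.erase w, f z * ∑ k ∈ range N, ((w⁻¹ * z : Circle) : ℂ) ^ k‖ ≤ C := by
      refine (norm_sum_le _ _).trans (Finset.sum_le_sum fun z hz => ?_)
      rw [norm_mul]
      refine mul_le_mul_of_nonneg_left ?_ (norm_nonneg _)
      have hne : ((w⁻¹ * z : Circle) : ℂ) ≠ 1 := fun h => by
        have : w⁻¹ * z = 1 := Subtype.ext h
        exact (Finset.ne_of_mem_erase hz) (inv_mul_eq_one.1 this).symm
      rw [geom_sum_eq hne, norm_div]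
      refine div_le_div_of_nonneg_right ((norm_sub_le _ _).trans ?_) (norm_nonneg _)
      rw [norm_pow, Circle.norm_coe, one_pow, norm_one]
      norm_num
    have h5 : (N : ℂ) * f w = ∑ k ∈ range N, ((w⁻¹ : Circle) : ℂ) ^ k *
        f.sum (fun z c => c * (z : ℂ) ^ k) -
        ∑ z ∈ f.support.erase w, f z * ∑ k ∈ range N, ((w⁻¹ * z : Circle) : ℂ) ^ k := by
      rw [h1, add_sub_cancel_right]
    calc (N : ℝ) * ‖f w‖ = ‖(N : ℂ) * f w‖ := by rw [norm_mul, Complex.norm_natCast]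
      _ ≤ _ := by rw [h5]; exact (norm_sub_le _ _).trans (add_le_add h3 h4)
  by_contra! hlt
  obtain ⟨N, hN⟩ := exists_nat_gt (C / (‖f w‖ - B))
  rw [div_lt_iff₀ (sub_pos.2 hlt)] at hN
  have := key N
  nlinarith

/-- The number of `p`-fold products from a finite subset of a commutative monoid grows at most
polynomially. -/
lemma card_pow_le_pow_card {M : Type*} [CommMonoid M] [DecidableEq M] (S T : Finset M) (p : ℕ)
    (hT : ∀ x ∈ T, ∃ ν : S → ℕ, (∀ s, ν s ≤ p) ∧ ∏ s : S, (s : M) ^ ν s = x) :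
    T.card ≤ (p + 1) ^ S.card := by
  classical
  have hsub : T ⊆ (univ : Finset (S → Fin (p + 1))).image
      fun ν => ∏ s : S, (s : M) ^ (ν s : ℕ) := by
    intro x hx
    obtain ⟨ν, hν, rfl⟩ := hT x hx
    exact mem_image.2 ⟨fun s => ⟨ν s, Nat.lt_succ_of_le (hν s)⟩, mem_univ _, rfl⟩
  refine (card_le_card hsub).trans (card_image_le.trans ?_)
  simp

lemma exists_exponents_of_mem_support_pow (f : MonoidAlgebra ℂ Circle) (p : ℕ) :
    ∀ x ∈ (f ^ p).coeff.support, ∃ ν : f.coeff.support → ℕ, (∀ s, ν s ≤ p) ∧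
      ∏ s : f.coeff.support, (s : Circle) ^ ν s = x := by
  classical
  induction p with
  | zero =>
    intro x hx
    refine ⟨fun _ => 0, fun _ => le_rfl, ?_⟩
    rw [pow_zero, MonoidAlgebra.one_def] at hx
    have := Finsupp.support_single_subset hx
    rw [Finset.mem_singleton] at this
    simp [this]
  | succ p ih =>
    intro x hx
    rw [pow_succ] at hx
    obtain ⟨y, hy, z, hz, rfl⟩ := Finset.mem_mul.1 (MonoidAlgebra.support_coeff_mul_subset _ _ hx)
    obtain ⟨ν, hν, rfl⟩ := ih y hy
    refine ⟨fun s => ν s + if s = ⟨z, hz⟩ then 1 else 0, fun s => ?_, ?_⟩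
    · have := hν s
      dsimp only
      split_ifs <;> omega
    · simp_rw [pow_add, Finset.prod_mul_distrib]
      congr 1
      simp

/-- A character of the discrete circle group is dominated by the supremum norm of trigonometric
polynomials. -/
lemma norm_lift_le_of_eval_le (h : Circle →* Circle) (f : MonoidAlgebra ℂ Circle) {B : ℝ}
    (hB : ∀ k : ℕ, ‖f.coeff.sum fun z c => c * (z : ℂ) ^ k‖ ≤ B) :
    ‖f.coeff.sum fun z c => c * (h z : ℂ)‖ ≤ B := by
  classical
  have hB0 : 0 ≤ B := (norm_nonneg _).trans (hB 0)
  let ev : (Circle →* Circle) → MonoidAlgebra ℂ Circle →ₐ[ℂ] ℂ := fun h =>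
    MonoidAlgebra.lift ℂ ℂ Circle (Circle.coeHom.comp h)
  have hev : ∀ (h : Circle →* Circle) (f : MonoidAlgebra ℂ Circle),
      ev h f = f.coeff.sum fun z c => c * (h z : ℂ) := fun h f => by
    simp only [ev, MonoidAlgebra.lift_apply, smul_eq_mul]
    rfl
  have hevk : ∀ (k : ℕ) (f : MonoidAlgebra ℂ Circle),
      ev (powMonoidHom k) f = f.coeff.sum fun z c => c * (z : ℂ) ^ k := fun k f => by
    rw [hev]
    simp
  have hpow : ∀ p : ℕ, ‖ev h f‖ ^ p ≤ ((p : ℝ) + 1) ^ f.coeff.support.card * B ^ p := by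
    intro p
    have h1 : ∀ w, ‖(f ^ p).coeff w‖ ≤ B ^ p := norm_coeff_le_of_eval_le _ fun k => by
      rw [← hevk, map_pow, norm_pow, hevk]
      exact pow_le_pow_left₀ (norm_nonneg _) (hB k) _
    rw [← norm_pow, ← map_pow, hev, Finsupp.sum]
    refine (norm_sum_le _ _).trans ?_
    calc _ ≤ ∑ z ∈ (f ^ p).coeff.support, B ^ p := Finset.sum_le_sum fun z _ => by
          rw [norm_mul, Circle.norm_coe, mul_one]
          exact h1 z
      _ = (f ^ p).coeff.support.card * B ^ p := by simp
      _ ≤ _ := by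
        refine mul_le_mul_of_nonneg_right ?_ (pow_nonneg hB0 p)
        exact_mod_cast card_pow_le_pow_card f.coeff.support _ p
          (exists_exponents_of_mem_support_pow f p)
  rw [← hev]
  by_contra! hlt
  have hpos : 0 < ‖ev h f‖ := hB0.trans_lt hlt
  set x := B / ‖ev h f‖ with hx
  have hx0 : 0 ≤ x := div_nonneg hB0 hpos.le
  have hx1 : x < 1 := (div_lt_one hpos).2 hlt
  have hlim := (tendsto_pow_const_mul_const_pow_of_abs_lt_one f.coeff.support.card
    (by rwa [abs_of_nonneg hx0] : |x| < 1)).comp (Filter.tendsto_add_atTop_nat 1)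
  have hge : ∀ p : ℕ, x ≤ ((p + 1 : ℕ) : ℝ) ^ f.coeff.support.card * x ^ (p + 1) := by
    intro p
    have h1 : 1 ≤ ((p : ℝ) + 1) ^ f.coeff.support.card * x ^ p := by
      rw [hx, div_pow, ← mul_div_assoc, le_div_iff₀ (pow_pos hpos p), one_mul]
      exact hpow p
    push_cast
    calc x = 1 * x := (one_mul x).symm
      _ ≤ _ := mul_le_mul_of_nonneg_right h1 hx0
      _ = _ := by ring
  have hxle : x ≤ 0 := ge_of_tendsto' hlim hge
  have hx00 : x = 0 := le_antisymm hxle hx0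
  have hB00 : B = 0 := by
    rw [hx, div_eq_zero_iff] at hx00
    exact hx00.resolve_right hpos.ne'
  have := hpow 1
  rw [hB00] at this
  simp at this
  rw [this] at hpos
  simp at hpos

lemma norm_one_add_le_of_le_norm_sub_one (z : Circle) {ε : ℝ} (hε : 0 ≤ ε)
    (hz : ε ≤ ‖(z : ℂ) - 1‖) : ‖1 + (z : ℂ)‖ ≤ 2 - ε ^ 2 / 4 := by
  have hpar := parallelogram_law_with_norm ℂ (z : ℂ) 1
  rw [Circle.norm_coe, norm_one, add_comm (z : ℂ) 1] at hpar
  have h2 : ‖1 + (z : ℂ)‖ ≤ 2 := (norm_add_le _ _).trans (by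
    rw [Circle.norm_coe, norm_one]
    norm_num)
  have h3 := norm_nonneg (1 + (z : ℂ))
  nlinarith [mul_self_le_mul_self hε hz]

/-- **Kronecker's theorem**: every endomorphism of the discrete circle group is a pointwise limit
of power maps. -/
theorem mem_closure_range_pow (h : Circle →* Circle) :
    (h : Circle → Circle) ∈ closure (Set.range fun (k : ℕ) (z : Circle) => z ^ k) := by
  classical
  rw [mem_closure_iff_nhds]
  intro t ht
  rw [nhds_pi, Filter.mem_pi'] at ht
  obtain ⟨I, U, hU, hIU⟩ := ht
  have hU' : ∃ ε > 0, ∀ z ∈ I, Metric.ball (h z) ε ⊆ U z := by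
    choose r hr0 hr using fun z => Metric.mem_nhds_iff.1 (hU z)
    have hall : ∀ᶠ ε in 𝓝[>] (0 : ℝ), ∀ z ∈ I, ε < r z :=
      (Filter.eventually_all_finset I).2 fun z _ =>
        Filter.mem_of_superset (Ioo_mem_nhdsGT (hr0 z)) fun ε hε => hε.2
    obtain ⟨ε, hε, hε0⟩ := (hall.and self_mem_nhdsWithin).exists
    exact ⟨ε, hε0, fun z hz => (Metric.ball_subset_ball (hε z hz).le).trans (hr z)⟩
  obtain ⟨ε, hε, hεU⟩ := hU'
  suffices ∃ k : ℕ, ∀ z ∈ I, ‖((z ^ k : Circle) : ℂ) - h z‖ < ε by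
    obtain ⟨k, hk⟩ := this
    exact ⟨_, hIU fun z hz => hεU z hz (by
      rw [Metric.mem_ball]
      exact (dist_eq_norm ((z ^ k : Circle) : ℂ) (h z)).trans_lt (hk z hz)), k, rfl⟩
  by_contra! hcon
  let f : MonoidAlgebra ℂ Circle := MonoidAlgebra.single 1 1 +
    ∑ z ∈ I, MonoidAlgebra.single z (((h z)⁻¹ : Circle) : ℂ)
  have hf : ∀ F : Circle →* Circle, (f.coeff.sum fun z c => c * (F z : ℂ)) =
      1 + ∑ z ∈ I, (((h z)⁻¹ * F z : Circle) : ℂ) := by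
    intro F
    have h1 : MonoidAlgebra.lift ℂ ℂ Circle (Circle.coeHom.comp F) f =
        f.coeff.sum fun z c => c * (F z : ℂ) := by
      simp only [MonoidAlgebra.lift_apply, smul_eq_mul]
      rfl
    rw [← h1]
    simp only [f, map_add, map_sum, MonoidAlgebra.lift_single, smul_eq_mul, map_one, mul_one]
    rfl
  have hfh := norm_lift_le_of_eval_le h f (B := (I.card : ℝ) + 1 - ε ^ 2 / 4) fun k => by
    have := hf (powMonoidHom k)
    simp only [powMonoidHom_apply, Circle.coe_pow] at this
    rw [this]
    obtain ⟨w, hw, hwε⟩ := hcon k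
    rw [← Finset.add_sum_erase _ _ hw, ← add_assoc]
    have hcard : ((I.erase w).card : ℝ) = I.card - 1 := by
      rw [Finset.card_erase_of_mem hw, Nat.cast_pred (Finset.card_pos.2 ⟨w, hw⟩)]
    have h1 : ‖∑ z ∈ I.erase w, (((h z)⁻¹ * z ^ k : Circle) : ℂ)‖ ≤ (I.card : ℝ) - 1 := by
      refine (norm_sum_le _ _).trans ?_
      simp only [Circle.norm_coe, Finset.sum_const, nsmul_eq_mul, mul_one]
      exact hcard.le
    have h2 : ‖1 + (((h w)⁻¹ * w ^ k : Circle) : ℂ)‖ ≤ 2 - ε ^ 2 / 4 := by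
      refine norm_one_add_le_of_le_norm_sub_one _ hε.le (hwε.trans_eq ?_)
      have : (((h w)⁻¹ * w ^ k : Circle) : ℂ) - 1 =
          ((h w)⁻¹ : Circle) * (((w ^ k : Circle) : ℂ) - h w) := by
        rw [mul_sub, ← Circle.coe_mul, ← Circle.coe_mul, inv_mul_cancel, Circle.coe_one]
      rw [this, norm_mul, Circle.norm_coe, one_mul]
    exact (norm_add_le _ _).trans (by linarith)
  rw [hf h] at hfh
  simp only [inv_mul_cancel, Circle.coe_one, Finset.sum_const, nsmul_eq_mul, mul_one] at hfh
  have : ‖(1 : ℂ) + I.card‖ = I.card + 1 := by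
    rw [← Nat.cast_one, ← Nat.cast_add, Complex.norm_natCast]
    push_cast
    ring
  rw [this] at hfh
  have := pow_pos hε 2
  linarith

end Kronecker

/-- Elements of infinite order in the circle are detected by homomorphisms to the rationals. -/
lemma exists_rat_hom_ne_zero {z₀ : Circle} (hz₀ : ¬ IsOfFinOrder z₀) :
    ∃ φ : Circle → ℚ, (∀ z w, φ (z * w) = φ z + φ w) ∧ φ z₀ ≠ 0 := by
  have hnot : Complex.arg z₀ ∉ Submodule.span ℚ {2 * Real.pi} := by
    rw [Submodule.mem_span_singleton]
    rintro ⟨q, hq⟩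
    apply hz₀
    rw [isOfFinOrder_iff_pow_eq_one]
    refine ⟨q.den, q.pos, ?_⟩
    rw [← Circle.exp_arg z₀, ← hq, ← Circle.exp_nsmul, ← Circle.exp_zero, Circle.exp_eq_exp]
    refine ⟨q.num, ?_⟩
    rw [Rat.smul_def, nsmul_eq_mul, ← mul_assoc, zero_add]
    congr 1
    have h : (q.den : ℚ) * q = q.num := Rat.den_mul_eq_num q
    exact_mod_cast congrArg (fun x : ℚ => (x : ℝ)) h
  obtain ⟨f, hf, hf0⟩ := Submodule.exists_dual_map_eq_bot_of_notMem hnot inferInstance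
  have h2pi : f (2 * Real.pi) = 0 := by
    have : f (2 * Real.pi) ∈ (Submodule.span ℚ {2 * Real.pi}).map f :=
      Submodule.mem_map_of_mem (Submodule.mem_span_singleton_self _)
    rwa [hf0, Submodule.mem_bot] at this
  refine ⟨fun z => f (Complex.arg z), fun z w => ?_, hf⟩
  have h : Circle.exp (Complex.arg ((z * w : Circle) : ℂ)) =
      Circle.exp (Complex.arg z + Complex.arg w) := by
    rw [Circle.exp_add, Circle.exp_arg, Circle.exp_arg, Circle.exp_arg]
  obtain ⟨m, hm⟩ := Circle.exp_eq_exp.1 h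
  have hm' : (m : ℝ) * (2 * Real.pi) = m • (2 * Real.pi) := (zsmul_eq_mul _ _).symm
  change f (Complex.arg ((z * w : Circle) : ℂ)) = f (Complex.arg z) + f (Complex.arg w)
  rw [hm, map_add, map_add, hm', map_zsmul, h2pi, smul_zero, add_zero]

section Diagonalized
variable {G : Type u} [Group G] [TopologicalSpace G] [IsTopologicalGroup G] [CompactSpace G]
  [T2Space G]

/-- The continuous unitary representations of `G` diagonalizing `a`, together with the
eigenvalues of `a`. -/
structure DiagonalizedRep (a : G) where
  dim : ℕ
  rep : G →* Matrix.unitaryGroup (Fin dim) ℂ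
  continuous_rep : Continuous rep
  eigenvalue : Fin dim → Circle
  rep_apply : (rep a : Matrix (Fin dim) (Fin dim) ℂ) = Matrix.diagonal fun i => (eigenvalue i : ℂ)

/-- Every continuous unitary representation is conjugate to one that diagonalizes `a`. -/
lemma exists_diagonalizedRep (a : G) {n : ℕ} (ρ : G →* Matrix.unitaryGroup (Fin n) ℂ)
    (hρ : Continuous ρ) : ∃ (W : Matrix.unitaryGroup (Fin n) ℂ) (μ : Fin n → Circle)
      (ρ' : G →* Matrix.unitaryGroup (Fin n) ℂ), Continuous ρ' ∧ (∀ g, ρ' g = W⁻¹ * ρ g * W) ∧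
      (ρ' a : Matrix (Fin n) (Fin n) ℂ) = Matrix.diagonal fun i => (μ i : ℂ) := by
  obtain ⟨W, μ, h⟩ := exists_unitary_diagonalization (ρ a)
  refine ⟨W, μ, (MulAut.conj W⁻¹).toMonoidHom.comp ρ, ?_, fun g => ?_, ?_⟩
  · change Continuous fun g => W⁻¹ * ρ g * W⁻¹⁻¹
    fun_prop
  · change W⁻¹ * ρ g * W⁻¹⁻¹ = _
    rw [inv_inv]
  · rw [← h]
    change ((W⁻¹ * ρ a * W⁻¹⁻¹ : Matrix.unitaryGroup (Fin n) ℂ) : Matrix (Fin n) (Fin n) ℂ) = _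
    rw [inv_inv]

lemma eq_of_forall_diagonalizedRep (a : G) {g g' : G}
    (h : ∀ R : DiagonalizedRep a, R.rep g = R.rep g') : g = g' := by
  by_contra hne
  obtain ⟨n, ρ, hρ, hρg⟩ := exists_unitaryRep_ne_one (g := g⁻¹ * g')
    (fun h => hne (inv_mul_eq_one.1 h))
  obtain ⟨W, μ, ρ', hρ', hconj, hμ⟩ := exists_diagonalizedRep a ρ hρ
  have h1 : ρ' g = ρ' g' := h ⟨n, ρ', hρ', μ, hμ⟩
  rw [hconj, hconj, mul_left_inj, mul_right_inj] at h1
  rw [map_mul, map_inv, h1, inv_mul_cancel] at hρg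
  exact hρg rfl

/-- A homomorphism `φ` from the circle to the rationals turns `a` into a homomorphism from the
rational solenoid to the closed submonoid generated by `a`. -/
theorem exists_solenoid_hom (a : G) (φ : Circle → ℚ) (hφ : ∀ z w, φ (z * w) = φ z + φ w) :
    ∃ τ : SolCone → G, ContinuousOn τ {s | s 0 = 1} ∧
      (∀ s s' : SolCone, s 0 = 1 → s' 0 = 1 → τ (s * s') = τ s * τ s') ∧
      (∀ s : SolCone, s 0 = 1 → τ s ∈ closure (Set.range fun k : ℕ => a ^ k)) ∧
      ∀ R : DiagonalizedRep a, ∀ s : SolCone, s 0 = 1 →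
        (R.rep (τ s) : Matrix (Fin R.dim) (Fin R.dim) ℂ) =
          Matrix.diagonal fun i => s (φ (R.eigenvalue i)) := by
  classical
  have hφ1 : φ 1 = 0 := by simpa using hφ 1 1
  have hex : ∀ s : SolCone, ∃ t : G, s 0 = 1 → t ∈ closure (Set.range fun k : ℕ => a ^ k) ∧
      ∀ R : DiagonalizedRep a, (R.rep t : Matrix (Fin R.dim) (Fin R.dim) ℂ) =
          Matrix.diagonal fun i => s (φ (R.eigenvalue i)) := by
    intro s
    by_cases hs : s 0 = 1
    swap
    · exact ⟨1, fun h => absurd h hs⟩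
    let h : Circle →* Circle :=
      { toFun := fun z => ⟨s (φ z), mem_sphere_zero_iff_norm.2 (by rw [s.norm_apply, hs, norm_one])⟩
        map_one' := Circle.ext (by
          change s (φ 1) = 1
          rw [hφ1, hs])
        map_mul' := fun z w => Circle.ext (by
          change s (φ (z * w)) = s (φ z) * s (φ w)
          rw [hφ, SolCone.apply_add hs]) }
    obtain ⟨U, hUr, hU⟩ := mem_closure_iff_ultrafilter.1 (mem_closure_range_pow h)
    have hU' : (Filter.comap (fun (k : ℕ) (z : Circle) => z ^ k) (U : Filter (Circle → Circle))).NeBot :=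
      Filter.NeBot.comap_of_range_mem inferInstance hUr
    let u : Ultrafilter ℕ := Ultrafilter.of (Filter.comap (fun (k : ℕ) (z : Circle) => z ^ k) U)
    have hu : Filter.Tendsto (fun (k : ℕ) (z : Circle) => z ^ k) u (𝓝 h) :=
      (Filter.tendsto_comap.mono_left (Ultrafilter.of_le _)).trans hU
    obtain ⟨t, -, ht⟩ := isCompact_univ.ultrafilter_le_nhds (u.map fun k => a ^ k) (by simp)
    have ht' : Filter.Tendsto (fun k : ℕ => a ^ k) u (𝓝 t) := ht
    refine ⟨t, fun _ => ⟨mem_closure_of_tendsto ht' (Filter.Eventually.of_forall fun k => ⟨k, rfl⟩),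
      fun R => ?_⟩⟩
    have h1 : Filter.Tendsto (fun k : ℕ => (R.rep (a ^ k) : Matrix (Fin R.dim) (Fin R.dim) ℂ)) u
        (𝓝 (R.rep t)) :=
      ((continuous_subtype_val.comp R.continuous_rep).tendsto t).comp ht'
    have h2 : ∀ k : ℕ, (R.rep (a ^ k) : Matrix (Fin R.dim) (Fin R.dim) ℂ) =
        Matrix.diagonal fun i => ((R.eigenvalue i ^ k : Circle) : ℂ) := by
      intro k
      rw [map_pow, SubmonoidClass.coe_pow, R.rep_apply, Matrix.diagonal_pow]
      congr 1
    have hc : Continuous fun f : Circle → Circle =>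
        Matrix.diagonal fun i => ((f (R.eigenvalue i) : Circle) : ℂ) := by
      refine Continuous.matrix_diagonal (continuous_pi fun i => ?_)
      exact continuous_subtype_val.comp (continuous_apply _)
    simp_rw [h2] at h1
    exact tendsto_nhds_unique h1 ((hc.tendsto _).comp hu)
  choose τ hτ using hex
  refine ⟨τ, ?_, fun s s' hs hs' => ?_, fun s hs => (hτ s hs).1, fun R s hs => (hτ s hs).2 R⟩
  · rw [continuousOn_iff_continuous_domRestrict]
    let Φ : G → ∀ R : DiagonalizedRep a, Matrix.unitaryGroup (Fin R.dim) ℂ := fun g R => R.rep g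
    have hΦ : Continuous Φ := continuous_pi fun R => R.continuous_rep
    have hΦi : Function.Injective Φ := fun g g' h =>
      eq_of_forall_diagonalizedRep a fun R => congrFun h R
    rw [(hΦ.isClosedEmbedding hΦi).isInducing.continuous_iff]
    refine continuous_pi fun R => ?_
    rw [continuous_induced_rng]
    have : (Subtype.val ∘ fun s : {s : SolCone | s 0 = 1} => (Φ ∘ {s : SolCone | s 0 = 1}.domRestrict τ) s R) =
        fun s : {s : SolCone | s 0 = 1} => Matrix.diagonal fun i => (s : SolCone) (φ (R.eigenvalue i)) :=
      funext fun s => (hτ s s.2).2 R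
    rw [this]
    exact Continuous.matrix_diagonal (continuous_pi fun i =>
      (SolCone.continuous_apply _).comp continuous_subtype_val)
  · refine eq_of_forall_diagonalizedRep a fun R => Subtype.ext ?_
    rw [map_mul, Submonoid.coe_mul, (hτ _ (SolCone.mul_apply_zero hs hs')).2 R, (hτ s hs).2 R,
      (hτ s' hs').2 R, Matrix.diagonal_mul_diagonal]
    rfl

end Diagonalized

section EquivariantExtension
variable {G : Type u} [Group G] [TopologicalSpace G] [IsTopologicalGroup G]

lemma exists_small_extension_of_isClosedEmbedding [CompactSpace G] [T2Space G] (hG : IsANE4 G)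
    {X Y : Type} [TopologicalSpace X] [CompactSpace X] [T2Space X] [TopologicalSpace Y]
    (hX : HasThinPartitions.{u} X) {e : Y → X} (he : IsClosedEmbedding e) {V : Set G}
    (hV : V ∈ 𝓝 (1 : G)) :
    ∃ V' ∈ 𝓝 (1 : G), ∀ (K : Set Y) (f : Y → G), IsClosed K → ContinuousOn f K →
      (∀ y ∈ K, f y ∈ V') → ∃ F : C(Y, G), (∀ y, F y ∈ V) ∧ ∀ y ∈ K, F y = f y := by
  obtain ⟨V', hV', H⟩ := exists_small_extension hG hX hV
  refine ⟨V', hV', fun K f hK hf hfV => ?_⟩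
  have hext : ∀ y, Function.extend e f (fun _ => 1) (e y) = f y := he.injective.extend_apply f _
  obtain ⟨F, hFV, hF⟩ := H (e '' K) (Function.extend e f fun _ => 1) (he.isClosedMap K hK) (by
      rintro _ ⟨y, hy, rfl⟩
      rw [ContinuousWithinAt, ← he.isInducing.map_nhdsWithin_eq, Filter.tendsto_map'_iff, hext]
      exact (hf y hy).tendsto.congr fun y => (hext y).symm) (by
      rintro _ ⟨y, hy, rfl⟩
      rw [hext]
      exact hfV y hy)
  exact ⟨F.comp ⟨e, he.continuous⟩, fun y => hFV _, fun y hy =>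
    (hF _ ⟨y, hy, rfl⟩).trans (hext y)⟩

lemma isClosedEmbedding_prodMk_one :
    IsClosedEmbedding fun x : SolCone => (x, (1 : SolCone)) :=
  (Continuous.prodMk_left (1 : SolCone)).isClosedEmbedding fun _ _ h => congrArg Prod.fst h

variable {X : Type*} [CommMonoid X] [TopologicalSpace X]

open Classical in
/-- Extension over a product with the cone over the solenoid, by equivariance over the base of the
cone. -/
noncomputable def equivariantExtension (δ : SolCone →* X) (f : C(X, G)) (g : C(SolCone, G))
    (p : X × SolCone) : G :=
  if p.2 0 = 1 then f (p.1 * δ p.2.conj) * g p.2 else f p.1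

variable {δ : SolCone →* X} {f : C(X, G)} {g : C(SolCone, G)} {τ : SolCone → G} {K : Set X}

lemma equivariantExtension_eq_of_mem (hτ : ∀ s s' : SolCone, s 0 = 1 → s' 0 = 1 →
    τ (s * s') = τ s * τ s') (hg : ∀ s : SolCone, s 0 = 1 → g s = τ s)
    (hf : ∀ x ∈ K, ∀ s : SolCone, s 0 = 1 → f (x * δ s) = f x * τ s) {p : X × SolCone}
    (hp : p.1 ∈ K) : equivariantExtension δ f g p = f p.1 := by
  unfold equivariantExtension
  split_ifs with h
  · have hc := SolCone.conj_apply_zero h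
    rw [hf _ hp _ hc, hg _ h, mul_assoc, ← hτ _ _ hc h, mul_comm p.2.conj, SolCone.mul_conj h,
      ← hf _ hp 1 rfl, map_one, mul_one]
  · rfl

lemma continuousOn_equivariantExtension [ContinuousMul X] (hδ : Continuous δ)
    (hτ : ∀ s s' : SolCone, s 0 = 1 → s' 0 = 1 →
    τ (s * s') = τ s * τ s') (hg : ∀ s : SolCone, s 0 = 1 → g s = τ s)
    (hf : ∀ x ∈ K, ∀ s : SolCone, s 0 = 1 → f (x * δ s) = f x * τ s) (hK : IsClosed K) :
    ContinuousOn (equivariantExtension δ f g) {p | p.1 ∈ K ∨ p.2 0 = 1} := by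
  have h1 : ContinuousOn (equivariantExtension δ f g) {p | p.1 ∈ K} :=
    (f.continuous.comp continuous_fst).continuousOn.congr fun p hp =>
      equivariantExtension_eq_of_mem hτ hg hf hp
  have h2 : ContinuousOn (equivariantExtension δ f g) {p | p.2 0 = 1} := by
    have : Continuous fun p : X × SolCone => f (p.1 * δ p.2.conj) * g p.2 :=
      (f.continuous.comp (continuous_fst.mul (hδ.comp (SolCone.continuous_conj.comp
        continuous_snd)))).mul (g.continuous.comp continuous_snd)
    exact this.continuousOn.congr fun p hp => if_pos hp
  exact h1.union_of_isClosed h2 (hK.preimage continuous_fst)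
    (isClosed_eq ((SolCone.continuous_apply 0).comp continuous_snd) continuous_const)

lemma equivariantExtension_mul
    (hτ : ∀ s s' : SolCone, s 0 = 1 → s' 0 = 1 →
    τ (s * s') = τ s * τ s') (hg : ∀ s : SolCone, s 0 = 1 → g s = τ s)
    (hf : ∀ x ∈ K, ∀ s : SolCone, s 0 = 1 → f (x * δ s) = f x * τ s)
    {p : X × SolCone} (hp : p.1 ∈ K ∨ p.2 0 = 1) {s : SolCone} (hs : s 0 = 1) :
    equivariantExtension δ f g (p.1 * δ s, p.2 * s) = equivariantExtension δ f g p * τ s := by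
  by_cases h : p.2 0 = 1
  · have h' := SolCone.mul_apply_zero h hs
    have hx : p.1 * δ s * δ (p.2 * s).conj = p.1 * δ p.2.conj := by
      rw [mul_assoc, ← map_mul, SolCone.conj_mul, mul_left_comm, SolCone.mul_conj hs, mul_one]
    simp only [equivariantExtension, if_pos h, if_pos h']
    rw [hx, hg _ h', hg _ h, hτ _ _ h hs, mul_assoc]
  · have h' : ¬ (p.2 * s) 0 = 1 := by rwa [SolCone.mul_apply, hs, mul_one]
    simp only [equivariantExtension, if_neg h, if_neg h']
    exact hf _ (hp.resolve_right h) s hs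

end EquivariantExtension

/-- In a compact group that is an ANE(4)-space, elements of small closed subgroups act with
eigenvalues of finite order in every unitary representation. -/
theorem exists_nhds_isOfFinOrder_eigenvalue {G : Type u} [Group G] [TopologicalSpace G]
    [IsTopologicalGroup G] [CompactSpace G] [T2Space G] (hG : IsANE4 G) :
    ∃ V ∈ 𝓝 (1 : G), ∀ N : Subgroup G, IsClosed (N : Set G) → (N : Set G) ⊆ V → ∀ a ∈ N,
      ∀ (R : DiagonalizedRep a) (i : Fin R.dim), IsOfFinOrder (R.eigenvalue i) := by
  obtain ⟨V₂, hV₂, H₂⟩ := exists_small_extension hG SolCone.hasThinPartitions_prod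
    (V := Set.univ) Filter.univ_mem
  obtain ⟨V₁, hV₁, hV₁₂⟩ := exists_nhds_one_split hV₂
  obtain ⟨V₀, hV₀, H₁⟩ := exists_small_extension_of_isClosedEmbedding hG
    SolCone.hasThinPartitions_prod isClosedEmbedding_prodMk_one hV₁
  refine ⟨V₀, hV₀, fun N hN hNV a ha R i₀ => ?_⟩
  by_contra hi₀
  obtain ⟨φ, hφ, hφ0, hφsum⟩ : ∃ φ : Circle → ℚ, (∀ z w, φ (z * w) = φ z + φ w) ∧
      φ (R.eigenvalue i₀) ≠ 0 ∧ ∑ i, φ (R.eigenvalue i) ≤ 0 := by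
    obtain ⟨φ, hφ, hφ0⟩ := exists_rat_hom_ne_zero hi₀
    rcases le_total (∑ i, φ (R.eigenvalue i)) 0 with h | h
    · exact ⟨φ, hφ, hφ0, h⟩
    · refine ⟨fun z => -φ z, fun z w => ?_, neg_ne_zero.2 hφ0, ?_⟩
      · change -φ (z * w) = -φ z + -φ w
        rw [hφ, neg_add]
      · rw [Finset.sum_neg_distrib]
        exact neg_nonpos.2 h
  obtain ⟨τ, hτc, hτ, hτa, hτR⟩ := exists_solenoid_hom a φ hφ
  have hτN : ∀ s : SolCone, s 0 = 1 → τ s ∈ N := fun s hs =>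
    closure_minimal (Set.range_subset_iff.2 fun k => N.pow_mem ha k) hN (hτa s hs)
  have hK₁ : IsClosed {s : SolCone | s 0 = 1} :=
    isClosed_eq (SolCone.continuous_apply 0) continuous_const
  obtain ⟨g, hgV, hg⟩ := H₁ {s | s 0 = 1} τ hK₁ hτc fun s hs => hNV (hτN s hs)
  have hg1 : ∀ x ∈ {s : SolCone | s 0 = 1}, ∀ s : SolCone, s 0 = 1 →
      g (x * MonoidHom.id SolCone s) = g x * τ s := fun x hx s hs => by
    rw [MonoidHom.id_apply, hg _ (SolCone.mul_apply_zero hx hs), hg x hx, hτ x s hx hs]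
  obtain ⟨f, -, hf⟩ := H₂ {p | p.1 0 = 1 ∨ p.2 0 = 1}
    (equivariantExtension (MonoidHom.id SolCone) g g)
    ((hK₁.preimage continuous_fst).union (hK₁.preimage continuous_snd))
    (continuousOn_equivariantExtension continuous_id hτ hg hg1 hK₁) fun p _ => by
      unfold equivariantExtension
      split_ifs
      · exact hV₁₂ _ (hgV _) _ (hgV _)
      · simpa using hV₁₂ _ (hgV p.1) _ (mem_of_mem_nhds hV₁)
  let δ : SolCone →* SolCone × SolCone := (MonoidHom.id SolCone).prod (MonoidHom.id SolCone)
  have hδ : Continuous δ := continuous_id.prodMk continuous_id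
  set K₂ : Set (SolCone × SolCone) := {p | p.1 0 = 1 ∨ p.2 0 = 1} with hK₂
  have hK₂c : IsClosed K₂ := (hK₁.preimage continuous_fst).union (hK₁.preimage continuous_snd)
  have hf2 : ∀ p ∈ K₂, ∀ s : SolCone, s 0 = 1 → f (p * δ s) = f p * τ s := by
    intro p hp s hs
    have hps : p * δ s ∈ K₂ := hp.imp (fun h => SolCone.mul_apply_zero h hs)
      (fun h => SolCone.mul_apply_zero h hs)
    rw [hf _ hps, hf _ hp]
    exact equivariantExtension_mul hτ hg hg1 hp hs
  let F : (Fin 3 → SolCone) → G := fun x => equivariantExtension δ f g ((x 0, x 1), x 2)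
  have hmem : ∀ x ∈ conesBoundary, (x 0, x 1) ∈ K₂ ∨ x 2 0 = 1 := by
    rintro x ⟨l, hl⟩
    fin_cases l
    · exact Or.inl (Or.inl hl)
    · exact Or.inl (Or.inr hl)
    · exact Or.inr hl
  have hFc : ContinuousOn F conesBoundary :=
    (continuousOn_equivariantExtension hδ hτ hg hf2 hK₂c).comp
      (((continuous_apply 0).prodMk (continuous_apply 1)).prodMk
        (continuous_apply 2)).continuousOn hmem
  have hFe : ∀ x ∈ conesBoundary, ∀ s : SolCone, s 0 = 1 → F (fun l => x l * s) = F x * τ s :=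
    fun x hx s hs => equivariantExtension_mul (p := ((x 0, x 1), x 2)) hτ hg hf2 (hmem x hx) hs
  refine false_of_equivariant_unitary (fun i => φ (R.eigenvalue i)) hφsum
    (fun h => hφ0 (congrFun h i₀)) (fun x => R.rep (F x))
    ((continuous_subtype_val.comp R.continuous_rep).comp_continuousOn hFc)
    (fun x _ => (R.rep (F x)).2) fun x hx s hs j i => ?_
  rw [hFe x hx s hs, map_mul, Submonoid.coe_mul, hτR R s hs, Matrix.mul_diagonal]

section Metrizability
variable {G : Type u} [Group G] [TopologicalSpace G] [IsTopologicalGroup G] [CompactSpace G]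
  [T2Space G]

/-- The common kernel of finitely many unitary representations can be made arbitrarily small. -/
lemma exists_unitaryRep_ker_subset {V : Set G} (hV : V ∈ 𝓝 (1 : G)) :
    ∃ (ι : Type u) (_ : Finite ι) (n : ι → ℕ) (q : G →* ∀ i, Matrix.unitaryGroup (Fin (n i)) ℂ),
      Continuous q ∧ (q.ker : Set G) ⊆ V := by
  have hex : ∀ g : G, ∃ (n : ℕ) (ρ : G →* Matrix.unitaryGroup (Fin n) ℂ),
      Continuous ρ ∧ (g ≠ 1 → ρ g ≠ 1) := by
    intro g
    by_cases hg : g = 1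
    · exact ⟨0, 1, continuous_const, fun h => absurd hg h⟩
    · obtain ⟨n, ρ, hρ, h⟩ := exists_unitaryRep_ne_one hg
      exact ⟨n, ρ, hρ, fun _ => h⟩
  choose n ρ hρ hρg using hex
  have hK : IsCompact (interior V)ᶜ := isOpen_interior.isClosed_compl.isCompact
  obtain ⟨t, -, ht⟩ := hK.elim_nhds_subcover (fun g => {x | ρ g x ≠ 1}) fun g hg =>
    (isOpen_ne_fun (hρ g) continuous_const).mem_nhds
      (hρg g fun h => hg (h ▸ mem_interior_iff_mem_nhds.2 hV))
  refine ⟨t, inferInstance, fun i => n i, MonoidHom.pi fun i : t => ρ i,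
    continuous_pi fun i => hρ i, fun g hg => ?_⟩
  by_contra hgV
  obtain ⟨x, hx, hxg⟩ := Set.mem_iUnion₂.1 (ht fun h => hgV (interior_subset h))
  exact hxg (congrFun (MonoidHom.mem_ker.1 hg) ⟨x, hx⟩)

variable {Y : Type v} [Group Y] [TopologicalSpace Y] [IsTopologicalGroup Y] [T2Space Y]

/-- Near a totally disconnected kernel, the group splits into a small part and the rest. -/
lemma exists_separation_of_isTotallyDisconnected_ker {q : G →* Y} (hq : Continuous q)
    (hN : IsTotallyDisconnected (q.ker : Set G)) {W : Set G} (hW : W ∈ 𝓝 (1 : G)) :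
    ∃ O₁ O₂ : Set G, ∃ B : Set Y, IsOpen O₁ ∧ IsOpen O₂ ∧ Disjoint O₁ O₂ ∧ (1 : G) ∈ O₁ ∧
      O₁ ⊆ W ∧ IsOpen B ∧ (1 : Y) ∈ B ∧ q ⁻¹' B ⊆ O₁ ∪ O₂ := by
  have : TotallyDisconnectedSpace (q.ker : Set G) := totallyDisconnectedSpace_subtype_iff.2 hN
  have hNc : IsClosed (q.ker : Set G) := isClosed_singleton.preimage hq
  have : CompactSpace (q.ker : Set G) :=
    isCompact_iff_compactSpace.1 hNc.isCompact
  obtain ⟨Q, hQ, h1Q, hQW⟩ := compact_exists_isClopen_in_isOpen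
    (X := (q.ker : Set G)) (x := ⟨1, q.ker.one_mem⟩) (isOpen_interior.preimage continuous_subtype_val)
    (mem_interior_iff_mem_nhds.2 hW)
  obtain ⟨O₁, O₂, hO₁, hO₂, hQ₁, hQ₂, hd⟩ := SeparatedNhds.of_isCompact_isCompact
    (hQ.isClosed.isCompact.image continuous_subtype_val)
    (hQ.compl.isClosed.isCompact.image continuous_subtype_val)
    ((Set.disjoint_image_iff Subtype.val_injective).2 disjoint_compl_right)
  refine ⟨O₁ ∩ interior W, O₂, (q '' ((O₁ ∩ interior W) ∪ O₂)ᶜ)ᶜ, hO₁.inter isOpen_interior, hO₂,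
    hd.mono_left Set.inter_subset_left, ⟨hQ₁ ⟨_, h1Q, rfl⟩, hQW h1Q⟩,
    Set.inter_subset_right.trans interior_subset,
    (hq.isClosedMap _ ((hO₁.inter isOpen_interior).union hO₂).isClosed_compl).isOpen_compl, ?_, ?_⟩
  · rintro ⟨g, hg, hg1⟩
    apply hg
    by_cases hgQ : (⟨g, hg1⟩ : (q.ker : Set G)) ∈ Q
    · exact Or.inl ⟨hQ₁ ⟨_, hgQ, rfl⟩, hQW hgQ⟩
    · exact Or.inr (hQ₂ ⟨_, hgQ, rfl⟩)
  · intro g hg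
    by_contra h
    exact hg ⟨g, h, rfl⟩

/-- Paths from `1` depend continuously on their images modulo a totally disconnected kernel. -/
lemma exists_isOpen_forall_path_mem {q : G →* Y} (hq : Continuous q)
    (hN : IsTotallyDisconnected (q.ker : Set G)) {γ₀ : C(unitInterval, G)} (hγ₀ : γ₀ 0 = 1)
    {W : Set G} (hW : W ∈ 𝓝 (γ₀ 1)) :
    ∃ O : Set C(unitInterval, Y), IsOpen O ∧ (ContinuousMap.mk q hq).comp γ₀ ∈ O ∧
      ∀ γ : C(unitInterval, G), γ 0 = 1 → (ContinuousMap.mk q hq).comp γ ∈ O → γ 1 ∈ W := by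
  have hW' : (fun g => γ₀ 1 * g) ⁻¹' W ∈ 𝓝 (1 : G) := by
    refine (continuous_const_mul (γ₀ 1)).continuousAt.preimage_mem_nhds ?_
    rwa [mul_one]
  obtain ⟨O₁, O₂, B, hO₁, hO₂, hd, h1, hO₁W, hB, h1B, hqB⟩ :=
    exists_separation_of_isTotallyDisconnected_ker hq hN hW'
  refine ⟨(fun η => ((ContinuousMap.mk q hq).comp γ₀)⁻¹ * η) ⁻¹' {f | Set.MapsTo f Set.univ B},
    (ContinuousMap.isOpen_setOfPred_mapsTo isCompact_univ hB).preimage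
      (continuous_const_mul _), fun t _ => ?_, fun γ hγ h => ?_⟩
  · simpa using h1B
  · let r : unitInterval → G := fun t => (γ₀ t)⁻¹ * γ t
    have hr : Continuous r := γ₀.continuous.inv.mul γ.continuous
    have hrs : Set.range r ⊆ O₁ ∪ O₂ := by
      rintro _ ⟨t, rfl⟩
      apply hqB
      have := h (Set.mem_univ t)
      simpa [r] using this
    have h0 : r 0 ∈ O₁ := by simpa [r, hγ, hγ₀] using h1
    have := hO₁W ((isPreconnected_range hr).subset_left_of_subset_union hO₁ hO₂ hd hrs
      ⟨r 0, ⟨0, rfl⟩, h0⟩ ⟨1, rfl⟩)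
    simpa [r] using this

/-- A compact group is metrizable if points near `1` are joined to `1` by paths and some
homomorphism to a second countable group has totally disconnected kernel. -/
theorem metrizableSpace_of_isTotallyDisconnected_ker [SecondCountableTopology Y] {q : G →* Y}
    (hq : Continuous q) (hN : IsTotallyDisconnected (q.ker : Set G))
    (hG : ∀ᶠ g in 𝓝 (1 : G), ∃ γ : C(unitInterval, G), γ 0 = 1 ∧ γ 1 = g) :
    TopologicalSpace.MetrizableSpace G := by
  let P := {γ : C(unitInterval, G) // γ 0 = 1 ∧ γ 1 ≠ 1}
  have hex : ∀ γ : P, ∃ (A : Set G) (O : Set C(unitInterval, Y)), A ∈ 𝓝 (1 : G) ∧ IsOpen O ∧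
      (ContinuousMap.mk q hq).comp γ.1 ∈ O ∧
      ∀ γ' : C(unitInterval, G), γ' 0 = 1 → (ContinuousMap.mk q hq).comp γ' ∈ O →
        Aᶜ ∈ 𝓝 (γ' 1) := by
    intro γ
    obtain ⟨U, A, hU, hA, hγU, h1A, hd⟩ := t2_separation γ.2.2
    obtain ⟨O, hO, hγO, h⟩ := exists_isOpen_forall_path_mem hq hN γ.2.1 (hU.mem_nhds hγU)
    exact ⟨A, O, hA.mem_nhds h1A, hO, hγO, fun γ' h0 h' =>
      Filter.mem_of_superset (hU.mem_nhds (h γ' h0 h')) hd.subset_compl_right⟩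
  choose A O hA hO hγO h using hex
  obtain ⟨T, hT, hTO⟩ := TopologicalSpace.isOpen_iUnion_countable O hO
  obtain ⟨A₀, hA₀, hA₀c, hA₀P⟩ := exists_mem_nhds_isClosed_subset hG
  have : Countable T := hT
  have hnhds : 𝓝 (1 : G) = (⨅ γ : T, Filter.principal (A γ)) ⊓ Filter.principal A₀ := by
    refine le_antisymm (le_inf (le_iInf fun γ => Filter.le_principal_iff.2 (hA γ))
      (Filter.le_principal_iff.2 hA₀)) (le_nhds_of_unique_clusterPt fun x hx => ?_)
    by_contra hx1
    have hxA₀ : x ∈ A₀ := by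
      rw [← hA₀c.closure_eq]
      exact mem_closure_iff_clusterPt.2 (hx.mono inf_le_right)
    obtain ⟨γ, hγ0, hγ1⟩ := hA₀P hxA₀
    let p : P := ⟨γ, hγ0, hγ1 ▸ hx1⟩
    have hp : (ContinuousMap.mk q hq).comp γ ∈ ⋃ i ∈ T, O i :=
      hTO ▸ Set.mem_iUnion.2 ⟨p, hγO p⟩
    obtain ⟨i, hi, hpi⟩ := Set.mem_iUnion₂.1 hp
    have h1 := h i γ hγ0 hpi
    rw [hγ1] at h1
    have h2 : ClusterPt x (Filter.principal (A i)) :=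
      hx.mono (inf_le_left.trans (iInf_le _ (⟨i, hi⟩ : T)))
    obtain ⟨y, hy, hy'⟩ := clusterPt_principal_iff.1 h2 _ h1
    exact hy hy'
  let _ : UniformSpace G := IsTopologicalGroup.rightUniformSpace G
  have : (𝓝 (1 : G)).IsCountablyGenerated := by
    rw [hnhds]
    infer_instance
  have : (uniformity G).IsCountablyGenerated := by
    change (Filter.comap _ (𝓝 (1 : G))).IsCountablyGenerated
    infer_instance
  exact UniformSpace.metrizableSpace

/-- The torsion elements of the circle form a countable set. -/
lemma countable_isOfFinOrder_circle : {z : Circle | IsOfFinOrder z}.Countable := by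
  have h : {z : Circle | IsOfFinOrder z} ⊆ ⋃ n : ℕ, {z : Circle | z ^ (n + 1) = 1} := by
    intro z hz
    obtain ⟨n, hn, h⟩ := isOfFinOrder_iff_pow_eq_one.1 hz
    refine Set.mem_iUnion.2 ⟨n - 1, ?_⟩
    change z ^ (n - 1 + 1) = 1
    rwa [Nat.sub_add_cancel hn]
  refine (Set.countable_iUnion fun n => Set.Finite.countable ?_).mono h
  refine Set.Finite.of_finite_image (f := ((↑) : Circle → ℂ))
    (((Polynomial.nthRootsFinset (n + 1) (1 : ℂ)).finite_toSet).subset ?_)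
    Subtype.val_injective.injOn
  rintro _ ⟨z, hz, rfl⟩
  rw [Finset.mem_coe, Polynomial.mem_nthRootsFinset n.succ_pos]
  exact_mod_cast congrArg ((↑) : Circle → ℂ) hz

lemma eq_one_of_sum_circle_eq {n : ℕ} {μ : Fin n → Circle} (h : ∑ i, (μ i : ℂ) = n) (i : Fin n) :
    μ i = 1 := by
  have hle : ∀ j, ((μ j : ℂ)).re ≤ 1 := fun j =>
    (Complex.re_le_norm _).trans (Circle.norm_coe _).le
  have hre : ∑ j, (1 - ((μ j : ℂ)).re) = 0 := by
    have := congrArg Complex.re h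
    rw [Complex.re_sum, Complex.natCast_re] at this
    rw [Finset.sum_sub_distrib, this]
    simp
  have h1 : ((μ i : ℂ)).re = 1 := by
    have := (Finset.sum_eq_zero_iff_of_nonneg fun j _ => sub_nonneg.2 (hle j)).1 hre i
      (Finset.mem_univ i)
    linarith
  have h2 := Circle.normSq_coe (μ i)
  rw [Complex.normSq_apply, h1] at h2
  refine Circle.ext (Complex.ext (by simpa using h1) ?_)
  have : ((μ i : ℂ)).im = 0 := by nlinarith
  simpa using this

/-- A subgroup on which all unitary representations have eigenvalues of finite order is totally
disconnected. -/
lemma isTotallyDisconnected_of_isOfFinOrder_eigenvalue {N : Subgroup G}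
    (hN : ∀ a ∈ N, ∀ (R : DiagonalizedRep a) (i : Fin R.dim), IsOfFinOrder (R.eigenvalue i)) :
    IsTotallyDisconnected (N : Set G) := by
  intro t htN ht x hx y hy
  rw [← inv_mul_eq_one]
  by_contra hne
  obtain ⟨n, ρ, hρ, hρg⟩ := exists_unitaryRep_ne_one hne
  have htr : ∀ g : G, ∃ R : DiagonalizedRep g, ∃ hR : R.dim = n,
      (ρ g : Matrix (Fin n) (Fin n) ℂ).trace = ∑ i, (R.eigenvalue i : ℂ) ∧
      ((∀ i, R.eigenvalue i = 1) → ρ g = 1) := by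
    intro g
    obtain ⟨W, μ, ρ', hρ', hconj, hμ⟩ := exists_diagonalizedRep g ρ hρ
    refine ⟨⟨n, ρ', hρ', μ, hμ⟩, rfl, ?_, fun h => ?_⟩
    · have h1 : ρ g = W * ρ' g * W⁻¹ := by
        rw [hconj]
        group
      rw [h1, Submonoid.coe_mul, Matrix.trace_mul_comm, ← Submonoid.coe_mul, inv_mul_cancel_left,
        hμ, Matrix.trace_diagonal]
    · have h1 : ρ' g = 1 := Subtype.ext (by
        rw [hμ]
        simp only at h
        simp [h])
      rw [hconj, mul_assoc, inv_mul_eq_one] at h1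
      exact mul_eq_right.1 h1.symm
  let f : G → ℂ := fun g => (ρ (x⁻¹ * g) : Matrix (Fin n) (Fin n) ℂ).trace
  have hf : Continuous f :=
    (continuous_subtype_val.comp (hρ.comp (continuous_const_mul x⁻¹))).matrix_trace
  let C : Set ℂ := Set.range fun μ : Fin n → {z : Circle | IsOfFinOrder z} => ∑ i, ((μ i : Circle) : ℂ)
  have hC : C.Countable := by
    have : Countable {z : Circle | IsOfFinOrder z} := countable_isOfFinOrder_circle
    exact Set.countable_range _
  have hfC : f '' t ⊆ C := by
    rintro _ ⟨g, hg, rfl⟩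
    obtain ⟨R, hR, htrace, -⟩ := htr (x⁻¹ * g)
    have hfin := hN _ (N.mul_mem (N.inv_mem (htN hx)) (htN hg)) R
    obtain ⟨d, rep, hrep, μ, hμ⟩ := R
    obtain rfl : d = n := hR
    exact ⟨fun i => ⟨μ i, hfin i⟩, htrace.symm⟩
  have hxy : f x = f y := hC.isTotallyDisconnected _ hfC (ht.image f hf.continuousOn)
    ⟨x, hx, rfl⟩ ⟨y, hy, rfl⟩
  have hfx : f x = n := by simp [f]
  obtain ⟨R, hR, htrace, h1⟩ := htr (x⁻¹ * y)
  obtain ⟨d, rep, hrep, μ, hμ⟩ := R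
  obtain rfl : d = n := hR
  exact hρg (h1 fun i => eq_one_of_sum_circle_eq (htrace.symm.trans (hxy.symm.trans hfx)) i)

lemma isClosedEmbedding_solCone_mk :
    IsClosedEmbedding fun t : unitInterval => (SolCone.mk t 0, (1 : SolCone)) := by
  refine Continuous.isClosedEmbedding ?_ fun t t' h => ?_
  · refine Continuous.prodMk (SolCone.continuous_iff.2 fun q => ?_) continuous_const
    simp only [SolCone.mk_apply]
    fun_prop
  · have := congrArg (fun p : SolCone × SolCone => p.1 0) h
    simp only [SolCone.mk_apply] at this
    exact Subtype.ext (by simpa using this)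

/-- Points near `1` in an ANE(4) compact group are joined to `1` by paths. -/
lemma IsANE4.eventually_exists_path (hG : IsANE4 G) :
    ∀ᶠ g in 𝓝 (1 : G), ∃ γ : C(unitInterval, G), γ 0 = 1 ∧ γ 1 = g := by
  classical
  obtain ⟨V, hV, h⟩ := exists_small_extension_of_isClosedEmbedding hG
    SolCone.hasThinPartitions_prod isClosedEmbedding_solCone_mk (V := Set.univ) Filter.univ_mem
  filter_upwards [hV] with g hg
  obtain ⟨γ, -, hγ⟩ := h {0, 1} (fun t => if t = 0 then 1 else g)
    (Set.toFinite _).isClosed ((Set.toFinite _).continuousOn _) fun t _ => by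
      split_ifs
      · exact mem_of_mem_nhds hV
      · exact hg
  exact ⟨γ, by simpa using hγ 0 (by simp), by simpa using hγ 1 (by simp)⟩

end Metrizability

/-- Every compact Hausdorff topological group whose underlying space is an
ANE(4)-space is metrizable. -/
theorem compact_ANE4_group_metrizable (G : Type u) [Group G]
    [TopologicalSpace G] [IsTopologicalGroup G] [CompactSpace G] [T2Space G]
    (h : IsANE4 G) :
    TopologicalSpace.MetrizableSpace G := by
  obtain ⟨V, hV, hfin⟩ := exists_nhds_isOfFinOrder_eigenvalue h
  obtain ⟨ι, _, n, q, hq, hqV⟩ := exists_unitaryRep_ker_subset hV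
  have : ∀ m : ℕ, SecondCountableTopology (Matrix.unitaryGroup (Fin m) ℂ) := fun m =>
    have : SecondCountableTopology (Matrix (Fin m) (Fin m) ℂ) :=
      inferInstanceAs (SecondCountableTopology (Fin m → Fin m → ℂ))
    IsInducing.subtypeVal.secondCountableTopology
  exact metrizableSpace_of_isTotallyDisconnected_ker hq
    (isTotallyDisconnected_of_isOfFinOrder_eigenvalue
      (hfin q.ker (isClosed_singleton.preimage hq) hqV)) h.eventually_exists_path
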